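/- For every integer k ≥ 2 there exist an integer C₀ and constants α, β ∈ (0,1) such that the following holds. If G is a graph on n ≥ C₀k vertices with minimum degree δ(G) ≥ n/2 + k, then for any k pairwise vertex-disjoint edges e_1, …, e_k in G and for any integer partition n = n_1 + ⋯ + n_k with n_i ≥ 5 for each i ∈ {1, …, k} and with the sum of those n_i that are less than βn at most αn, G contains k vertex-disjoint cycles C_1, …, C_k of orders n_1, …, n_k respectively, such that the cycle C_i passes through the edge e_i for all 1 ≤ i ≤ k. -/

import Mathlib

open scoped Classical

/-- `c` is a cycle in the graph `G`, recorded as the list of its vertices in cyclic order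
(the closing edge joins the last vertex back to the first). -/
def IsCycleListGraph {V : Type*} (G : SimpleGraph V) (c : List V) : Prop :=
  c ≠ [] ∧ c.Nodup ∧ c.Chain' G.Adj ∧ ∀ h : c ≠ [], G.Adj (c.getLast h) (c.head h)

namespace W
section
variable {V : Type}

/-- enumeration of `R` -/
def En (R : Finset V) (q : ℕ → V) : Prop :=
  (∀ i, i < R.card → q i ∈ R) ∧ (∀ i j, i < R.card → j < R.card → q i = q j → i = j)

/-- Hamilton path of `H` on `R` from `u` to `v` -/
def HP (H : SimpleGraph V) (R : Finset V) (u v : V) : Prop :=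
  ∃ f : ℕ → V, En R f ∧ (∀ i, i + 1 < R.card → H.Adj (f i) (f (i+1))) ∧
    f 0 = u ∧ f (R.card - 1) = v ∧ 0 < R.card

/-- Hamilton path in `H` plus the virtual edge `uv`, containing the virtual edge at position `p` -/
def EP (H : SimpleGraph V) (R : Finset V) (u v : V) (p : ℕ) (q : ℕ → V) : Prop :=
  En R q ∧ p + 1 < R.card ∧ (∀ i, i + 1 < R.card → i ≠ p → H.Adj (q i) (q (i+1))) ∧
    ((q p = v ∧ q (p+1) = u) ∨ (q p = u ∧ q (p+1) = v))

lemma En.surj {R : Finset V} {q : ℕ → V} (h : En R q) {v : V} (hv : v ∈ R) :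
    ∃ i, i < R.card ∧ q i = v := by
  have himg : (Finset.range R.card).image q = R := by
    apply Finset.eq_of_subset_of_card_le
    · intro w hw
      obtain ⟨i, hi, rfl⟩ := Finset.mem_image.1 hw
      exact h.1 i (Finset.mem_range.1 hi)
    · rw [Finset.card_image_of_injOn]
      · simp
      · intro i hi j hj hij
        exact h.2 i j (by simpa using hi) (by simpa using hj) hij
  rw [← himg] at hv
  obtain ⟨i, hi, rfl⟩ := Finset.mem_image.1 hv
  exact ⟨i, Finset.mem_range.1 hi, rfl⟩

lemma En.comp {R : Finset V} {q : ℕ → V} (h : En R q) (σ : ℕ → ℕ)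
    (h1 : ∀ i, i < R.card → σ i < R.card)
    (h2 : ∀ i j, i < R.card → j < R.card → σ i = σ j → i = j) : En R (fun i => q (σ i)) :=
  ⟨fun i hi => h.1 _ (h1 i hi), fun i j hi hj e => h2 i j hi hj (h.2 _ _ (h1 i hi) (h1 j hj) e)⟩

lemma HP.symm {H : SimpleGraph V} {R : Finset V} {u v : V} (h : HP H R u v) : HP H R v u := by
  obtain ⟨f, hE, ha, h0, h1, hp⟩ := h
  refine ⟨fun i => f (R.card - 1 - i), hE.comp _ (by intros; omega) (by intros; omega), ?_, ?_, ?_, hp⟩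
  · intro i hi
    have := ha (R.card - 1 - (i+1)) (by omega)
    rw [show R.card - 1 - (i+1) + 1 = R.card - 1 - i by omega] at this
    exact this.symm
  · simpa using h1
  · simpa using h0

lemma HP.mono {H H' : SimpleGraph V} {R : Finset V} {u v : V} (h : HP H R u v) (hle : ∀ a ∈ R, ∀ b ∈ R, H.Adj a b → H'.Adj a b) :
    HP H' R u v := by
  obtain ⟨f, hE, ha, h0⟩ := h
  exact ⟨f, hE, fun i hi => hle _ (hE.1 _ (by omega)) _ (hE.1 _ (by omega)) (ha i hi), h0⟩

lemma EP.rev {H : SimpleGraph V} {R : Finset V} {u v : V} {p : ℕ} {q : ℕ → V} (h : EP H R u v p q) :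
    EP H R u v (R.card - 2 - p) (fun i => q (R.card - 1 - i)) := by
  obtain ⟨hE, hp, ha, hv⟩ := h
  refine ⟨hE.comp _ (by intros; omega) (by intros; omega), by omega, ?_, ?_⟩
  · intro i hi hip
    have := ha (R.card - 1 - (i+1)) (by omega) (by omega)
    rw [show R.card - 1 - (i+1) + 1 = R.card - 1 - i by omega] at this
    exact this.symm
  · have e1 : R.card - 1 - (R.card - 2 - p) = p + 1 := by omega
    have e2 : R.card - 1 - (R.card - 2 - p + 1) = p := by omega
    simp only [e1, e2]
    tauto

/-- closing the path through the ends and removing the virtual edge -/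
lemma EP.close {H : SimpleGraph V} {R : Finset V} {u v : V} {p : ℕ} {q : ℕ → V} (h : EP H R u v p q)
    (hc : H.Adj (q (R.card - 1)) (q 0)) : HP H R u v := by
  obtain ⟨hE, hp, ha, hv⟩ := h
  have key : HP H R (q (p+1)) (q p) := by
    refine ⟨fun l => q (if p + 1 + l < R.card then p + 1 + l else p + 1 + l - R.card),
      hE.comp _ ?_ ?_, ?_, ?_, ?_, by omega⟩
    · intro i hi; split_ifs <;> omega
    · intro i j hi hj; split_ifs <;> omega
    · intro i hi
      beta_reduce
      by_cases h1 : p + 1 + i + 1 < R.card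
      · have := ha (p+1+i) (by omega) (by omega)
        rw [if_pos (by omega), if_pos (by omega)]
        exact this
      · by_cases h2 : p + 1 + i + 1 = R.card
        · rw [if_pos (by omega), if_neg (by omega)]
          rw [show p + 1 + i = R.card - 1 by omega, show p + 1 + (i+1) - R.card = 0 by omega]
          exact hc
        · rw [if_neg (by omega), if_neg (by omega)]
          have := ha (p+1+i - R.card) (by omega) (by omega)
          rw [show p + 1 + i - R.card + 1 = p + 1 + (i+1) - R.card by omega] at this
          exact this
    · simp [show p + 1 < R.card by omega]
    · simp only []
      congr 1
      split_ifs <;> omega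
  rcases hv with ⟨h1, h2⟩ | ⟨h1, h2⟩
  · rw [h1, h2] at key; exact key
  · rw [h1, h2] at key; exact key.symm

lemma EP.cross {H : SimpleGraph V} {R : Finset V} {u v : V} {p : ℕ} {q : ℕ → V} (h : EP H R u v p q)
    {i : ℕ} (hi : i + 1 < R.card) (hip : i ≠ p) (h0 : H.Adj (q 0) (q (i+1)))
    (h1 : H.Adj (q (R.card - 1)) (q i)) : HP H R u v := by
  have hh := h
  obtain ⟨hE, hp, ha, hv⟩ := h
  have : EP H R u v (if p < i then p else R.card + i - (p+1)) (fun l => q (if l ≤ i then l else R.card + i - l)) := by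
    refine ⟨hE.comp _ ?_ ?_, ?_, ?_, ?_⟩
    · intro l hl; split_ifs <;> omega
    · intro l j hl hj; split_ifs <;> omega
    · split_ifs <;> omega
    · intro l hl hlp; beta_reduce
      by_cases c1 : l < i
      · rw [if_pos (by omega), if_pos (by omega)]
        refine ha l (by omega) ?_
        split_ifs at hlp <;> omega
      · by_cases c2 : l = i
        · rw [if_pos (by omega), if_neg (by omega)]
          rw [c2, show R.card + i - (i+1) = R.card - 1 by omega]
          exact h1.symm
        · rw [if_neg (by omega), if_neg (by omega)]
          have := ha (R.card + i - (l+1)) (by omega) (by split_ifs at hlp <;> omega)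
          rw [show R.card + i - (l+1) + 1 = R.card + i - l by omega] at this
          exact this.symm
    · by_cases c : p < i
      · simp only [c, if_true]
        rw [if_pos (by omega), if_pos (by omega)]
        exact hv
      · simp only [c, if_false]
        rw [if_neg (by omega), if_neg (by omega)]
        rw [show R.card + i - (R.card + i - (p+1)) = p + 1 by omega,
          show R.card + i - (R.card + i - (p+1) + 1) = p by omega]
        tauto
  apply this.close
  beta_reduce
  rw [if_neg (by omega), if_pos (by omega)]
  rw [show R.card + i - (R.card - 1) = i + 1 by omega]
  exact h0.symm

lemma EP.rot {H : SimpleGraph V} {R : Finset V} {u v : V} {p : ℕ} {q : ℕ → V} (h : EP H R u v p q)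
    {i : ℕ} (hi : i + 1 < R.card) (hip : i ≠ p) (h0 : H.Adj (q 0) (q (i+1))) :
    EP H R u v (if p < i then i - 1 - p else p) (fun l => q (if l ≤ i then i - l else l)) := by
  obtain ⟨hE, hp, ha, hv⟩ := h
  refine ⟨hE.comp _ ?_ ?_, ?_, ?_, ?_⟩
  · intro l hl; split_ifs <;> omega
  · intro l j hl hj; split_ifs <;> omega
  · split_ifs <;> omega
  · intro l hl hlp; beta_reduce
    by_cases c1 : l < i
    · rw [if_pos (by omega), if_pos (by omega)]
      have := ha (i - (l+1)) (by omega) (by split_ifs at hlp <;> omega)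
      rw [show i - (l+1) + 1 = i - l by omega] at this
      exact this.symm
    · by_cases c2 : l = i
      · rw [if_pos (by omega), if_neg (by omega), c2, show i - i = 0 by omega]
        exact h0
      · rw [if_neg (by omega), if_neg (by omega)]
        exact ha l (by omega) (by split_ifs at hlp <;> omega)
  · by_cases c : p < i
    · simp only [c, if_true]
      rw [if_pos (by omega), if_pos (by omega)]
      rw [show i - (i - 1 - p) = p + 1 by omega, show i - (i - 1 - p + 1) = p by omega]
      tauto
    · simp only [c, if_false]
      rw [if_neg (by omega), if_neg (by omega)]
      exact hv

/-- If `H2` is `H1` plus at most one edge `xy`, a Hamilton path for `H2` is one of `H1` or an EP with ends `x,y`. -/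
lemma HP.split {H1 H2 : SimpleGraph V} {R : Finset V} {u v x y : V} (h : HP H2 R u v) (huv : u ≠ v)
    (hle : ∀ a b, H2.Adj a b → H1.Adj a b ∨ (a = x ∧ b = y) ∨ (a = y ∧ b = x)) :
    HP H1 R u v ∨ ∃ p q, EP H1 R u v p q ∧ q 0 = y ∧ q (R.card - 1) = x := by
  obtain ⟨f, hE, ha, h0, h1, hp⟩ := h
  by_cases hall : ∀ i, i + 1 < R.card → H1.Adj (f i) (f (i+1))
  · left; exact ⟨f, hE, hall, h0, h1, hp⟩
  · right
    push Not at hall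
    obtain ⟨i0, hi0, hna⟩ := hall
    have hm : 0 < R.card - 1 := by
      by_contra hc
      have : R.card - 1 = 0 := by omega
      rw [this] at h1; exact huv (h0.symm.trans h1)
    have hx := (hle _ _ (ha i0 hi0)).resolve_left hna
    have huniq : ∀ i, i + 1 < R.card → i ≠ i0 → H1.Adj (f i) (f (i+1)) := by
      intro i hi hne
      rcases hle _ _ (ha i hi) with h | h | h
      · exact h
      · exfalso
        rcases hx with hx | hx
        · exact hne (hE.2 _ _ (by omega) (by omega) (h.1.trans hx.1.symm))
        · have e1 := hE.2 i (i0+1) (by omega) (by omega) (h.1.trans hx.2.symm)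
          have e2 := hE.2 (i+1) i0 (by omega) (by omega) (h.2.trans hx.1.symm)
          omega
      · exfalso
        rcases hx with hx | hx
        · have e1 := hE.2 i (i0+1) (by omega) (by omega) (h.1.trans hx.2.symm)
          have e2 := hE.2 (i+1) i0 (by omega) (by omega) (h.2.trans hx.1.symm)
          omega
        · exact hne (hE.2 _ _ (by omega) (by omega) (h.1.trans hx.1.symm))
    have key : EP H1 R u v (R.card - 2 - i0)
        (fun l => f (if i0 + 1 + l < R.card then i0 + 1 + l else i0 + 1 + l - R.card)) := by
      refine ⟨hE.comp _ ?_ ?_, by omega, ?_, ?_⟩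
      · intro l hl; split_ifs <;> omega
      · intro l j hl hj; split_ifs <;> omega
      · intro l hl hlp; beta_reduce
        by_cases c : i0 + 1 + l + 1 < R.card
        · rw [if_pos (by omega), if_pos (by omega)]
          exact huniq (i0 + 1 + l) (by omega) (by omega)
        · rw [if_neg (by omega), if_neg (by omega)]
          have := huniq (i0 + 1 + l - R.card) (by omega) (by omega)
          rw [show i0 + 1 + l - R.card + 1 = i0 + 1 + (l+1) - R.card by omega] at this
          exact this
      · left
        simp only []
        rw [if_pos (by omega), if_neg (by omega), ← h0, ← h1]
        constructor <;> congr 1 <;> omega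
    rcases hx with hx | hx
    · refine ⟨_, _, key, ?_, ?_⟩
      · beta_reduce
        rw [if_pos (by omega)]; exact hx.2
      · beta_reduce
        rw [if_neg (by omega), show i0 + 1 + (R.card - 1) - R.card = i0 by omega]; exact hx.1
    · refine ⟨_, _, key.rev, ?_, ?_⟩
      · beta_reduce
        rw [if_neg (by omega), show i0 + 1 + (R.card - 1 - 0) - R.card = i0 by omega]; exact hx.1
      · beta_reduce
        rw [if_pos (by omega), show i0 + 1 + (R.card - 1 - (R.card - 1)) = i0 + 1 by omega]; exact hx.2

end
end W

namespace W
section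
variable {V : Type}

lemma EP.cl {H : SimpleGraph V} {R : Finset V} {u v x y : V} {p : ℕ} {q : ℕ → V} (h : EP H R u v p q)
    (hy : q 0 = y) (hx : q (R.card - 1) = x) (S T Z : Finset V)
    (hS : ∀ b ∈ S, H.Adj y b ∧ b ∈ Z) (hT : ∀ a ∈ T, H.Adj x a ∧ a ∈ R)
    (hZ : ∀ a ∈ T, ∀ b ∈ R, H.Adj a b → b ∈ Z) (hc : Z.card + 2 ≤ S.card + T.card) : HP H R u v := by
  have hh := h
  obtain ⟨hE, hp, ha, hv⟩ := h
  by_contra hno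
  -- index function
  have hidx : ∀ a, ∃ i, a ∈ R → (i < R.card ∧ q i = a) := by
    intro a
    by_cases haR : a ∈ R
    · obtain ⟨i, hi⟩ := hE.surj haR
      exact ⟨i, fun _ => hi⟩
    · exact ⟨0, fun h => absurd h haR⟩
  choose idx hidx using hidx
  have hne : ∀ a ∈ T, idx a + 1 < R.card := by
    intro a haT
    obtain ⟨h1, h2⟩ := hT a haT
    obtain ⟨h3, h4⟩ := hidx a h2
    by_contra hcon
    have : idx a = R.card - 1 := by omega
    rw [this, hx] at h4
    rw [h4] at h1
    exact H.loopless.irrefl _ h1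
  have hinj : Set.InjOn (fun a => q (idx a + 1)) (T.erase (q p) : Set V) := by
    intro a haT b hbT hab
    have haT' := (Finset.mem_erase.1 haT).2
    have hbT' := (Finset.mem_erase.1 hbT).2
    have e := hE.2 _ _ (hne a haT') (hne b hbT') hab
    rw [← (hidx a (hT a haT').2).2, ← (hidx b (hT b hbT').2).2]
    congr 1; omega
  have hdisj : Disjoint S ((T.erase (q p)).image (fun a => q (idx a + 1))) := by
    rw [Finset.disjoint_left]
    intro b hbS hb
    obtain ⟨a, haT, rfl⟩ := Finset.mem_image.1 hb
    obtain ⟨hap, haT'⟩ := Finset.mem_erase.1 haT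
    obtain ⟨h3, h4⟩ := hidx a (hT a haT').2
    apply hno
    apply hh.cross (hne a haT') (i := idx a)
    · intro e; rw [e] at h4; exact hap h4.symm
    · rw [hy]; exact (hS _ hbS).1
    · rw [hx, h4]; exact (hT a haT').1
  have hsub : S ∪ ((T.erase (q p)).image (fun a => q (idx a + 1))) ⊆ Z := by
    apply Finset.union_subset
    · intro b hb; exact (hS b hb).2
    · intro b hb
      obtain ⟨a, haT, rfl⟩ := Finset.mem_image.1 hb
      obtain ⟨hap, haT'⟩ := Finset.mem_erase.1 haT
      obtain ⟨h3, h4⟩ := hidx a (hT a haT').2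
      apply hZ a haT' _ (hE.1 _ (hne a haT'))
      have := ha (idx a) (hne a haT') (by intro e; rw [e] at h4; exact hap h4.symm)
      rwa [h4] at this
  have hcard := Finset.card_le_card hsub
  rw [Finset.card_union_of_disjoint hdisj, Finset.card_image_of_injOn hinj] at hcard
  have := Finset.pred_card_le_card_erase (s := T) (a := q p)
  omega

def ClCond (H H' : SimpleGraph V) (R : Finset V) (x y : V) : Prop :=
  ∃ S T Z : Finset V, (∀ b ∈ S, H.Adj y b ∧ b ∈ Z) ∧ (∀ a ∈ T, H.Adj x a ∧ a ∈ R) ∧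
    (∀ a ∈ T, ∀ b ∈ R, H'.Adj a b → b ∈ Z) ∧ Z.card + 2 ≤ S.card + T.card

lemma HP.closure [Finite V] {H H' : SimpleGraph V} {R : Finset V} {u v : V} (huv : u ≠ v)
    (hle : H ≤ H') (hc : ∀ x y, x ∈ R → y ∈ R → H'.Adj x y → ¬ H.Adj x y → ClCond H H' R x y ∨ ClCond H H' R y x)
    (hHP : HP H' R u v) : HP H R u v := by
  have hfin : {K : SimpleGraph V | H ≤ K ∧ K ≤ H' ∧ HP K R u v}.Finite := Set.toFinite _
  obtain ⟨K, hK⟩ := hfin.exists_minimal ⟨H', hle, le_refl _, hHP⟩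
  obtain ⟨⟨hHK, hKH', hKP⟩, hmin⟩ := hK
  by_cases hex : ∃ x y, x ∈ R ∧ y ∈ R ∧ K.Adj x y ∧ ¬ H.Adj x y
  · exfalso
    obtain ⟨x, y, hxR, hyR, hxy, hnxy⟩ := hex
    set K1 := K.deleteEdges {s(x,y)} with hK1
    have hK1K : K1 ≤ K := SimpleGraph.deleteEdges_le _
    have hHK1 : H ≤ K1 := by
      intro a b hab
      rw [hK1, SimpleGraph.deleteEdges_adj]
      refine ⟨hHK hab, ?_⟩
      intro hmem
      rcases (by simpa using hmem : (a = x ∧ b = y) ∨ (a = y ∧ b = x)) with ⟨rfl, rfl⟩ | ⟨rfl, rfl⟩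
      · exact hnxy hab
      · exact hnxy hab.symm
    have hno : ¬ HP K1 R u v := by
      intro hP
      have := hmin ⟨hHK1, hK1K.trans hKH', hP⟩ hK1K
      have hc := this hxy
      rw [hK1, SimpleGraph.deleteEdges_adj] at hc
      exact hc.2 (by simp)
    have hsp : ∀ a b, K.Adj a b → K1.Adj a b ∨ (a = x ∧ b = y) ∨ (a = y ∧ b = x) := by
      intro a b hab
      by_cases hm : s(a,b) ∈ ({s(x,y)} : Set (Sym2 V))
      · right; simpa using hm
      · left; rw [hK1, SimpleGraph.deleteEdges_adj]; exact ⟨hab, hm⟩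
    have fin : ∀ x y, (∀ a b, K.Adj a b → K1.Adj a b ∨ (a = x ∧ b = y) ∨ (a = y ∧ b = x)) →
        ClCond H H' R x y → False := by
      intro x y hsp hcl
      rcases hKP.split huv hsp with h | ⟨p, q, hEP, h0, h1⟩
      · exact hno h
      · obtain ⟨S, T, Z, hS, hT, hZ, hcard⟩ := hcl
        exact hno (hEP.cl h0 h1 S T Z (fun b hb => ⟨hHK1 (hS b hb).1, (hS b hb).2⟩)
          (fun a ha => ⟨hHK1 (hT a ha).1, (hT a ha).2⟩)
          (fun a ha b hb hab => hZ a ha b hb (hKH' (hK1K hab))) hcard)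
    rcases hc x y hxR hyR (hKH' hxy) hnxy with h | h
    · exact fin x y hsp h
    · exact fin y x (fun a b hab => by rcases hsp a b hab with h | h | h <;> tauto) h
  · push Not at hex
    exact hKP.mono (fun a ha b hb hab => hex a b ha hb hab)

end
end W

namespace W
section
variable {V : Type}

/-- `l` is the list of internal vertices of a path from `u` to `v` -/
def Conn (G : SimpleGraph V) (u v : V) (l : List V) : Prop :=
  l.Nodup ∧ List.IsChain G.Adj (u :: (l ++ [v]))

lemma Conn.cons {G : SimpleGraph V} {u w v : V} {l : List V} (h : Conn G w v l) (hu : G.Adj u w)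
    (hw : w ∉ l) : Conn G u v (w :: l) := by
  refine ⟨List.nodup_cons.2 ⟨hw, h.1⟩, ?_⟩
  have := h.2
  simp only [List.cons_append, List.isChain_cons_cons]
  exact ⟨hu, this⟩

lemma Conn.symm {G : SimpleGraph V} {u v : V} {l : List V} (h : Conn G u v l) : Conn G v u l.reverse := by
  refine ⟨List.nodup_reverse.2 h.1, ?_⟩
  have h2 := h.2
  have e : v :: (l.reverse ++ [u]) = (u :: (l ++ [v])).reverse := by simp
  rw [e, List.isChain_reverse]
  refine h2.imp ?_
  intro a b hab; exact hab.symm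

/-- concatenating with a middle vertex -/
lemma Conn.trans {G : SimpleGraph V} {u w v : V} {l l' : List V} (h : Conn G u w l) (h' : Conn G w v l')
    (hw : w ∉ l) (hw' : w ∉ l') (hd : ∀ a ∈ l, a ∉ l') : Conn G u v (l ++ w :: l') := by
  refine ⟨?_, ?_⟩
  · rw [List.nodup_append]
    refine ⟨h.1, List.nodup_cons.2 ⟨hw', h'.1⟩, ?_⟩
    intro a ha b hb e
    subst e
    rcases List.mem_cons.1 hb with rfl | hb
    · exact hw ha
    · exact hd a ha hb
  · have e : u :: (l ++ w :: l' ++ [v]) = (u :: l) ++ w :: (l' ++ [v]) := by simp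
    rw [e, List.isChain_split]
    refine ⟨?_, h'.2⟩
    simpa using h.2

lemma exists_avoid {A U : Finset V} (h : U.card < A.card) : ∃ a ∈ A, a ∉ U := by
  by_contra hc
  push Not at hc
  exact absurd (Finset.card_le_card (show A ⊆ U from hc)) (by omega)

lemma filter_not_card (A : Finset V) (p : V → Prop) :
    (A.filter p).card + (A.filter (fun a => ¬ p a)).card = A.card := by
  simpa using Finset.card_filter_add_card_filter_not (s := A) p

lemma filter_and_card (A : Finset V) (p q : V → Prop) :
    (A.filter p).card ≤ (A.filter (fun a => p a ∧ q a)).card + (A.filter (fun a => ¬ q a)).card := by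
  rw [← Finset.card_union_add_card_inter]
  refine le_trans (Finset.card_le_card ?_) (Nat.le_add_right _ _)
  intro a ha
  simp only [Finset.mem_union, Finset.mem_filter] at *
  tauto

lemma alt1 (G : SimpleGraph V) (h t : ℕ) : ∀ (j : ℕ) (Q : ℕ → Finset V) (u v : V) (U : Finset V), 1 ≤ j →
    (∀ l, ∀ w ∈ Q l, ((Q (l+1)).filter (fun a => ¬ G.Adj w a)).card ≤ h) →
    ((Q 0).filter (fun a => ¬ G.Adj u a)).card ≤ h →
    t ≤ ((Q (j-1)).filter (fun a => G.Adj v a)).card →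
    (∀ l, t ≤ (Q l).card) → U.card + j + h < t →
    ∃ l : List V, Conn G u v l ∧ l.length = j ∧ (∀ w ∈ l, w ∉ U) ∧
      ∀ i (hi : i < l.length), l[i] ∈ Q i := by
  intro j
  induction j with
  | zero => intro Q u v U hj; omega
  | succ j ih =>
    intro Q u v U _ hm hu hv hQ hc
    by_cases hj : j = 0
    · subst hj
      have h1 := filter_and_card (Q 0) (fun a => G.Adj v a) (fun a => G.Adj u a)
      simp only [Nat.zero_add, Nat.sub_self] at hv
      obtain ⟨w, hw, hwU⟩ := exists_avoid (A := (Q 0).filter (fun a => G.Adj v a ∧ G.Adj u a)) (U := U) (by omega)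
      simp only [Finset.mem_filter] at hw
      refine ⟨[w], ⟨by simp, ?_⟩, by simp, by simpa using hwU, ?_⟩
      · simp [hw.2.2, hw.2.1.symm]
      · intro i hi
        simp only [List.length_cons, List.length_nil] at hi
        obtain rfl : i = 0 := by omega
        simpa using hw.1
    · have h1 := filter_not_card (Q 0) (fun a => G.Adj u a)
      have h2 := hQ 0
      obtain ⟨w, hw, hwU⟩ := exists_avoid (A := (Q 0).filter (fun a => G.Adj u a)) (U := U) (by omega)
      simp only [Finset.mem_filter] at hw
      obtain ⟨l, hl1, hl2, hl3, hl4⟩ := ih (fun i => Q (i+1)) w v (insert w U) (by omega)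
        (fun l => hm (l+1)) (hm 0 w hw.1) (by simpa [show j - 1 + 1 = j by omega] using hv)
        (fun l => hQ _) (by
          have := Finset.card_insert_le w U
          omega)
      refine ⟨w :: l, hl1.cons hw.2 (fun hwl => hl3 w hwl (by simp)), by simp [hl2], ?_, ?_⟩
      · intro a ha
        rcases List.mem_cons.1 ha with rfl | ha
        · exact hwU
        · intro haU; exact hl3 a ha (by simp [haU])
      · intro i hi
        rcases i with _ | i
        · simpa using hw.1
        · simpa using hl4 i (by simpa using hi)

lemma alt2 (G : SimpleGraph V) (h t : ℕ) (j : ℕ) (Q : ℕ → Finset V) (u v : V) (U : Finset V) (hj : 2 ≤ j)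
    (hm : ∀ l, ∀ w ∈ Q l, ((Q (l+1)).filter (fun a => ¬ G.Adj w a)).card ≤ h)
    (hu : t ≤ ((Q 0).filter (fun a => G.Adj u a)).card)
    (hv : t ≤ ((Q (j-1)).filter (fun a => G.Adj v a)).card)
    (hQ : ∀ l, t ≤ (Q l).card) (hc : U.card + j + h < t) :
    ∃ l : List V, Conn G u v l ∧ l.length = j ∧ (∀ w ∈ l, w ∉ U) ∧
      ∀ i (hi : i < l.length), l[i] ∈ Q i := by
  obtain ⟨w, hw, hwU⟩ := exists_avoid (A := (Q 0).filter (fun a => G.Adj u a)) (U := U) (by omega)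
  simp only [Finset.mem_filter] at hw
  obtain ⟨l, hl1, hl2, hl3, hl4⟩ := alt1 G h t (j-1) (fun i => Q (i+1)) w v (insert w U) (by omega)
    (fun l => hm (l+1)) (hm 0 w hw.1) (by simpa [show j - 1 - 1 + 1 = j - 1 by omega] using hv)
    (fun l => hQ _) (by
      have := Finset.card_insert_le w U
      omega)
  refine ⟨w :: l, hl1.cons hw.2 (fun hwl => hl3 w hwl (by simp)), by simp [hl2]; omega, ?_, ?_⟩
  · intro a ha
    rcases List.mem_cons.1 ha with rfl | ha
    · exact hwU
    · intro haU; exact hl3 a ha (by simp [haU])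
  · intro i hi
    rcases i with _ | i
    · simpa using hw.1
    · simpa using hl4 i (by simpa using hi)

/-- greedy choice of disjoint lists -/
lemma greedy {ι : Type} (J : Finset ι) (Pr : ι → List V → Prop) (L : ι → ℕ) (B : ℕ) :
    ∀ (U0 : Finset V), (∀ i ∈ J, ∀ U : Finset V, U.card ≤ B → ∃ l, Pr i l ∧ l.length = L i ∧ ∀ w ∈ l, w ∉ U) →
    U0.card + ∑ i ∈ J, L i ≤ B →
    ∃ l : ι → List V, (∀ i ∈ J, Pr i (l i) ∧ (l i).length = L i ∧ ∀ w ∈ l i, w ∉ U0) ∧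
      (∀ i ∈ J, ∀ j ∈ J, i ≠ j → ∀ w ∈ l i, w ∉ l j) := by
  induction J using Finset.induction_on with
  | empty => intro U0 _ _; exact ⟨fun _ => [], by simp, by simp⟩
  | insert a J haJ ih =>
    intro U0 hex hB
    rw [Finset.sum_insert haJ] at hB
    obtain ⟨l0, h1, h2, h3⟩ := hex a (by simp) U0 (by omega)
    have hle : (U0 ∪ l0.toFinset).card ≤ U0.card + L a := by
      have := Finset.card_union_le U0 l0.toFinset
      have := List.toFinset_card_le l0
      omega
    obtain ⟨l, hl, hd⟩ := ih (U0 ∪ l0.toFinset) (fun i hi => hex i (by simp [hi])) (by omega)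
    refine ⟨Function.update l a l0, ?_, ?_⟩
    · intro i hi
      rcases Finset.mem_insert.1 hi with rfl | hi
      · simpa using ⟨h1, h2, h3⟩
      · have hne : i ≠ a := fun e => haJ (e ▸ hi)
        rw [Function.update_of_ne hne]
        refine ⟨(hl i hi).1, (hl i hi).2.1, fun w hw hwU => (hl i hi).2.2 w hw (by simp [hwU])⟩
    · intro i hi j hj hij w hw
      rcases Finset.mem_insert.1 hi with rfl | hi2
      · rcases Finset.mem_insert.1 hj with rfl | hj
        · exact absurd rfl hij
        · rw [Function.update_of_ne hij.symm]
          rw [Function.update_self] at hw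
          intro hwj
          exact (hl j hj).2.2 w hwj (by simp [hw])
      · have hne : i ≠ a := fun e => haJ (e ▸ hi2)
        rw [Function.update_of_ne hne] at hw
        rcases Finset.mem_insert.1 hj with rfl | hj
        · rw [Function.update_self]
          intro hwj
          exact (hl i hi2).2.2 w hw (by simp [hwj])
        · have hne' : j ≠ a := fun e => haJ (e ▸ hj)
          rw [Function.update_of_ne hne']
          exact hd i hi2 j hj hij w hw

/-- from a Hamilton path to internals -/
lemma HP.list {G : SimpleGraph V} {R : Finset V} {u v : V} (h : HP G R u v) (huv : u ≠ v) :
    ∃ l, Conn G u v l ∧ l.length + 2 = R.card ∧ (∀ w ∈ l, w ∈ R ∧ w ≠ u ∧ w ≠ v) := by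
  obtain ⟨f, hE, ha, h0, h1, hp⟩ := h
  have hm : 0 < R.card - 1 := by
    by_contra hc
    have : R.card - 1 = 0 := by omega
    rw [this] at h1; exact huv (h0.symm.trans h1)
  have he : u :: ((List.range (R.card - 2)).map (fun i => f (i+1)) ++ [v]) = (List.range R.card).map f := by
    obtain ⟨m, hm'⟩ : ∃ m, R.card = m + 2 := ⟨R.card - 2, by omega⟩
    rw [hm'] at h1 ⊢
    rw [show m + 2 - 2 = m by omega, List.range_succ, List.range_succ_eq_map]
    simp only [List.map_append, List.map_cons, List.map_map, List.map_nil, h0]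
    rw [show m + 2 - 1 = m + 1 by omega] at h1
    simp [h1, Function.comp_def]
  refine ⟨(List.range (R.card - 2)).map (fun i => f (i+1)), ⟨?_, ?_⟩, ?_, ?_⟩
  · rw [List.nodup_map_iff_inj_on List.nodup_range]
    intro i hi j hj e
    have := hE.2 (i+1) (j+1) (by have := List.mem_range.1 hi; omega) (by have := List.mem_range.1 hj; omega) e
    omega
  · rw [he, List.isChain_iff_getElem]
    intro i hi
    simp only [List.length_map, List.length_range] at hi
    simpa using ha i hi
  · simp; omega
  · intro w hw
    obtain ⟨i, hi, rfl⟩ := List.mem_map.1 hw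
    have hi' := List.mem_range.1 hi
    refine ⟨hE.1 _ (by omega), ?_, ?_⟩
    · rw [← h0]; intro e
      have := hE.2 _ _ (by omega) (by omega) e; omega
    · rw [← h1]; intro e
      have := hE.2 _ _ (by omega) (by omega) e; omega

/-- from internals to a Hamilton path -/
lemma Conn.toHP {G : SimpleGraph V} {u v : V} {l : List V} (h : Conn G u v l) (huv : u ≠ v) (hu : u ∉ l) (hv : v ∉ l) :
    HP G (insert u (insert v l.toFinset)) u v := by
  have hcard : (insert u (insert v l.toFinset)).card = l.length + 2 := by
    rw [Finset.card_insert_of_notMem (by simp [huv, hu]), Finset.card_insert_of_notMem (by simp [hv]),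
      List.toFinset_card_of_nodup h.1]
  set L := u :: (l ++ [v]) with hL
  have hlen : L.length = l.length + 2 := by simp [hL]
  have hnd : L.Nodup := by
    rw [hL, List.nodup_cons, List.nodup_append]
    refine ⟨by simp [hu, huv], h.1, by simp, ?_⟩
    intro a ha b hb e
    simp at hb
    subst hb; subst e; exact hv ha
  have hch := List.isChain_iff_getElem.1 h.2
  refine ⟨fun i => L.getD i u, ⟨?_, ?_⟩, ?_, ?_, ?_, by omega⟩
  · intro i hi; beta_reduce
    rw [hcard, ← hlen] at hi
    rw [List.getD_eq_getElem _ _ hi]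
    have : L[i] ∈ L := List.getElem_mem hi
    generalize L[i] = w at this ⊢
    rw [hL] at this
    simp only [Finset.mem_insert, List.mem_toFinset]
    rcases List.mem_cons.1 this with h | h
    · left; exact h
    · rcases List.mem_append.1 h with h | h
      · right; right; exact h
      · right; left; simpa using h
  · intro i j hi hj e; beta_reduce at e
    rw [hcard, ← hlen] at hi hj
    rw [List.getD_eq_getElem _ _ hi, List.getD_eq_getElem _ _ hj] at e
    exact (List.Nodup.getElem_inj_iff hnd).1 e
  · intro i hi; beta_reduce
    rw [hcard, ← hlen] at hi
    rw [List.getD_eq_getElem _ _ hi, List.getD_eq_getElem _ _ (by omega)]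
    exact hch i hi
  · simp [hL]
  · beta_reduce; rw [hcard, List.getD_eq_getElem _ _ (by omega)]
    simp [hL]

end
end W

namespace W
section
variable {V : Type}

lemma HP_top {R : Finset V} {u v : V} (hu : u ∈ R) (hv : v ∈ R) (huv : u ≠ v) : HP (⊤ : SimpleGraph V) R u v := by
  set l := ((R.erase u).erase v).toList with hl
  have hul : u ∉ l := by simp [hl]
  have hvl : v ∉ l := by simp [hl]
  have hnd : l.Nodup := Finset.nodup_toList _
  have hC : Conn (⊤ : SimpleGraph V) u v l := by
    refine ⟨hnd, ?_⟩
    have hnd2 : (u :: (l ++ [v])).Nodup := by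
      rw [List.nodup_cons, List.nodup_append]
      refine ⟨by simp [hul, huv], hnd, by simp, ?_⟩
      intro a ha b hb e
      simp at hb
      subst hb; subst e; exact hvl ha
    exact (List.Pairwise.isChain hnd2).imp (fun a b h => by simpa using h)
  have := hC.toHP huv hul hvl
  convert this using 1
  rw [hl, Finset.toList_toFinset]
  rw [Finset.insert_erase (by simp [hv, huv.symm]), Finset.insert_erase hu]

/-- graph obtained by joining the set `C` to everything -/
def joinG (H : SimpleGraph V) (C : Finset V) : SimpleGraph V where
  Adj a b := a ≠ b ∧ (H.Adj a b ∨ a ∈ C ∨ b ∈ C)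
  symm := ⟨fun a b h => ⟨h.1.symm, by rcases h.2 with h | h | h <;> [left; (right; right); (right; left)] <;> [exact h.symm; exact h; exact h]⟩⟩
  loopless := ⟨fun a h => h.1 rfl⟩

lemma ham_clique [Finite V] {H : SimpleGraph V} {R C : Finset V} {u v : V} {h τ : ℕ} (hu : u ∈ R) (hv : v ∈ R)
    (huv : u ≠ v) (hCR : C ⊆ R) (hτ : ∀ w ∈ R, τ ≤ (C.filter (fun c => H.Adj w c)).card)
    (hC : ∀ c ∈ C, (C.filter (fun a => ¬ H.Adj c a)).card ≤ h)
    (hc : R.card + h + 4 ≤ C.card + τ) : HP H R u v := by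
  have hτC : τ ≤ C.card := (hτ u hu).trans (Finset.card_filter_le _ _)
  apply HP.closure (H' := joinG H C) huv
  · intro a b hab; exact ⟨hab.ne, Or.inl hab⟩
  · have key : ∀ x y, x ∈ C → y ∈ R → ClCond H (joinG H C) R x y := by
      intro x y hx hy
      refine ⟨C.filter (fun c => H.Adj y c), C.filter (fun c => H.Adj x c), R, ?_, ?_, ?_, ?_⟩
      · intro b hb; simp only [Finset.mem_filter] at hb; exact ⟨hb.2, hCR hb.1⟩
      · intro b hb; simp only [Finset.mem_filter] at hb; exact ⟨hb.2, hCR hb.1⟩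
      · intro a _ b hb _; exact hb
      · have h1 := hτ y hy
        have h2 := hC x hx
        have h3 := filter_not_card C (fun c => H.Adj x c)
        omega
    intro x y hx hy hxy hn
    rcases hxy.2 with h | h | h
    · exact absurd h hn
    · exact Or.inl (key x y h hy)
    · exact Or.inr (key y x h hx)
  · apply HP.closure (H' := (⊤ : SimpleGraph V)) huv le_top
    · intro x y hx hy hxy hn
      left
      refine ⟨C.erase y, C.erase x, R, ?_, ?_, ?_, ?_⟩
      · intro b hb
        obtain ⟨h1, h2⟩ := Finset.mem_erase.1 hb
        exact ⟨⟨h1.symm, Or.inr (Or.inr h2)⟩, hCR h2⟩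
      · intro b hb
        obtain ⟨h1, h2⟩ := Finset.mem_erase.1 hb
        exact ⟨⟨h1.symm, Or.inr (Or.inr h2)⟩, hCR h2⟩
      · intro a _ b hb _; exact hb
      · have h1 := Finset.pred_card_le_card_erase (s := C) (a := x)
        have h2 := Finset.pred_card_le_card_erase (s := C) (a := y)
        omega
    · exact HP_top hu hv huv

/-- flattening of a list of pairs -/
def fl (M : List (V × V)) : List V := M.flatMap (fun e => [e.1, e.2])

lemma fl_cons (e : V × V) (M : List (V × V)) : fl (e :: M) = e.1 :: e.2 :: fl M := by simp [fl]

lemma fl_length (M : List (V × V)) : (fl M).length = 2 * M.length := by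
  induction M with
  | nil => simp [fl]
  | cons e M ih => rw [fl_cons]; simp [ih]; omega

lemma mem_fl_of {M : List (V × V)} {e : V × V} (h : e ∈ M) : e.1 ∈ fl M ∧ e.2 ∈ fl M := by
  simp only [fl, List.mem_flatMap]
  exact ⟨⟨e, h, by simp⟩, ⟨e, h, by simp⟩⟩

lemma set_aux1 {P Q : Finset V} {u q : V} (hu : u ∈ P) (hq : q ∈ Q) :
    insert u (insert q (P.erase u ∪ Q.erase q)) = P ∪ Q := by
  ext b; simp only [Finset.mem_insert, Finset.mem_union, Finset.mem_erase]
  by_cases h1 : b = u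
  · simp [h1, hu]
  · by_cases h2 : b = q
    · simp [h2, hq]
    · simp [h1, h2]

lemma set_aux2 {P Q : Finset V} {u q a : V} (hu : u ∈ P) (hq : q ∈ Q) (ha : a ∈ P) :
    insert u (insert q (insert a ((P.erase u).erase a ∪ Q.erase q))) = P ∪ Q := by
  ext b; simp only [Finset.mem_insert, Finset.mem_union, Finset.mem_erase]
  by_cases h1 : b = u
  · simp [h1, hu]
  · by_cases h2 : b = q
    · simp [h2, hq]
    · by_cases h3 : b = a
      · simp [h3, ha]
      · simp [h1, h2, h3]

lemma set_aux3 (S : Finset V) (a b c d : V) : insert a (insert b (insert c (insert d S))) =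
    insert a (insert c (insert d (insert b S))) := by
  rw [Finset.insert_comm b c, Finset.insert_comm b d]

lemma bip_explicit {K : SimpleGraph V} : ∀ (m : ℕ) (P Q : Finset V) (M : List (V × V)) (u v : V), Q.card = m + 1 →
    Disjoint P Q → (∀ p ∈ P, ∀ q ∈ Q, K.Adj p q) → (∀ e ∈ M, K.Adj e.1 e.2) → (fl M).Nodup →
    (∀ a ∈ fl M, a ∈ P ∧ a ≠ u) → P.card = Q.card + M.length → u ∈ P → v ∈ Q →
    ∃ l, Conn K u v l ∧ u ∉ l ∧ v ∉ l ∧ insert u (insert v l.toFinset) = P ∪ Q := by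
  intro m
  induction m with
  | zero =>
    intro P Q M u v hQ hd hK hM hnd hfl hc hu hv
    have hsub : (fl M).toFinset ⊆ P.erase u := by
      intro a ha
      have := hfl a (by simpa using ha)
      simp [this.1, this.2]
    have := Finset.card_le_card hsub
    rw [List.toFinset_card_of_nodup hnd, fl_length, Finset.card_erase_of_mem hu] at this
    have hM0 : M.length = 0 := by omega
    have hP : P = {u} := by
      apply Finset.eq_singleton_iff_unique_mem.2 ⟨hu, _⟩
      intro x hx
      exact Finset.card_le_one.1 (by omega) _ hx _ hu
    have hQ' : Q = {v} := by
      apply Finset.eq_singleton_iff_unique_mem.2 ⟨hv, _⟩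
      intro x hx
      exact Finset.card_le_one.1 (by omega) _ hx _ hv
    refine ⟨[], ⟨by simp, ?_⟩, by simp, by simp, by rw [hP, hQ']; ext; simp⟩
    simpa using hK u hu v hv
  | succ m ih =>
    intro P Q M u v hQ hd hK hM hnd hfl hc hu hv
    obtain ⟨q, hqQ, hqv⟩ : ∃ q ∈ Q, q ∉ ({v} : Finset V) := exists_avoid (by simp; omega)
    have hqv : q ≠ v := by simpa using hqv
    have huQ : u ∉ Q := Finset.disjoint_left.1 hd hu
    have hqP : q ∉ P := Finset.disjoint_right.1 hd hqQ
    have hvP : v ∉ P := Finset.disjoint_right.1 hd hv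
    cases M with
    | nil =>
      simp only [List.length_nil, Nat.add_zero] at hc
      obtain ⟨p, hpP, hpu⟩ : ∃ p ∈ P, p ∉ ({u} : Finset V) := exists_avoid (by simp; omega)
      have hpu : p ≠ u := by simpa using hpu
      obtain ⟨l, hl, hl1, hl2, hl3⟩ := ih (P.erase u) (Q.erase q) [] p v
        (by rw [Finset.card_erase_of_mem hqQ]; omega)
        (Finset.disjoint_of_subset_left (Finset.erase_subset _ _)
          (Finset.disjoint_of_subset_right (Finset.erase_subset _ _) hd))
        (fun a ha b hb => hK a (Finset.mem_of_mem_erase ha) b (Finset.mem_of_mem_erase hb))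
        (by simp) (by simp [fl]) (by simp [fl])
        (by rw [Finset.card_erase_of_mem hqQ, Finset.card_erase_of_mem hu]; simp; omega)
        (by simp [hpP, hpu]) (by simp [hv, hqv.symm])
      have hmem : ∀ a ∈ l, a ∈ P.erase u ∪ Q.erase q := by
        intro a ha; rw [← hl3]; simp [ha]
      have huq : u ≠ q := fun e => huQ (e ▸ hqQ)
      have hul : u ∉ l := fun h => by have := hmem u h; simp [huQ] at this
      have hql : q ∉ l := fun h => by have := hmem q h; simp [hqP] at this
      refine ⟨q :: p :: l, ?_, ?_, ?_, ?_⟩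
      · refine (hl.cons (hK p hpP q hqQ).symm hl1).cons (hK u hu q hqQ) ?_
        simp only [List.mem_cons, not_or]
        exact ⟨fun e => hqP (e ▸ hpP), hql⟩
      · simp [huq, hpu.symm, hul]
      · simp only [List.mem_cons, not_or]
        exact ⟨hqv.symm, fun e => hvP (e ▸ hpP), hl2⟩
      · rw [List.toFinset_cons, List.toFinset_cons, set_aux3, hl3]
        exact set_aux1 hu hqQ
    | cons e M =>
      obtain ⟨a, a'⟩ := e
      rw [fl_cons] at hnd hfl
      simp only [List.length_cons] at hc
      simp only [List.nodup_cons, List.mem_cons, not_or] at hnd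
      obtain ⟨⟨haa', haM⟩, ha'M, hnd⟩ := hnd
      have haP := hfl a (by simp)
      have ha'P := hfl a' (by simp)
      have hadj : K.Adj a a' := hM (a, a') (by simp)
      obtain ⟨l, hl, hl1, hl2, hl3⟩ := ih ((P.erase u).erase a) (Q.erase q) M a' v
        (by rw [Finset.card_erase_of_mem hqQ]; omega)
        (Finset.disjoint_of_subset_left ((Finset.erase_subset _ _).trans (Finset.erase_subset _ _))
          (Finset.disjoint_of_subset_right (Finset.erase_subset _ _) hd))
        (fun a ha b hb => hK a (Finset.mem_of_mem_erase (Finset.mem_of_mem_erase ha)) b (Finset.mem_of_mem_erase hb))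
        (fun e he => hM e (by simp [he])) hnd
        (by
          intro b hb
          have := hfl b (by simp [hb])
          simp only [Finset.mem_erase]
          exact ⟨⟨fun e => haM (e ▸ hb), this.2, this.1⟩, fun e => ha'M (e ▸ hb)⟩)
        (by
          rw [Finset.card_erase_of_mem hqQ, Finset.card_erase_of_mem (by simp [haP]), Finset.card_erase_of_mem hu]
          omega)
        (by simp [ha'P, Ne.symm haa']) (by simp [hv, hqv.symm])
      have hmem : ∀ b ∈ l, b ∈ (P.erase u).erase a ∪ Q.erase q := by
        intro b hb; rw [← hl3]; simp [hb]
      have huq : u ≠ q := fun e => huQ (e ▸ hqQ)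
      have hul : u ∉ l := fun h => by have := hmem u h; simp [huQ] at this
      have hql : q ∉ l := fun h => by have := hmem q h; simp [hqP] at this
      have haQ : a ∉ Q := Finset.disjoint_left.1 hd haP.1
      have hal : a ∉ l := fun h => by have := hmem a h; simp [haQ] at this
      refine ⟨q :: a :: a' :: l, ?_, ?_, ?_, ?_⟩
      · refine ((hl.cons hadj hl1).cons (hK a haP.1 q hqQ).symm ?_).cons (hK u hu q hqQ) ?_
        · simp [haa', hal]
        · simp only [List.mem_cons, not_or]
          exact ⟨fun e => hqP (e ▸ haP.1), fun e => hqP (e ▸ ha'P.1), hql⟩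
      · simp [huq, haP.2.symm, ha'P.2.symm, hul]
      · simp only [List.mem_cons, not_or]
        exact ⟨hqv.symm, fun e => hvP (e ▸ haP.1), fun e => hvP (e ▸ ha'P.1), hl2⟩
      · rw [List.toFinset_cons, List.toFinset_cons, List.toFinset_cons, set_aux3, Finset.insert_comm v a', hl3]
        exact set_aux2 hu hqQ haP.1

/-- bipartite graph from a relation plus a list of edges -/
def bipG (r : V → V → Prop) (P Q : Finset V) (M : List (V × V)) : SimpleGraph V :=
  SimpleGraph.fromRel (fun a b => (r a b ∧ a ∈ P ∧ b ∈ Q) ∨ (a, b) ∈ M)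

lemma ham_bip [Finite V] {H : SimpleGraph V} {P Q P0 Q0 : Finset V} {M : List (V × V)} {u v : V} {h τ : ℕ}
    (hd : Disjoint P Q) (hP0 : P0 ⊆ P) (hQ0 : Q0 ⊆ Q)
    (hP : ∀ p ∈ P, τ ≤ (Q0.filter (fun c => H.Adj p c)).card)
    (hQ : ∀ q ∈ Q, τ ≤ (P0.filter (fun c => H.Adj q c)).card)
    (hPm : ∀ p ∈ P0, (Q0.filter (fun c => ¬ H.Adj p c)).card ≤ h)
    (hQm : ∀ q ∈ Q0, (P0.filter (fun c => ¬ H.Adj q c)).card ≤ h)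
    (hM : ∀ e ∈ M, H.Adj e.1 e.2) (hnd : (fl M).Nodup) (hfl : ∀ a ∈ fl M, a ∈ P ∧ a ≠ u)
    (hc : P.card = Q.card + M.length) (hu : u ∈ P) (hv : v ∈ Q)
    (h1 : P.card + h + 2 ≤ Q0.card + τ) (h2 : P.card + h + 2 ≤ P0.card + τ) : HP H (P ∪ Q) u v := by
  have huv : u ≠ v := fun e => Finset.disjoint_left.1 hd hu (e ▸ hv)
  have hτ : τ ≤ Q0.card := (hP u hu).trans (Finset.card_filter_le _ _)
  set K0 := bipG (fun a b => H.Adj a b) P Q M with hK0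
  set K1 := bipG (fun a b => H.Adj a b ∨ a ∈ P0 ∨ b ∈ Q0) P Q M with hK1
  set K2 := bipG (fun a b => True) P Q M with hK2
  have hne : ∀ {a b}, a ∈ P → b ∈ Q → a ≠ b := fun ha hb e => Finset.disjoint_left.1 hd ha (e ▸ hb)
  have hMP : ∀ {a b}, (a, b) ∈ M → a ∈ P ∧ b ∈ P := fun hab =>
    ⟨(hfl _ (mem_fl_of hab).1).1, (hfl _ (mem_fl_of hab).2).1⟩
  -- neighbours of Q-vertices lie in P
  have hQn : ∀ r a b, a ∈ Q → (bipG r P Q M).Adj a b → b ∈ P := by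
    intro r a b ha hab
    have haP : a ∉ P := Finset.disjoint_right.1 hd ha
    rw [bipG, SimpleGraph.fromRel_adj] at hab
    rcases hab.2 with (h | h) | (h | h)
    · exact absurd h.2.1 haP
    · exact absurd (hMP h).1 haP
    · exact h.2.1
    · exact absurd (hMP h).2 haP
  have hadj : ∀ (r : V → V → Prop) a b, a ∈ P → b ∈ Q → r a b → (bipG r P Q M).Adj a b := by
    intro r a b ha hb hr
    rw [bipG, SimpleGraph.fromRel_adj]
    exact ⟨hne ha hb, Or.inl (Or.inl ⟨hr, ha, hb⟩)⟩
  have hmono : ∀ (r r' : V → V → Prop), (∀ a b, r a b → r' a b) → bipG r P Q M ≤ bipG r' P Q M := by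
    intro r r' hrr a b hab
    rw [bipG, SimpleGraph.fromRel_adj] at hab ⊢
    refine ⟨hab.1, ?_⟩
    rcases hab.2 with (h | h) | (h | h)
    · exact Or.inl (Or.inl ⟨hrr _ _ h.1, h.2⟩)
    · exact Or.inl (Or.inr h)
    · exact Or.inr (Or.inl ⟨hrr _ _ h.1, h.2⟩)
    · exact Or.inr (Or.inr h)
  have hnew : ∀ (r r' : V → V → Prop) x y, (bipG r' P Q M).Adj x y → ¬ (bipG r P Q M).Adj x y →
      (x ∈ P ∧ y ∈ Q ∧ r' x y ∧ ¬ r x y) ∨ (y ∈ P ∧ x ∈ Q ∧ r' y x ∧ ¬ r y x) := by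
    intro r r' x y hxy hn
    rw [bipG, SimpleGraph.fromRel_adj] at hxy hn
    rcases hxy.2 with (h | h) | (h | h)
    · left; exact ⟨h.2.1, h.2.2, h.1, fun hr => hn ⟨hxy.1, Or.inl (Or.inl ⟨hr, h.2⟩)⟩⟩
    · exact absurd ⟨hxy.1, Or.inl (Or.inr h)⟩ hn
    · right; exact ⟨h.2.1, h.2.2, h.1, fun hr => hn ⟨hxy.1, Or.inr (Or.inl ⟨hr, h.2⟩)⟩⟩
    · exact absurd ⟨hxy.1, Or.inr (Or.inr h)⟩ hn
  have main : ∀ (r r' : V → V → Prop), (∀ a b, r a b → r' a b) →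
      (∀ x y, x ∈ P → y ∈ Q → r' x y → ¬ r x y → P.card + 2 ≤ (P0.filter (fun c => r c y)).card + (Q0.filter (fun c => r x c)).card) →
      HP (bipG r' P Q M) (P ∪ Q) u v → HP (bipG r P Q M) (P ∪ Q) u v := by
    intro r r' hrr hcard hHP
    refine HP.closure huv (hmono r r' hrr) ?_ hHP
    have cl : ∀ x y, x ∈ P → y ∈ Q → r' x y → ¬ r x y → ClCond (bipG r P Q M) (bipG r' P Q M) (P ∪ Q) x y := by
      intro x y hx hy hr hnr
      refine ⟨P0.filter (fun c => r c y), Q0.filter (fun c => r x c), P, ?_, ?_, ?_, hcard x y hx hy hr hnr⟩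
      · intro b hb
        simp only [Finset.mem_filter] at hb
        exact ⟨(hadj r b y (hP0 hb.1) hy hb.2).symm, hP0 hb.1⟩
      · intro b hb
        simp only [Finset.mem_filter] at hb
        exact ⟨hadj r x b hx (hQ0 hb.1) hb.2, Finset.mem_union_right _ (hQ0 hb.1)⟩
      · intro a ha b _ hab
        exact hQn r' a b (hQ0 (Finset.mem_filter.1 ha).1) hab
    intro x y _ _ hxy hn
    rcases hnew r r' x y hxy hn with h | h
    · exact Or.inl (cl x y h.1 h.2.1 h.2.2.1 h.2.2.2)
    · exact Or.inr (cl y x h.1 h.2.1 h.2.2.1 h.2.2.2)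
  have hK2P : HP K2 (P ∪ Q) u v := by
    have hQpos : 0 < Q.card := Finset.card_pos.2 ⟨v, hv⟩
    obtain ⟨l, hl, hl1, hl2, hl3⟩ := bip_explicit (K := K2) (Q.card - 1) P Q M u v (by omega) hd
      (fun p hp q hq => hadj _ p q hp hq trivial) (fun e he => by
        rw [hK2, bipG, SimpleGraph.fromRel_adj]
        exact ⟨(hM e he).ne, Or.inl (Or.inr he)⟩) hnd hfl hc hu hv
    rw [← hl3]
    exact hl.toHP huv hl1 hl2
  have hK1P : HP K1 (P ∪ Q) u v := by
    refine main _ _ (fun _ _ _ => trivial) ?_ hK2P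
    intro x y hx hy _ _
    refine le_trans ?_ (add_le_add (Finset.card_le_card (s := P0) ?_) (Finset.card_le_card (s := Q0) ?_))
    · omega
    · intro c hc; simp [hc]
    · intro c hc; simp [hc]
  have hK0P : HP K0 (P ∪ Q) u v := by
    refine main _ _ (fun _ _ h => Or.inl h) ?_ hK1P
    intro x y hx hy hr hnr
    have hx1 := hP x hx
    have hy1 := hQ y hy
    have ey : P0.filter (fun c => H.Adj c y) = P0.filter (fun c => H.Adj y c) := by
      ext; simp [H.adj_comm]
    rw [ey]
    rcases hr with h | h | h
    · exact absurd h hnr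
    · have a1 := hPm x h
      have a2 := filter_not_card Q0 (fun c => H.Adj x c)
      omega
    · have a1 := hQm y h
      have a2 := filter_not_card P0 (fun c => H.Adj y c)
      omega
  refine hK0P.mono ?_
  intro a ha b hb hab
  rw [hK0, bipG, SimpleGraph.fromRel_adj] at hab
  rcases hab.2 with (h | h) | (h | h)
  · exact h.1
  · exact hM _ h
  · exact h.1.symm
  · exact (hM _ h).symm

end
end W

namespace W
section
variable {V : Type} {k : ℕ}

/-- a family of internal lists for the small cycles -/
def SC (G : SimpleGraph V) (x y : Fin k → V) (N : Fin k → ℕ) (o : Fin k) (l : Fin k → List V) : Prop :=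
  (∀ i, i ≠ o → Conn G (y i) (x i) (l i) ∧ (l i).length + 2 = N i ∧ ∀ w ∈ l i, ∀ j, w ≠ x j ∧ w ≠ y j) ∧
  (∀ i j, i ≠ o → j ≠ o → i ≠ j → ∀ w ∈ l i, w ∉ l j)

/-- the vertices used by the small cycles -/
noncomputable def used (x y : Fin k → V) (o : Fin k) (l : Fin k → List V) : Finset V :=
  (Finset.univ.erase o).biUnion (fun i => insert (x i) (insert (y i) (l i).toFinset))

lemma mem_used {x y : Fin k → V} {o : Fin k} {l : Fin k → List V} {w : V} :
    w ∈ used x y o l ↔ ∃ i, i ≠ o ∧ (w = x i ∨ w = y i ∨ w ∈ l i) := by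
  simp [used]

def Concl (G : SimpleGraph V) (x y : Fin k → V) (N : Fin k → ℕ) : Prop :=
  ∃ c : Fin k → List V,
              (∀ i, IsCycleListGraph G (c i)) ∧
              (∀ i, (c i).length = N i) ∧
              (∀ i, (c i).head? = some (x i) ∧ (c i)[1]? = some (y i)) ∧
              (∀ i j, i ≠ j → ∀ v ∈ c i, v ∉ c j)

/-- distinctness of all endpoints -/
def Inj (x y : Fin k → V) : Prop := (∀ i j, x i = x j → i = j) ∧ (∀ i j, y i = y j → i = j) ∧ ∀ i j, x i ≠ y j

lemma Inj_of {x y : Fin k → V} (h : Function.Injective (Sum.elim x y : Fin k ⊕ Fin k → V)) : Inj x y := by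
  refine ⟨fun i j e => ?_, fun i j e => ?_, fun i j e => ?_⟩
  · have := @h (Sum.inl i) (Sum.inl j) (by simpa using e); simpa using this
  · have := @h (Sum.inr i) (Sum.inr j) (by simpa using e); simpa using this
  · have := @h (Sum.inl i) (Sum.inr j) (by simpa using e); simp at this

lemma sc_card {G : SimpleGraph V} {x y : Fin k → V} {N : Fin k → ℕ} {o : Fin k} {l : Fin k → List V}
    (hI : Inj x y) (h : SC G x y N o l) :
    (used x y o l).card = ∑ i ∈ Finset.univ.erase o, N i := by
  rw [used, Finset.card_biUnion]
  · apply Finset.sum_congr rfl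
    intro i hi
    have hi' : i ≠ o := (Finset.mem_erase.1 hi).1
    obtain ⟨h1, h2, h3⟩ := h.1 i hi'
    rw [Finset.card_insert_of_notMem, Finset.card_insert_of_notMem, List.toFinset_card_of_nodup h1.1]
    · exact h2
    · intro hm; exact (h3 _ (List.mem_toFinset.1 hm) i).2 rfl
    · intro hm
      rcases Finset.mem_insert.1 hm with hm | hm
      · exact hI.2.2 i i hm
      · exact (h3 _ (List.mem_toFinset.1 hm) i).1 rfl
  · intro i hi j hj hij
    have hi' : i ≠ o := by simpa using hi
    have hj' : j ≠ o := by simpa using hj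
    rw [Function.onFun, Finset.disjoint_left]
    intro w hw hw'
    simp only [Finset.mem_insert, List.mem_toFinset] at hw hw'
    have hi3 := (h.1 i hi').2.2
    have hj3 := (h.1 j hj').2.2
    rcases hw with rfl | rfl | hw <;> rcases hw' with hw' | hw' | hw'
    · exact hij (hI.1 _ _ hw')
    · exact hI.2.2 _ _ hw'
    · exact (hj3 _ hw' i).1 rfl
    · exact hI.2.2 _ _ hw'.symm
    · exact hij (hI.2.1 _ _ hw')
    · exact (hj3 _ hw' i).2 rfl
    · exact (hi3 _ hw j).1 hw'
    · exact (hi3 _ hw j).2 hw'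
    · exact h.2 i j hi' hj' hij w hw hw'

lemma finish [Fintype V] {G : SimpleGraph V} {x y : Fin k → V} {N : Fin k → ℕ} {o : Fin k} {l : Fin k → List V}
    (hadj : ∀ i, G.Adj (x i) (y i)) (hI : Inj x y) (hN : ∑ i, N i = Fintype.card V) (h : SC G x y N o l)
    (hHP : HP G (Finset.univ \ used x y o l) (y o) (x o)) : Concl G x y N := by
  obtain ⟨lo, ho1, ho2, ho3⟩ := hHP.list (hI.2.2 o o).symm
  have hcard : (Finset.univ \ used x y o l).card = N o := by
    rw [Finset.card_sdiff_of_subset (Finset.subset_univ _), sc_card hI h, Finset.card_univ, ← hN,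
      ← Finset.add_sum_erase _ _ (Finset.mem_univ o)]
    omega
  set L : Fin k → List V := Function.update l o lo with hL
  have hLo : L o = lo := by simp [hL]
  have hLi : ∀ i, i ≠ o → L i = l i := fun i hi => by simp [hL, hi]
  have hprop : ∀ i, Conn G (y i) (x i) (L i) ∧ (L i).length + 2 = N i ∧ ∀ w ∈ L i, ∀ j, w ≠ x j ∧ w ≠ y j := by
    intro i
    by_cases hi : i = o
    · subst hi
      rw [hLo]
      refine ⟨ho1, by omega, ?_⟩
      intro w hw j
      obtain ⟨h1, h2, h3⟩ := ho3 w hw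
      by_cases hj : j = i
      · subst hj; exact ⟨h3, h2⟩
      · have hnu : w ∉ used x y i l := (Finset.mem_sdiff.1 h1).2
        rw [mem_used] at hnu
        push Not at hnu
        exact ⟨(hnu j hj).1, (hnu j hj).2.1⟩
    · rw [hLi i hi]; exact h.1 i hi
  have hdis : ∀ i j, i ≠ j → ∀ w ∈ L i, w ∉ L j := by
    have aux : ∀ j, j ≠ o → ∀ w ∈ lo, w ∉ l j := by
      intro j hj w hw hwj
      have hnu : w ∉ used x y o l := (Finset.mem_sdiff.1 (ho3 w hw).1).2
      rw [mem_used] at hnu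
      push Not at hnu
      exact (hnu j hj).2.2 hwj
    intro i j hij w hw
    by_cases hi : i = o
    · subst hi
      rw [hLo] at hw
      rw [hLi j hij.symm]
      exact aux j hij.symm w hw
    · rw [hLi i hi] at hw
      by_cases hj : j = o
      · subst hj
        rw [hLo]
        exact fun hw' => aux i hi w hw' hw
      · rw [hLi j hj]
        exact h.2 i j hi hj hij w hw
  refine ⟨fun i => x i :: y i :: L i, ?_, ?_, ?_, ?_⟩
  · intro i
    obtain ⟨h1, h2, h3⟩ := hprop i
    refine ⟨by simp, ?_, ?_, ?_⟩
    · rw [List.nodup_cons, List.nodup_cons]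
      refine ⟨?_, fun hm => (h3 _ hm i).2 rfl, h1.1⟩
      intro hm
      rcases List.mem_cons.1 hm with hm | hm
      · exact hI.2.2 i i hm
      · exact (h3 _ hm i).1 rfl
    · show List.IsChain _ _
      rw [List.isChain_cons_cons]
      refine ⟨hadj i, ?_⟩
      have := h1.2
      rw [← List.cons_append] at this
      exact (List.isChain_append.1 this).1
    · intro hne
      have := h1.2
      rw [← List.cons_append] at this
      have h4 := (List.isChain_append.1 this).2.2
      have e : (x i :: y i :: L i).getLast hne = (y i :: L i).getLast (by simp) := by simp
      rw [e]
      exact h4 _ (List.getLast_mem_getLast? _) _ (by simp)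
  · intro i; simpa using (hprop i).2.1
  · intro i; simp
  · intro i j hij w hw hw'
    have hi3 := (hprop i).2.2
    have hj3 := (hprop j).2.2
    simp only [List.mem_cons] at hw hw'
    rcases hw with rfl | rfl | hw <;> rcases hw' with hw' | hw' | hw'
    · exact hij (hI.1 _ _ hw')
    · exact hI.2.2 _ _ hw'
    · exact (hj3 _ hw' i).1 rfl
    · exact hI.2.2 _ _ hw'.symm
    · exact hij (hI.2.1 _ _ hw')
    · exact (hj3 _ hw' i).2 rfl
    · exact (hi3 _ hw j).1 hw'
    · exact (hi3 _ hw j).2 hw'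
    · exact hdis i j hij w hw hw'

end
end W

namespace W
section

lemma filter_not_card' {α : Type} (A : Finset α) (p : α → Prop)
    [DecidablePred p] [DecidablePred (fun a => ¬ p a)] :
    (A.filter p).card + (A.filter (fun a => ¬ p a)).card = A.card := by
  simpa using Finset.card_filter_add_card_filter_not (s := A) p

lemma filter_split' {α : Type} (A : Finset α) (p q : α → Prop)
    [DecidablePred p] [DecidablePred (fun a => ¬ p a)] [DecidablePred q] :
    ((A.filter p).filter q).card + ((A.filter (fun a => ¬ p a)).filter q).card = (A.filter q).card := by
  rw [Finset.filter_comm (p := p) (q := q), Finset.filter_comm (p := fun a => ¬ p a) (q := q)]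
  exact filter_not_card' _ _

lemma pc_comm {α β : Type} (S : Finset α) (T : Finset β) (P : α → β → Prop) [∀ i l, Decidable (P i l)] :
    ∑ i ∈ S, (T.filter (fun l => P i l)).card = ∑ l ∈ T, (S.filter (fun i => P i l)).card := by
  simp only [Finset.card_filter]
  exact Finset.sum_comm

lemma sum_le_mul {α : Type} (S : Finset α) (f : α → ℕ) (m b : ℕ) (hS : S.card ≤ m) (h : ∀ i ∈ S, f i ≤ b) :
    ∑ i ∈ S, f i ≤ m * b := by
  refine (Finset.sum_le_card_nsmul S f b h).trans ?_
  rw [smul_eq_mul]; exact Nat.mul_le_mul_right _ hS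

lemma core_aux (m g E : ℕ) (S Wt : Finset ℕ) (adj : ℕ → ℕ → Prop) (hsym : ∀ i l, adj i l → adj l i)
    (hSW : S ⊆ Wt) (hWm : Wt ⊆ Finset.range m) (hg : (Wt \ S).card ≤ g)
    (hN : ∀ i ∈ S, ((Finset.range m).filter (fun l => adj i l ∧ ¬ ((l < i ∧ l+1 ∈ Wt) ∨ (i < l ∧ l-1 ∈ Wt)))).card ≤ 1)
    (hA : ∀ i ∈ S, ((Finset.range m).filter (fun l => ((l < i ∧ l+1 ∈ Wt) ∨ (i < l ∧ l-1 ∈ Wt)) ∧ ¬ adj i l)).card ≤ g + 1)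
    (hSS : E * m ≤ ∑ i ∈ S, (S.filter (fun l => adj i l)).card)
    (hST : E * m ≤ ∑ i ∈ S, (((Finset.range m) \ Wt).filter (fun l => adj i l)).card)
    (hE : 100 * m * (g + 2) ≤ E * E) (hm : 0 < m) : False := by
  set F1 := S.filter (fun i => i + 1 ∈ Wt) with hF1
  set F0 := S.filter (fun i => ¬ i + 1 ∈ Wt) with hF0
  set G1 := S.filter (fun i => 0 < i ∧ i - 1 ∈ Wt) with hG1
  set G0 := S.filter (fun i => ¬ (0 < i ∧ i - 1 ∈ Wt)) with hG0
  have hSm : S.card ≤ m := by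
    have := Finset.card_le_card (hSW.trans hWm); simpa using this
  have hSr : S ⊆ Finset.range m := hSW.trans hWm
  have hF : F1.card + F0.card = S.card := filter_not_card' S (fun i => i + 1 ∈ Wt)
  have hG : G1.card + G0.card = S.card := filter_not_card' S (fun i => 0 < i ∧ i - 1 ∈ Wt)
  have hF1m : F1.card ≤ m := (Finset.card_filter_le _ _).trans hSm
  have hF0m : F0.card ≤ m := (Finset.card_filter_le _ _).trans hSm
  have hG1m : G1.card ≤ m := (Finset.card_filter_le _ _).trans hSm
  -- shifting F1 into G1
  have shift : ∀ i, (F1.filter (fun l => l < i)).card ≤ (G1.filter (fun l => l < i)).card + g + 1 := by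
    intro i
    have hinj : ((F1.filter (fun l => l < i)).image (fun l => l + 1)).card = (F1.filter (fun l => l < i)).card :=
      Finset.card_image_of_injective _ (fun a b h => by simpa using h)
    have hsub : (F1.filter (fun l => l < i)).image (fun l => l + 1) ⊆ (G1.filter (fun l => l < i)) ∪ (Wt \ S) ∪ {i} := by
      intro b hb
      obtain ⟨a, ha, rfl⟩ := Finset.mem_image.1 hb
      simp only [hF1, Finset.mem_filter] at ha
      simp only [hG1, Finset.mem_union, Finset.mem_filter, Finset.mem_sdiff, Finset.mem_singleton]
      by_cases h1 : a + 1 ∈ S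
      · by_cases h2 : a + 1 = i
        · right; exact h2
        · left; left; exact ⟨⟨h1, by omega, by simpa using hSW ha.1.1⟩, by omega⟩
      · left; right; exact ⟨ha.1.2, h1⟩
    have h1 := Finset.card_le_card hsub
    have h2 := Finset.card_union_le ((G1.filter (fun l => l < i)) ∪ (Wt \ S)) {i}
    have h3 := Finset.card_union_le (G1.filter (fun l => l < i)) (Wt \ S)
    simp only [Finset.card_singleton] at h2
    omega
  have shift2 : ∀ i, (F1.filter (fun l => i < l)).card ≤ (G1.filter (fun l => i < l)).card + g := by
    intro i
    have hinj : ((F1.filter (fun l => i < l)).image (fun l => l + 1)).card = (F1.filter (fun l => i < l)).card :=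
      Finset.card_image_of_injective _ (fun a b h => by simpa using h)
    have hsub : (F1.filter (fun l => i < l)).image (fun l => l + 1) ⊆ (G1.filter (fun l => i < l)) ∪ (Wt \ S) := by
      intro b hb
      obtain ⟨a, ha, rfl⟩ := Finset.mem_image.1 hb
      simp only [hF1, Finset.mem_filter] at ha
      simp only [hG1, Finset.mem_union, Finset.mem_filter, Finset.mem_sdiff]
      by_cases h1 : a + 1 ∈ S
      · left; exact ⟨⟨h1, by omega, by simpa using hSW ha.1.1⟩, by omega⟩
      · right; exact ⟨ha.1.2, h1⟩
    have h1 := Finset.card_le_card hsub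
    have h3 := Finset.card_union_le (G1.filter (fun l => i < l)) (Wt \ S)
    omega
  have hFG : F1.card ≤ G1.card + g + 1 := by
    have := shift m
    rwa [Finset.filter_true_of_mem, Finset.filter_true_of_mem] at this
    · intro a ha; simpa using hSr (Finset.mem_filter.1 ha).1
    · intro a ha; simpa using hSr (Finset.mem_filter.1 ha).1
  have hGF : G1.card ≤ F1.card + g := by
    have hinj : (G1.image (fun l => l - 1)).card = G1.card := by
      apply Finset.card_image_of_injOn
      intro a ha b hb hab
      have ha' := (Finset.mem_filter.1 ha).2.1
      have hb' := (Finset.mem_filter.1 hb).2.1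
      simp only at hab
      omega
    have hsub : G1.image (fun l => l - 1) ⊆ F1 ∪ (Wt \ S) := by
      intro b hb
      obtain ⟨a, ha, rfl⟩ := Finset.mem_image.1 hb
      simp only [hG1, Finset.mem_filter] at ha
      simp only [hF1, Finset.mem_union, Finset.mem_filter, Finset.mem_sdiff]
      by_cases h1 : a - 1 ∈ S
      · left; refine ⟨h1, ?_⟩
        rw [show a - 1 + 1 = a by omega]; exact hSW ha.1
      · right; exact ⟨ha.2.2, h1⟩
    have h1 := Finset.card_le_card hsub
    have h3 := Finset.card_union_le F1 (Wt \ S)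
    omega
  -- (1)
  have c1 : ∑ i ∈ F0, (G1.filter (fun l => i < l)).card ≤ m * (g + 2) := by
    have hx : ∑ i ∈ F0, (G1.filter (fun l => i < l)).card ≤
        ∑ i ∈ F0, ((g + 1) + (S.filter (fun l => i < l ∧ adj l i ∧ ¬ i + 1 ∈ Wt)).card) := by
      apply Finset.sum_le_sum
      intro i hi
      simp only [hF0, Finset.mem_filter] at hi
      have hsub : G1.filter (fun l => i < l) ⊆ ((Finset.range m).filter (fun l => ((l < i ∧ l+1 ∈ Wt) ∨ (i < l ∧ l-1 ∈ Wt)) ∧ ¬ adj i l)) ∪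
          (S.filter (fun l => i < l ∧ adj l i ∧ ¬ i + 1 ∈ Wt)) := by
        intro l hl
        simp only [hG1, Finset.mem_filter] at hl
        simp only [Finset.mem_union, Finset.mem_filter]
        by_cases ha : adj i l
        · right; exact ⟨hl.1.1, hl.2, hsym _ _ ha, hi.2⟩
        · left; exact ⟨hSr hl.1.1, Or.inr ⟨hl.2, hl.1.2.2⟩, ha⟩
      have h1 := (Finset.card_le_card hsub).trans (Finset.card_union_le _ _)
      have h2 := hA i hi.1
      omega
    have hy : ∑ i ∈ F0, (S.filter (fun l => i < l ∧ adj l i ∧ ¬ i + 1 ∈ Wt)).card ≤ m * 1 := by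
      rw [pc_comm F0 S (fun i l => i < l ∧ adj l i ∧ ¬ i + 1 ∈ Wt)]
      apply sum_le_mul _ _ _ _ hSm
      intro l hl
      refine le_trans (Finset.card_le_card ?_) (hN l hl)
      intro i hi
      simp only [hF0, Finset.mem_filter] at hi ⊢
      refine ⟨hSr hi.1.1, hi.2.2.1, ?_⟩
      rintro (h | h)
      · exact hi.1.2 h.2
      · omega
    have hz := sum_le_mul F0 (fun _ => g + 1) m (g+1) hF0m (fun _ _ => le_refl _)
    rw [Finset.sum_add_distrib] at hx
    nlinarith
  have c2 : ∑ i ∈ F1, (G0.filter (fun l => i < l)).card ≤ m * (g + 2) := by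
    have hx : ∑ i ∈ F1, (G0.filter (fun l => i < l)).card ≤
        ∑ i ∈ F1, (1 + (S.filter (fun l => i < l ∧ ¬ adj l i ∧ i + 1 ∈ Wt)).card) := by
      apply Finset.sum_le_sum
      intro i hi
      simp only [hF1, Finset.mem_filter] at hi
      have hsub : G0.filter (fun l => i < l) ⊆ ((Finset.range m).filter (fun l => adj i l ∧ ¬ ((l < i ∧ l+1 ∈ Wt) ∨ (i < l ∧ l-1 ∈ Wt)))) ∪
          (S.filter (fun l => i < l ∧ ¬ adj l i ∧ i + 1 ∈ Wt)) := by
        intro l hl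
        simp only [hG0, Finset.mem_filter] at hl
        simp only [Finset.mem_union, Finset.mem_filter]
        by_cases ha : adj i l
        · left; refine ⟨hSr hl.1.1, ha, ?_⟩
          rintro (h | h)
          · omega
          · exact hl.1.2 ⟨by omega, h.2⟩
        · right; exact ⟨hl.1.1, hl.2, fun h => ha (hsym _ _ h), hi.2⟩
      have h1 := (Finset.card_le_card hsub).trans (Finset.card_union_le _ _)
      have h2 := hN i hi.1
      omega
    have hy : ∑ i ∈ F1, (S.filter (fun l => i < l ∧ ¬ adj l i ∧ i + 1 ∈ Wt)).card ≤ m * (g+1) := by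
      rw [pc_comm F1 S (fun i l => i < l ∧ ¬ adj l i ∧ i + 1 ∈ Wt)]
      apply sum_le_mul _ _ _ _ hSm
      intro l hl
      refine le_trans (Finset.card_le_card ?_) (hA l hl)
      intro i hi
      simp only [hF1, Finset.mem_filter] at hi ⊢
      exact ⟨hSr hi.1.1, Or.inl ⟨hi.2.1, hi.2.2.2⟩, hi.2.2.1⟩
    have hz := sum_le_mul F1 (fun _ => 1) m 1 hF1m (fun _ _ => le_refl _)
    rw [Finset.sum_add_distrib] at hx
    nlinarith
  -- (2)
  have b2 : E ≤ F1.card + G1.card + 1 := by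
    have : ∑ i ∈ S, (S.filter (fun l => adj i l)).card ≤ m * (F1.card + G1.card + 1) := by
      apply sum_le_mul _ _ _ _ hSm
      intro i hi
      have hsub : S.filter (fun l => adj i l) ⊆ (F1 ∪ G1) ∪ ((Finset.range m).filter (fun l => adj i l ∧ ¬ ((l < i ∧ l+1 ∈ Wt) ∨ (i < l ∧ l-1 ∈ Wt)))) := by
        intro l hl
        simp only [Finset.mem_filter] at hl
        simp only [hF1, hG1, Finset.mem_union, Finset.mem_filter]
        by_cases hc : (l < i ∧ l+1 ∈ Wt) ∨ (i < l ∧ l-1 ∈ Wt)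
        · left
          rcases hc with h | h
          · left; exact ⟨hl.1, h.2⟩
          · right; exact ⟨hl.1, by omega, h.2⟩
        · right; exact ⟨hSr hl.1, hl.2, hc⟩
      have h1 := (Finset.card_le_card hsub).trans (Finset.card_union_le _ _)
      have h2 := hN i hi
      have h3 := Finset.card_union_le F1 G1
      omega
    have h1 := hSS.trans this
    rw [Nat.mul_comm] at h1
    exact Nat.le_of_mul_le_mul_left h1 hm
  -- (3)
  have b3 : E ≤ F0.card + G0.card + 2 * g + 1 := by
    have : ∑ i ∈ S, (((Finset.range m) \ Wt).filter (fun l => adj i l)).card ≤ m * (F0.card + G0.card + 2 * g + 1) := by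
      apply sum_le_mul _ _ _ _ hSm
      intro i hi
      have hsub : ((Finset.range m) \ Wt).filter (fun l => adj i l) ⊆
          ((G0 ∪ (Wt \ S)).image (fun l => l - 1) ∪ (F0 ∪ (Wt \ S)).image (fun l => l + 1)) ∪
          ((Finset.range m).filter (fun l => adj i l ∧ ¬ ((l < i ∧ l+1 ∈ Wt) ∨ (i < l ∧ l-1 ∈ Wt)))) := by
        intro l hl
        simp only [Finset.mem_filter, Finset.mem_sdiff] at hl
        by_cases hc : (l < i ∧ l+1 ∈ Wt) ∨ (i < l ∧ l-1 ∈ Wt)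
        · apply Finset.mem_union_left
          rcases hc with h | h
          · apply Finset.mem_union_left
            refine Finset.mem_image.2 ⟨l + 1, ?_, by simp⟩
            simp only [hG0, Finset.mem_union, Finset.mem_filter, Finset.mem_sdiff]
            by_cases hs : l + 1 ∈ S
            · left; refine ⟨hs, ?_⟩; simpa using hl.1.2
            · right; exact ⟨h.2, hs⟩
          · apply Finset.mem_union_right
            refine Finset.mem_image.2 ⟨l - 1, ?_, by omega⟩
            simp only [hF0, Finset.mem_union, Finset.mem_filter, Finset.mem_sdiff]
            by_cases hs : l - 1 ∈ S
            · left; refine ⟨hs, ?_⟩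
              rw [show l - 1 + 1 = l by omega]; exact hl.1.2
            · right; exact ⟨h.2, hs⟩
        · apply Finset.mem_union_right
          exact Finset.mem_filter.2 ⟨hl.1.1, hl.2, hc⟩
      have h1 := (Finset.card_le_card hsub).trans (Finset.card_union_le _ _)
      have h2 := hN i hi
      have h3 := Finset.card_union_le ((G0 ∪ (Wt \ S)).image (fun l => l - 1)) ((F0 ∪ (Wt \ S)).image (fun l => l + 1))
      have h4 := Finset.card_image_le (s := G0 ∪ (Wt \ S)) (f := fun l => l - 1)
      have h5 := Finset.card_image_le (s := F0 ∪ (Wt \ S)) (f := fun l => l + 1)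
      have h6 := Finset.card_union_le G0 (Wt \ S)
      have h7 := Finset.card_union_le F0 (Wt \ S)
      omega
    have h1 := hST.trans this
    rw [Nat.mul_comm] at h1
    exact Nat.le_of_mul_le_mul_left h1 hm
  -- (4)
  have c4 : F1.card * G0.card ≤ m * (4 * g + 6) := by
    have e1 : F1.card * G0.card = ∑ i ∈ F1, G0.card := by simp
    have e2 : ∑ i ∈ F1, G0.card ≤ ∑ i ∈ F1, ((G0.filter (fun l => i < l)).card + ((F0.filter (fun l => l < i)).card + (g + 2))) := by
      apply Finset.sum_le_sum
      intro i hi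
      have hsub : G0 ⊆ (G0.filter (fun l => i < l) ∪ G0.filter (fun l => l < i)) ∪ {i} := by
        intro l hl
        simp only [Finset.mem_union, Finset.mem_filter, Finset.mem_singleton]
        rcases lt_trichotomy i l with h | h | h
        · left; left; exact ⟨hl, h⟩
        · right; exact h.symm
        · left; right; exact ⟨hl, h⟩
      have h1 := (Finset.card_le_card hsub).trans (Finset.card_union_le _ _)
      have h2 := Finset.card_union_le (G0.filter (fun l => i < l)) (G0.filter (fun l => l < i))
      simp only [Finset.card_singleton] at h1
      have h3 := shift i
      have h4 : (F1.filter (fun l => l < i)).card + (F0.filter (fun l => l < i)).card = (S.filter (fun l => l < i)).card := by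
        exact filter_split' S (fun i => i + 1 ∈ Wt) (fun l => l < i)
      have h5 : (G1.filter (fun l => l < i)).card + (G0.filter (fun l => l < i)).card = (S.filter (fun l => l < i)).card := by
        exact filter_split' S (fun i => 0 < i ∧ i - 1 ∈ Wt) (fun l => l < i)
      omega
    rw [Finset.sum_add_distrib, Finset.sum_add_distrib] at e2
    have e3 : ∑ i ∈ F1, (F0.filter (fun l => l < i)).card ≤ ∑ l ∈ F0, ((G1.filter (fun i => l < i)).card + g) := by
      rw [pc_comm F1 F0 (fun i l => l < i)]
      apply Finset.sum_le_sum
      intro l _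
      exact shift2 l
    rw [Finset.sum_add_distrib] at e3
    have z1 := sum_le_mul F0 (fun _ => g) m g hF0m (fun _ _ => le_refl _)
    have z2 := sum_le_mul F1 (fun _ => g+2) m (g+2) hF1m (fun _ _ => le_refl _)
    nlinarith
  have hEm : E ≤ m := by
    have : ∑ i ∈ S, (S.filter (fun l => adj i l)).card ≤ m * m :=
      sum_le_mul _ _ _ _ hSm (fun i _ => (Finset.card_filter_le _ _).trans hSm)
    exact Nat.le_of_mul_le_mul_right (hSS.trans this) hm
  have hEg : 100 * (g + 2) ≤ E := by
    by_contra hcon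
    push Not at hcon
    have : E * E < 100 * m * (g+2) := by
      calc E * E ≤ m * E := Nat.mul_le_mul_right _ hEm
        _ < m * (100 * (g+2)) := Nat.mul_lt_mul_of_pos_left hcon hm
        _ = 100 * m * (g+2) := by ring
    omega
  have k1 : E ≤ 4 * F1.card := by omega
  have k2 : E ≤ 4 * G0.card := by omega
  have k3 : E * E ≤ 16 * (F1.card * G0.card) := by
    calc E * E ≤ (4 * F1.card) * (4 * G0.card) := Nat.mul_le_mul k1 k2
      _ = _ := by ring
  nlinarith

end
end W

namespace W
section
variable {V : Type}

lemma sum_image_adj {H : SimpleGraph V} {q : ℕ → V} {m : ℕ} (hq : ∀ i j, i < m → j < m → q i = q j → i = j)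
    (S T : Finset ℕ) (hS : S ⊆ Finset.range m) (hT : T ⊆ Finset.range m) :
    ∑ a ∈ S.image q, ((T.image q).filter (fun b => H.Adj a b)).card
      = ∑ i ∈ S, (T.filter (fun l => H.Adj (q i) (q l))).card := by
  have inj : ∀ T : Finset ℕ, T ⊆ Finset.range m → Set.InjOn q T := by
    intro T hT a ha b hb h
    exact hq a b (Finset.mem_range.1 (hT ha)) (Finset.mem_range.1 (hT hb)) h
  rw [Finset.sum_image (inj S hS)]
  refine Finset.sum_congr rfl fun i _ => ?_
  rw [Finset.filter_image, Finset.card_image_of_injOn]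
  exact (inj T hT).mono (by intro a ha; exact (Finset.mem_filter.1 ha).1)

lemma ham_nonext [Finite V] {G : SimpleGraph V} {R : Finset V} {u v : V} {d g E : ℕ}
    (hu : u ∈ R) (hv : v ∈ R) (huv : u ≠ v)
    (hd : ∀ w ∈ R, d ≤ (R.filter (fun c => G.Adj w c)).card)
    (hg : R.card + 2 ≤ 2 * d + g)
    (hX : ∀ X Y : Finset V, X ⊆ R → Y ⊆ R → d ≤ X.card + 1 → d ≤ Y.card + 1 →
      E * R.card ≤ ∑ a ∈ X, (Y.filter (fun b => G.Adj a b)).card)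
    (hE : 100 * R.card * (g + 2) ≤ E * E) : HP G R u v := by
  by_contra hno
  obtain ⟨H, hGH, hmax⟩ := Finite.exists_le_maximal (p := fun H : SimpleGraph V => ¬ HP H R u v) hno
  have hnH : ¬ HP H R u v := hmax.1
  have hcl : ∃ x ∈ R, ∃ y ∈ R, x ≠ y ∧ ¬ H.Adj x y := by
    by_contra hcon
    push Not at hcon
    exact hnH ((HP_top hu hv huv).mono (fun a ha b hb hab => hcon a ha b hb hab))
  obtain ⟨x, hx, y, hy, hxy, hnadj⟩ := hcl
  have hHP2 : HP (H ⊔ SimpleGraph.edge x y) R u v := by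
    by_contra hcon
    have := hmax.2 (y := H ⊔ SimpleGraph.edge x y) hcon le_sup_left
    exact hnadj (this (by simp [SimpleGraph.edge_adj, hxy]))
  obtain hbad | ⟨p, q, hEP, -, -⟩ := hHP2.split (H1 := H) (x := x) (y := y) huv (by
    intro a b hab
    simp only [SimpleGraph.sup_adj, SimpleGraph.edge_adj] at hab
    tauto)
  · exact hnH hbad
  have hEn := hEP.1
  have hp := hEP.2.1
  set m := R.card with hm
  have himg : R = (Finset.range m).image q := by
    ext w; constructor
    · intro hw
      obtain ⟨i, hi, rfl⟩ := hEn.surj hw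
      exact Finset.mem_image_of_mem _ (Finset.mem_range.2 hi)
    · intro hw
      obtain ⟨i, hi, rfl⟩ := Finset.mem_image.1 hw
      exact hEn.1 i (Finset.mem_range.1 hi)
  have hdeg : ∀ i, i < m → d ≤ ((Finset.range m).filter (fun l => H.Adj (q i) (q l))).card := by
    intro i hi
    have h1 := hd (q i) (hEn.1 i hi)
    have h2 : (R.filter (fun c => G.Adj (q i) c)).card ≤ (R.filter (fun c => H.Adj (q i) c)).card :=
      Finset.card_le_card (Finset.monotone_filter_right _ (fun c _ hc => hGH hc))
    have h3 : (R.filter (fun c => H.Adj (q i) c)).card ≤ ((Finset.range m).filter (fun l => H.Adj (q i) (q l))).card := by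
      conv_lhs => rw [himg, Finset.filter_image]
      exact Finset.card_image_le
    omega
  set S := (Finset.range m).filter (fun i => i + 1 < m ∧ i ≠ p ∧ H.Adj (q 0) (q (i+1))) with hS
  set T := (Finset.range m).filter (fun i => i + 1 < m ∧ i ≠ p ∧ H.Adj (q (m-1)) (q i)) with hT
  have hScard : d ≤ S.card + 1 := by
    have h1 := hdeg 0 (by omega)
    have h2 : (Finset.range m).filter (fun l => H.Adj (q 0) (q l)) ⊆ insert (p+1) (S.image (fun i => i+1)) := by
      intro l hl
      simp only [Finset.mem_filter, Finset.mem_range] at hl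
      have hl0 : l ≠ 0 := by rintro rfl; exact H.loopless.irrefl _ hl.2
      simp only [hS, Finset.mem_insert, Finset.mem_image, Finset.mem_filter, Finset.mem_range]
      by_cases hlp : l = p + 1
      · left; exact hlp
      · right; exact ⟨l - 1, ⟨by omega, by omega, by omega, by rw [Nat.sub_add_cancel (by omega)]; exact hl.2⟩, by omega⟩
    have h3 := Finset.card_le_card h2
    have h4 := Finset.card_insert_le (p+1) (S.image (fun i => i+1))
    have h5 : (S.image (fun i => i+1)).card ≤ S.card := Finset.card_image_le
    omega
  have hTcard : d ≤ T.card + 1 := by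
    have h1 := hdeg (m-1) (by omega)
    have h2 : (Finset.range m).filter (fun l => H.Adj (q (m-1)) (q l)) ⊆ insert p T := by
      intro l hl
      simp only [Finset.mem_filter, Finset.mem_range] at hl
      have hl0 : l ≠ m - 1 := by rintro rfl; exact H.loopless.irrefl _ hl.2
      simp only [hT, Finset.mem_insert, Finset.mem_filter, Finset.mem_range]
      by_cases hlp : l = p
      · left; exact hlp
      · right; exact ⟨by omega, by omega, hlp, hl.2⟩
    have h3 := Finset.card_le_card h2
    have h4 := Finset.card_insert_le p T
    omega
  have hTm : T ⊆ Finset.range m := Finset.filter_subset _ _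
  have hSm : S ⊆ Finset.range m := Finset.filter_subset _ _
  have hdisj : Disjoint S T := by
    rw [Finset.disjoint_left]
    intro i h1 h2
    simp only [hS, hT, Finset.mem_filter] at h1 h2
    exact hnH (hEP.cross h1.2.1 h1.2.2.1 h1.2.2.2 h2.2.2.2)
  set Wt := Finset.range m \ T with hWt
  have hSW : S ⊆ Wt := by
    intro i hi
    exact Finset.mem_sdiff.2 ⟨hSm hi, Finset.disjoint_left.1 hdisj hi⟩
  have hWm : Wt ⊆ Finset.range m := Finset.sdiff_subset
  have hWc : Wt.card + T.card = m := by
    have := Finset.card_sdiff_add_card_eq_card hTm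
    simpa using this
  have hWS : (Wt \ S).card + S.card = Wt.card := Finset.card_sdiff_add_card_eq_card hSW
  have hTW : Finset.range m \ Wt = T := by
    rw [hWt]; exact Finset.sdiff_sdiff_eq_self hTm
  have key : ∀ i ∈ S, ∀ l, l < m → H.Adj (q i) (q l) →
      ¬ ((l < i ∧ l+1 ∈ Wt) ∨ (i < l ∧ l-1 ∈ Wt)) → l = if p < i then p else p + 1 := by
    intro i hi l hl hadj hnA
    have hi' := hi
    simp only [hS, Finset.mem_filter, Finset.mem_range] at hi'
    obtain ⟨him, hi1, hip, h0⟩ := hi'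
    have hrot := hEP.rot hi1 hip h0
    have hli : l ≠ i := by rintro rfl; exact H.loopless.irrefl _ hadj
    by_contra hne
    have e0 : (if m - 1 ≤ i then i - (m-1) else m-1) = m - 1 := by rw [if_neg (by omega)]
    rcases lt_or_gt_of_ne hli with hlt | hgt
    · apply hnA; left
      refine ⟨hlt, Finset.mem_sdiff.2 ⟨Finset.mem_range.2 (by omega), fun hT1 => ?_⟩⟩
      simp only [hT, Finset.mem_filter] at hT1
      refine hnH (hrot.cross (i := i - 1 - l) (by omega) ?_ ?_ ?_)
      · split_ifs at hne ⊢ <;> omega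
      · have e1 : (if i - 1 - l + 1 ≤ i then i - (i - 1 - l + 1) else i - 1 - l + 1) = l := by
          rw [if_pos (by omega)]; omega
        simp only [e1, Nat.zero_le, if_true, Nat.sub_zero]; exact hadj
      · have e1 : (if i - 1 - l ≤ i then i - (i - 1 - l) else i - 1 - l) = l + 1 := by
          rw [if_pos (by omega)]; omega
        simp only [← hm, e0, e1]; exact hT1.2.2.2
    · by_cases hl1 : l = i + 1
      · apply hnA; right; refine ⟨hgt, ?_⟩
        rw [hl1]; simpa using hSW hi
      apply hnA; right
      refine ⟨hgt, Finset.mem_sdiff.2 ⟨Finset.mem_range.2 (by omega), fun hT1 => ?_⟩⟩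
      simp only [hT, Finset.mem_filter] at hT1
      refine hnH (hrot.cross (i := l - 1) (by omega) ?_ ?_ ?_)
      · split_ifs at hne ⊢ <;> omega
      · have e1 : (if l - 1 + 1 ≤ i then i - (l - 1 + 1) else l - 1 + 1) = l := by
          rw [if_neg (by omega)]; omega
        simp only [e1, Nat.zero_le, if_true, Nat.sub_zero]; exact hadj
      · have e1 : (if l - 1 ≤ i then i - (l - 1) else l - 1) = l - 1 := by
          rw [if_neg (by omega)]
        simp only [← hm, e0, e1]; exact hT1.2.2.2
  have hN : ∀ i ∈ S, ((Finset.range m).filter (fun l => H.Adj (q i) (q l) ∧ ¬ ((l < i ∧ l+1 ∈ Wt) ∨ (i < l ∧ l-1 ∈ Wt)))).card ≤ 1 := by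
    intro i hi
    have : ((Finset.range m).filter (fun l => H.Adj (q i) (q l) ∧ ¬ ((l < i ∧ l+1 ∈ Wt) ∨ (i < l ∧ l-1 ∈ Wt)))) ⊆ {if p < i then p else p + 1} := by
      intro l hl
      simp only [Finset.mem_filter, Finset.mem_range] at hl
      rw [Finset.mem_singleton]
      exact key i hi l hl.1 hl.2.1 hl.2.2
    simpa using Finset.card_le_card this
  have hA : ∀ i ∈ S, ((Finset.range m).filter (fun l => ((l < i ∧ l+1 ∈ Wt) ∨ (i < l ∧ l-1 ∈ Wt)) ∧ ¬ H.Adj (q i) (q l))).card ≤ g + 1 := by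
    intro i hi
    have hAi : ((Finset.range m).filter (fun l => (l < i ∧ l+1 ∈ Wt) ∨ (i < l ∧ l-1 ∈ Wt))).card ≤ Wt.card + 1 := by
      have h1 : (Finset.range m).filter (fun l => (l < i ∧ l+1 ∈ Wt) ∨ (i < l ∧ l-1 ∈ Wt)) ⊆
          (Wt.filter (fun b => ¬ i < b)).image (fun b => b - 1) ∪ ((Wt.filter (fun b => i < b)).image (fun b => b + 1) ∪ {i+1}) := by
        intro l hl
        simp only [Finset.mem_filter, Finset.mem_range] at hl
        simp only [Finset.mem_union, Finset.mem_image, Finset.mem_filter, Finset.mem_singleton]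
        rcases hl.2 with h | h
        · left; exact ⟨l+1, ⟨h.2, by omega⟩, by omega⟩
        · right
          by_cases hl1 : l = i + 1
          · right; exact hl1
          · left; exact ⟨l-1, ⟨h.2, by omega⟩, by omega⟩
      have h2 := Finset.card_le_card h1
      have h3 := Finset.card_union_le ((Wt.filter (fun b => ¬ i < b)).image (fun b => b - 1)) ((Wt.filter (fun b => i < b)).image (fun b => b + 1) ∪ {i+1})
      have h4 := Finset.card_union_le ((Wt.filter (fun b => i < b)).image (fun b => b + 1)) {i+1}
      have h5 : ((Wt.filter (fun b => ¬ i < b)).image (fun b => b - 1)).card ≤ (Wt.filter (fun b => ¬ i < b)).card := Finset.card_image_le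
      have h6 : ((Wt.filter (fun b => i < b)).image (fun b => b + 1)).card ≤ (Wt.filter (fun b => i < b)).card := Finset.card_image_le
      have h7 := filter_not_card' Wt (fun b => i < b)
      simp only [Finset.card_singleton] at h4
      omega
    have hi' := hi
    simp only [hS, Finset.mem_filter, Finset.mem_range] at hi'
    have h1 := hdeg i hi'.1
    have h2 := hN i hi
    have h3 := filter_split' (Finset.range m) (fun l => (l < i ∧ l+1 ∈ Wt) ∨ (i < l ∧ l-1 ∈ Wt)) (fun l => H.Adj (q i) (q l))
    have h4 := filter_not_card' ((Finset.range m).filter (fun l => (l < i ∧ l+1 ∈ Wt) ∨ (i < l ∧ l-1 ∈ Wt))) (fun l => H.Adj (q i) (q l))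
    simp only [Finset.filter_filter] at h3 h4
    simp only [and_comm (a := H.Adj _ _)] at h2
    omega
  have inj : ∀ i j, i < m → j < m → q i = q j → i = j := hEn.2
  have subR : ∀ T' : Finset ℕ, T' ⊆ Finset.range m → T'.image q ⊆ R := by
    intro T' hT'; conv_rhs => rw [himg]
    exact Finset.image_subset_image hT'
  have cardI : ∀ T' : Finset ℕ, T' ⊆ Finset.range m → (T'.image q).card = T'.card := by
    intro T' hT'
    refine Finset.card_image_of_injOn ?_
    intro a ha b hb h
    exact inj a b (Finset.mem_range.1 (hT' ha)) (Finset.mem_range.1 (hT' hb)) h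
  have trans : ∀ T' : Finset ℕ, T' ⊆ Finset.range m → d ≤ T'.card + 1 →
      E * m ≤ ∑ i ∈ S, (T'.filter (fun l => H.Adj (q i) (q l))).card := by
    intro T' hT' hc
    rw [← sum_image_adj inj S T' hSm hT']
    refine (hX (S.image q) (T'.image q) (subR _ hSm) (subR _ hT') (by rw [cardI _ hSm]; exact hScard) (by rw [cardI _ hT']; exact hc)).trans ?_
    refine Finset.sum_le_sum fun a _ => ?_
    exact Finset.card_le_card (Finset.monotone_filter_right _ (fun c _ hc => hGH hc))
  refine core_aux m g E S Wt (fun i l => H.Adj (q i) (q l)) (fun i l h => h.symm) hSW hWm (by omega) hN hA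
    (trans S hSm hScard) ?_ hE (by omega)
  rw [hTW]
  exact trans T hTm hTcard

end
end W

namespace W
section
variable {V : Type} {k : ℕ}

noncomputable def Ends (x y : Fin k → V) : Finset V := Finset.univ.image x ∪ Finset.univ.image y

lemma mem_Ends {x y : Fin k → V} {w : V} : w ∈ Ends x y ↔ ∃ i, w = x i ∨ w = y i := by
  simp only [Ends, Finset.mem_union, Finset.mem_image, Finset.mem_univ, true_and]
  constructor
  · rintro (⟨i, rfl⟩ | ⟨i, rfl⟩)
    · exact ⟨i, Or.inl rfl⟩
    · exact ⟨i, Or.inr rfl⟩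
  · rintro ⟨i, rfl | rfl⟩
    · exact Or.inl ⟨i, rfl⟩
    · exact Or.inr ⟨i, rfl⟩

lemma card_Ends (x y : Fin k → V) : (Ends x y).card ≤ 2 * k := by
  have h1 := Finset.card_union_le (Finset.univ.image x) (Finset.univ.image y)
  have h2 : (Finset.univ.image x).card ≤ k := by simpa using Finset.card_image_le (s := Finset.univ) (f := x)
  have h3 : (Finset.univ.image y).card ≤ k := by simpa using Finset.card_image_le (s := Finset.univ) (f := y)
  unfold Ends; omega

lemma not_mem_Ends {x y : Fin k → V} {w : V} : w ∉ Ends x y ↔ ∀ i, w ≠ x i ∧ w ≠ y i := by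
  rw [mem_Ends]; push Not; rfl

lemma sc_gadget {G : SimpleGraph V} {x y : Fin k → V} {N : Fin k → ℕ} {o : Fin k} {s B : ℕ}
    (g : Fin k → List V) (U0 : Finset V) (Pr : Fin k → List V → Prop)
    (hs : ∑ i ∈ Finset.univ.erase o, N i ≤ s)
    (hgE : ∀ i, i ≠ o → ∀ w ∈ g i, w ∉ Ends x y)
    (hgd : ∀ i j, i ≠ o → j ≠ o → i ≠ j → ∀ w ∈ g i, w ∉ g j)
    (hgl : ∀ i, i ≠ o → (g i).length ≤ N i)
    (hB : U0.card + 4 * k + 3 * s ≤ B)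
    (hex : ∀ i, i ≠ o → ∀ U : Finset V, U.card ≤ B → (∀ w ∈ g i, w ∈ U) → (∀ w ∈ Ends x y, w ∈ U) →
      ∃ r, Conn G (y i) (x i) (g i ++ r) ∧ (g i).length + r.length + 2 = N i ∧ Pr i r ∧ ∀ w ∈ r, w ∉ U) :
    ∃ l r : Fin k → List V, SC G x y N o l ∧ ∀ i, i ≠ o → l i = g i ++ r i ∧ Pr i (r i) ∧ ∀ w ∈ r i, w ∉ U0 := by
  set Gd : Finset V := (Finset.univ.erase o).biUnion (fun i => (g i).toFinset) with hGd
  have hGc : Gd.card ≤ s := by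
    refine le_trans Finset.card_biUnion_le (le_trans (Finset.sum_le_sum fun i hi => ?_) hs)
    exact (List.toFinset_card_le _).trans (hgl i (Finset.ne_of_mem_erase hi))
  have hmemG : ∀ i, i ≠ o → ∀ w ∈ g i, w ∈ Gd := by
    intro i hi w hw
    simp only [hGd, Finset.mem_biUnion]
    exact ⟨i, Finset.mem_erase.2 ⟨hi, Finset.mem_univ _⟩, List.mem_toFinset.2 hw⟩
  have hEc := card_Ends x y
  have hc1 := Finset.card_union_le (U0 ∪ Ends x y) Gd
  have hc2 := Finset.card_union_le U0 (Ends x y)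
  obtain ⟨r, hr1, hr2⟩ := greedy (Finset.univ.erase o)
    (fun i r => Conn G (y i) (x i) (g i ++ r) ∧ (g i).length + r.length + 2 = N i ∧ Pr i r)
    (fun i => N i - 2 - (g i).length) (U0.card + 2 * k + 2 * s) (U0 ∪ Ends x y ∪ Gd) (by
      intro i hi U hU
      have hio := Finset.ne_of_mem_erase hi
      have hUc := Finset.card_union_le (U ∪ Ends x y) (g i).toFinset
      have c2 := Finset.card_union_le U (Ends x y)
      have h3 : (g i).toFinset.card ≤ Gd.card :=
          Finset.card_le_card (fun w hw => hmemG i hio w (List.mem_toFinset.1 hw))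
      obtain ⟨r, h1, h2, h3, h4⟩ := hex i hio (U ∪ Ends x y ∪ (g i).toFinset) (by omega)
          (fun w hw => Finset.mem_union_right _ (List.mem_toFinset.2 hw))
          (fun w hw => Finset.mem_union_left _ (Finset.mem_union_right _ hw))
      exact ⟨r, ⟨h1, h2, h3⟩, by omega, fun w hw hwU => h4 w hw (Finset.mem_union_left _ (Finset.mem_union_left _ hwU))⟩) (by
      have : ∑ i ∈ Finset.univ.erase o, (N i - 2 - (g i).length) ≤ ∑ i ∈ Finset.univ.erase o, N i :=
        Finset.sum_le_sum fun i _ => by omega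
      omega)
  have hr : ∀ i, i ≠ o → _ := fun i hi => hr1 i (Finset.mem_erase.2 ⟨hi, Finset.mem_univ _⟩)
  have hrU : ∀ i, i ≠ o → ∀ w ∈ r i, w ∉ U0 ∧ w ∉ Ends x y ∧ w ∉ Gd := by
    intro i hi w hw
    have := (hr i hi).2.2 w hw
    simp only [Finset.mem_union, not_or] at this
    tauto
  refine ⟨fun i => g i ++ r i, r, ⟨?_, ?_⟩, ?_⟩
  · intro i hi
    refine ⟨(hr i hi).1.1, by have := (hr i hi).1.2.1; simp only [List.length_append]; omega, ?_⟩
    intro w hw j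
    have : w ∉ Ends x y := by
      rcases List.mem_append.1 hw with h | h
      · exact hgE i hi w h
      · exact (hrU i hi w h).2.1
    exact not_mem_Ends.1 this j
  · intro i j hi hj hij w hw hw'
    rcases List.mem_append.1 hw with h | h <;> rcases List.mem_append.1 hw' with h' | h'
    · exact hgd i j hi hj hij w h h'
    · exact (hrU j hj w h').2.2 (hmemG i hi w h)
    · exact (hrU i hi w h).2.2 (hmemG j hj w h')
    · exact hr2 i (Finset.mem_erase.2 ⟨hi, Finset.mem_univ _⟩) j (Finset.mem_erase.2 ⟨hj, Finset.mem_univ _⟩) hij w h h'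
  · intro i hi
    exact ⟨rfl, (hr i hi).1.2.2, fun w hw => (hrU i hi w hw).1⟩

/-- connecting lemma in the nonextremal case -/
lemma conn_nonext [Fintype V] {G : SimpleGraph V} {e : ℕ} (he : 0 < e)
    (hdeg : ∀ v, Fintype.card V ≤ 2 * (Finset.univ.filter (fun w => G.Adj v w)).card)
    (hstar : ∀ X Y : Finset V, Fintype.card V ≤ 2 * X.card + 2 * e → Fintype.card V ≤ 2 * Y.card + 2 * e →
      e * Fintype.card V ≤ ∑ a ∈ X, (Y.filter (fun b => G.Adj a b)).card) :
    ∀ (j : ℕ) (u v : V) (U : Finset V), 2 ≤ j → U.card + j ≤ e → 2 * e < Fintype.card V →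
      ∃ l, Conn G u v l ∧ l.length = j ∧ ∀ w ∈ l, w ∉ U := by
  intro j
  induction j with
  | zero => intro u v U h; omega
  | succ j ih =>
    intro u v U hj hU hn
    have hav : ∀ w, Fintype.card V ≤ 2 * ((Finset.univ.filter (fun z => G.Adj w z)) \ U).card + 2 * U.card := by
      intro w
      have := Finset.le_card_sdiff U (Finset.univ.filter (fun z => G.Adj w z))
      have := hdeg w
      omega
    by_cases hj1 : j = 1
    · subst hj1
      set X := (Finset.univ.filter (fun z => G.Adj u z)) \ U with hX
      set Y := (Finset.univ.filter (fun z => G.Adj v z)) \ U with hY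
      have h := hstar X Y (by have := hav u; rw [hX]; omega) (by have := hav v; rw [hY]; omega)
      have hpos : 0 < ∑ a ∈ X, (Y.filter (fun b => G.Adj a b)).card :=
        lt_of_lt_of_le (Nat.mul_pos he (by omega)) h
      obtain ⟨a, haX, hne⟩ := Finset.exists_ne_zero_of_sum_ne_zero hpos.ne'
      obtain ⟨b, hb⟩ := Finset.card_pos.1 (Nat.pos_of_ne_zero hne)
      simp only [hX, hY, Finset.mem_filter, Finset.mem_sdiff, Finset.mem_univ, true_and] at haX hb
      refine ⟨[a, b], ⟨by simp [hb.2.ne], by simp [haX.1, hb.2, hb.1.1.symm]⟩, rfl, ?_⟩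
      intro w hw
      simp only [List.mem_cons, List.not_mem_nil, or_false] at hw
      rcases hw with rfl | rfl
      · exact haX.2
      · exact hb.1.2
    · obtain ⟨w, hw⟩ : ((Finset.univ.filter (fun z => G.Adj u z)) \ U).Nonempty := by
        rw [← Finset.card_pos]; have := hav u; omega
      simp only [Finset.mem_filter, Finset.mem_sdiff, Finset.mem_univ, true_and] at hw
      have hc := Finset.card_insert_le w U
      obtain ⟨l, h1, h2, h3⟩ := ih w v (insert w U) (by omega) (by omega) hn
      have hwl : w ∉ l := fun h => h3 w h (Finset.mem_insert_self _ _)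
      refine ⟨w :: l, h1.cons hw.1 hwl, by simp [h2], ?_⟩
      intro z hz
      rcases List.mem_cons.1 hz with rfl | hz
      · exact hw.2
      · exact fun h => h3 z hz (Finset.mem_insert_of_mem h)

lemma sdiff_deg {A U : Finset V} {p : V → Prop} : (A.filter p).card ≤ ((A \ U).filter p).card + U.card := by
  have h : A.filter p ⊆ (A \ U).filter p ∪ U := by
    intro a ha
    simp only [Finset.mem_filter, Finset.mem_union, Finset.mem_sdiff] at *
    tauto
  exact (Finset.card_le_card h).trans (Finset.card_union_le _ _)

/-- standard hypotheses -/
structure Setup [Fintype V] (G : SimpleGraph V) (x y : Fin k → V) (N : Fin k → ℕ) (o : Fin k) (s : ℕ) : Prop where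
  deg : ∀ v, Fintype.card V + 2 * k ≤ 2 * (Finset.univ.filter (fun w => G.Adj v w)).card
  adj : ∀ i, G.Adj (x i) (y i)
  inj : Inj x y
  five : ∀ i, 5 ≤ N i
  sum : ∑ i, N i = Fintype.card V
  small : ∑ i ∈ Finset.univ.erase o, N i ≤ s

lemma Setup.Nle [Fintype V] {G : SimpleGraph V} {x y : Fin k → V} {N : Fin k → ℕ} {o : Fin k} {s : ℕ}
    (h : Setup G x y N o s) {i : Fin k} (hi : i ≠ o) : N i ≤ s :=
  (Finset.single_le_sum (f := N) (fun _ _ => Nat.zero_le _) (Finset.mem_erase.2 ⟨hi, Finset.mem_univ _⟩)).trans h.small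

theorem nonext [Fintype V] {G : SimpleGraph V} {x y : Fin k → V} {N : Fin k → ℕ} {o : Fin k} {s e : ℕ}
    (h : Setup G x y N o s)
    (hstar : ∀ X Y : Finset V, Fintype.card V ≤ 2 * X.card + 2 * e → Fintype.card V ≤ 2 * Y.card + 2 * e →
      e * Fintype.card V ≤ ∑ a ∈ X, (Y.filter (fun b => G.Adj a b)).card)
    (h1 : 4 * k + 4 * s + 4 ≤ e) (h2 : 2 * e < Fintype.card V)
    (h3 : 100 * Fintype.card V * (2 * s + 5) ≤ e * e) : Concl G x y N := by
  obtain ⟨l, r, hSC, -⟩ := sc_gadget (B := 4 * k + 3 * s) (G := G) (x := x) (y := y) (N := N) (o := o) (s := s)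
    (fun _ => []) ∅ (fun _ _ => True) h.small (by simp) (by simp) (by simp) (by simp) (by
      intro i hi U hU _ _
      have h5 := h.five i
      have hNs := h.Nle hi
      obtain ⟨l, a1, a2, a3⟩ := conn_nonext (e := e) (by omega) (fun v => by have := h.deg v; omega) hstar (N i - 2)
        (y i) (x i) U (by omega) (by omega) h2
      exact ⟨l, by simpa using a1, by simp; omega, trivial, a3⟩)
  refine finish h.adj h.inj h.sum hSC ?_
  have hcard := sc_card h.inj hSC
  have hu := h.small
  set U := used x y o l with hU
  have hR : (Finset.univ \ U).card + U.card = Fintype.card V := by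
    have := Finset.card_sdiff_add_card_eq_card (Finset.subset_univ U)
    simpa using this
  have hnot : y o ∉ U ∧ x o ∉ U := by
    constructor <;> rw [hU, mem_used] <;> rintro ⟨i, hi, h' | h' | h'⟩
    · exact h.inj.2.2 _ _ h'.symm
    · exact hi (h.inj.2.1 _ _ h').symm
    · exact ((hSC.1 i hi).2.2 _ h' o).2 rfl
    · exact hi (h.inj.1 _ _ h').symm
    · exact h.inj.2.2 _ _ h'
    · exact ((hSC.1 i hi).2.2 _ h' o).1 rfl
  refine ham_nonext (d := Fintype.card V / 2 - s) (g := 2 * s + 3) (E := e) (by simp [hnot]) (by simp [hnot]) (h.adj o).ne' ?_ (by omega) ?_ ?_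
  · intro w _
    have := h.deg w
    have h4 := sdiff_deg (A := Finset.univ) (U := U) (p := fun c => G.Adj w c)
    omega
  · intro X Y _ _ hX hY
    refine le_trans (Nat.mul_le_mul_left e (by omega)) (hstar X Y (by omega) (by omega))
  · refine le_trans ?_ h3
    gcongr; omega

end
end W

namespace W
section
variable {V : Type} {k : ℕ}

noncomputable def dg (G : SimpleGraph V) (a : V) (S : Finset V) : ℕ := (S.filter (fun b => G.Adj a b)).card
noncomputable def ms (G : SimpleGraph V) (a : V) (S : Finset V) : ℕ := (S.filter (fun b => ¬ G.Adj a b)).card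

lemma dg_ms (G : SimpleGraph V) (a : V) (S : Finset V) : dg G a S + ms G a S = S.card :=
  filter_not_card' S _

lemma dg_mono (G : SimpleGraph V) (a : V) {S T : Finset V} (h : S ⊆ T) : dg G a S ≤ dg G a T :=
  Finset.card_le_card (Finset.filter_subset_filter _ h)
lemma ms_mono (G : SimpleGraph V) (a : V) {S T : Finset V} (h : S ⊆ T) : ms G a S ≤ ms G a T :=
  Finset.card_le_card (Finset.filter_subset_filter _ h)

lemma dg_le_card (G : SimpleGraph V) (a : V) (S : Finset V) : dg G a S ≤ S.card := Finset.card_filter_le _ _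

lemma dg_union_le (G : SimpleGraph V) (a : V) (S T : Finset V) : dg G a (S ∪ T) ≤ dg G a S + dg G a T := by
  unfold dg; rw [Finset.filter_union]; exact Finset.card_union_le _ _

lemma dg_union (G : SimpleGraph V) (a : V) {S T : Finset V} (h : Disjoint S T) : dg G a (S ∪ T) = dg G a S + dg G a T := by
  unfold dg; rw [Finset.filter_union, Finset.card_union_of_disjoint]
  exact Finset.disjoint_filter_filter h

lemma dg_sdiff_le (G : SimpleGraph V) (a : V) (S T : Finset V) : dg G a S ≤ dg G a (S \ T) + T.card := sdiff_deg

lemma dg_split (G : SimpleGraph V) (a : V) (S T : Finset V) : dg G a S ≤ dg G a T + (S \ T).card := by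
  have h : S ⊆ T ∪ (S \ T) := by intro z hz; by_cases hT : z ∈ T <;> simp [hz, hT]
  have h1 := dg_mono G a h
  have h2 := dg_union_le G a T (S \ T)
  have h3 := dg_le_card G a (S \ T)
  omega

lemma dg_compl [Fintype V] (G : SimpleGraph V) (a : V) (S : Finset V) : dg G a S + dg G a Sᶜ = dg G a Finset.univ := by
  rw [← dg_union G a disjoint_compl_right, Finset.union_compl]

lemma core_ext (P : Finset V) (f : V → ℕ) (M h0 : ℕ) (hM : ∑ a ∈ P, f a ≤ M) (hh : M ≤ h0 * h0) :
    P.card ≤ (P.filter (fun a => f a ≤ h0)).card + h0 := by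
  have h1 := filter_not_card' P (fun a => f a ≤ h0)
  by_contra hcon
  have h2 : h0 + 1 ≤ (P.filter (fun a => ¬ f a ≤ h0)).card := by omega
  have h3 : (P.filter (fun a => ¬ f a ≤ h0)).card * (h0 + 1) ≤ ∑ a ∈ P.filter (fun a => ¬ f a ≤ h0), f a := by
    rw [← smul_eq_mul]
    exact Finset.card_nsmul_le_sum _ _ _ (fun a ha => by have := (Finset.mem_filter.1 ha).2; omega)
  have h4 : ∑ a ∈ P.filter (fun a => ¬ f a ≤ h0), f a ≤ ∑ a ∈ P, f a :=
    Finset.sum_le_sum_of_subset (Finset.filter_subset _ _)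
  have h5 := Nat.mul_le_mul_right (h0+1) h2
  nlinarith

lemma sum_le_cb {P : Finset V} {f : V → ℕ} {n b : ℕ} (hP : P.card ≤ n) (h : ∀ a ∈ P, f a ≤ b) : ∑ a ∈ P, f a ≤ n * b :=
  sum_le_mul P f n b hP h

lemma extract [Fintype V] {G : SimpleGraph V} {e L h0 : ℕ} {X Y : Finset V}
    (hdeg : ∀ v, Fintype.card V ≤ 2 * dg G v Finset.univ)
    (hX : Fintype.card V ≤ 2 * X.card + 2 * e) (hY : Fintype.card V ≤ 2 * Y.card + 2 * e)
    (hs : ∑ a ∈ X, dg G a Y < e * Fintype.card V)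
    (heL : e ≤ L) (hL1 : 1 ≤ L) (hL : e * Fintype.card V ≤ L * L) (hLh : L ≤ h0) (hh : 5 * L * Fintype.card V ≤ h0 * h0) :
    ∃ A0 B0 : Finset V, Disjoint A0 B0 ∧ Fintype.card V ≤ 2 * A0.card + 6 * h0 ∧ Fintype.card V ≤ 2 * B0.card + 6 * h0 ∧
      (((∀ a ∈ A0, ms G a A0 ≤ h0) ∧ (∀ b ∈ B0, ms G b B0 ≤ h0)) ∨
       ((∀ a ∈ A0, ms G a B0 ≤ h0) ∧ (∀ b ∈ B0, ms G b A0 ≤ h0))) := by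
  set n := Fintype.card V with hn
  have hcc : ∀ S : Finset V, S.card + Sᶜ.card = n := fun S => Finset.card_add_card_compl S
  have hXn : X.card ≤ n := Finset.card_le_univ X
  have hYn : Y.card ≤ n := Finset.card_le_univ Y
  have pt : ∀ (S : Finset V) (a : V), n ≤ 2 * S.card + 2 * e → ms G a Sᶜ ≤ e + dg G a S := by
    intro S a hS
    have h1 := dg_compl G a S
    have h2 := dg_ms G a Sᶜ
    have h3 := hdeg a
    have h4 := hcc S
    omega
  have hsYX : ∑ b ∈ Y, dg G b X < e * n := by
    have : ∑ b ∈ Y, dg G b X = ∑ a ∈ X, dg G a Y := by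
      unfold dg
      rw [pc_comm]
      refine Finset.sum_congr rfl fun a _ => ?_
      congr 1; ext b; simp [G.adj_comm]
    omega
  have hLn : e * n ≤ L * n := Nat.mul_le_mul_right _ heL
  by_cases hI : (X ∩ Y).card < L
  · -- two cliques
    have key : ∀ S T : Finset V, n ≤ 2 * S.card + 2 * e → n ≤ 2 * T.card + 2 * e → S.card ≤ n → ∑ a ∈ S, dg G a T < e * n → (S ∩ T).card < L →
        ∃ A0 ⊆ S \ T, n ≤ 2 * A0.card + 6 * h0 ∧ ∀ a ∈ A0, ms G a A0 ≤ h0 := by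
      intro S T hS hT hSn hST hIST
      have hsub : S \ T ⊆ Tᶜ := by intro z; simp
      have hsum : ∑ a ∈ S \ T, ms G a (S \ T) ≤ 2 * (e * n) := by
        have h1 : ∑ a ∈ S \ T, ms G a (S \ T) ≤ ∑ a ∈ S, (e + dg G a T) := by
          refine le_trans (Finset.sum_le_sum_of_subset Finset.sdiff_subset) (Finset.sum_le_sum fun a _ => ?_)
          exact (ms_mono G a hsub).trans (pt T a hT)
        rw [Finset.sum_add_distrib] at h1
        have h2 : ∑ a ∈ S, e ≤ n * e := sum_le_cb hSn (fun _ _ => le_rfl)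
        rw [Nat.mul_comm n e] at h2
        omega
      refine ⟨(S \ T).filter (fun a => ms G a (S \ T) ≤ h0), Finset.filter_subset _ _, ?_, ?_⟩
      · have h1 := core_ext (S \ T) (fun a => ms G a (S \ T)) _ h0 hsum (by nlinarith)
        have h2 : (S \ T).card + (S ∩ T).card = S.card := Finset.card_sdiff_add_card_inter S T
        omega
      · intro a ha
        exact (ms_mono G a (Finset.filter_subset _ _)).trans (Finset.mem_filter.1 ha).2
    obtain ⟨A0, hA, hA1, hA2⟩ := key X Y hX hY hXn hs hI
    obtain ⟨B0, hB, hB1, hB2⟩ := key Y X hY hX hYn hsYX (by rwa [Finset.inter_comm])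
    refine ⟨A0, B0, ?_, hA1, hB1, Or.inl ⟨hA2, hB2⟩⟩
    rw [Finset.disjoint_left]
    intro z hz hz'
    have := hA hz; have := hB hz'
    simp_all
  · have hz : ∃ z ∈ X ∩ Y, dg G z X + dg G z Y ≤ 2 * L := by
      by_contra hcon
      push Not at hcon
      have h1 : (X ∩ Y).card * (2 * L + 1) ≤ ∑ z ∈ X ∩ Y, (dg G z X + dg G z Y) := by
        rw [← smul_eq_mul]
        exact Finset.card_nsmul_le_sum _ _ _ (fun a ha => by have := hcon a ha; omega)
      rw [Finset.sum_add_distrib] at h1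
      have h2 : ∑ z ∈ X ∩ Y, dg G z X ≤ ∑ z ∈ Y, dg G z X := Finset.sum_le_sum_of_subset Finset.inter_subset_right
      have h3 : ∑ z ∈ X ∩ Y, dg G z Y ≤ ∑ z ∈ X, dg G z Y := Finset.sum_le_sum_of_subset Finset.inter_subset_left
      have h4 : L * (2 * L + 1) ≤ (X ∩ Y).card * (2 * L + 1) := Nat.mul_le_mul_right _ (by omega)
      nlinarith
    obtain ⟨z, hzI, hz⟩ := hz
    have hz1 := dg_compl G z (X ∪ Y)
    have hz2 := dg_union_le G z X Y
    have hz3 := hdeg z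
    have hz4 := hcc (X ∪ Y)
    have hz5 := dg_le_card G z (X ∪ Y)ᶜ
    have hz6 : (X \ Y).card + Y.card = (X ∪ Y).card := Finset.card_sdiff_add_card X Y
    have hXY : (X \ Y).card ≤ 3 * L := by omega
    have hXc : n ≤ 2 * Xᶜ.card + 4 * L := by
      have h1 := dg_compl G z X
      have h2 := dg_le_card G z Xᶜ
      omega
    have hsum : ∑ a ∈ X, ms G a Xᶜ ≤ 5 * L * n := by
      have h1 : ∑ a ∈ X, ms G a Xᶜ ≤ ∑ a ∈ X, (4 * L + dg G a Y) := by
        refine Finset.sum_le_sum fun a _ => ?_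
        have h1 := pt X a hX
        have h2 := dg_split G a X Y
        omega
      rw [Finset.sum_add_distrib] at h1
      have h2 : ∑ a ∈ X, 4 * L ≤ n * (4 * L) := sum_le_cb hXn (fun _ _ => le_rfl)
      have h3 : n * (4 * L) + L * n = 5 * L * n := by ring
      omega
    have hsum' : ∑ b ∈ Xᶜ, ms G b X ≤ 5 * L * n := by
      refine le_trans (le_of_eq ?_) hsum
      unfold ms
      rw [pc_comm]
      refine Finset.sum_congr rfl fun a _ => ?_
      congr 1; ext b; simp [G.adj_comm]
    refine ⟨X.filter (fun a => ms G a Xᶜ ≤ h0), Xᶜ.filter (fun a => ms G a X ≤ h0), ?_, ?_, ?_, Or.inr ⟨?_, ?_⟩⟩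
    · exact Finset.disjoint_of_subset_left (Finset.filter_subset _ _)
        (Finset.disjoint_of_subset_right (Finset.filter_subset _ _) disjoint_compl_right)
    · have h1 := core_ext X (fun a => ms G a Xᶜ) _ h0 hsum hh
      omega
    · have h1 := core_ext Xᶜ (fun a => ms G a X) _ h0 hsum' hh
      omega
    · intro a ha
      exact (ms_mono G a (Finset.filter_subset _ _)).trans (Finset.mem_filter.1 ha).2
    · intro a ha
      exact (ms_mono G a (Finset.filter_subset _ _)).trans (Finset.mem_filter.1 ha).2

end
end W

namespace W
section
variable {V : Type} {k : ℕ}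

lemma greedy2 {ι : Type} (Pr : ι → List V → Prop) (L : ι → ℕ) (B : ℕ) (g : ι → Finset V) (Gd : Finset V) (J : Finset ι) :
    ∀ (U0 : Finset V), (∀ i ∈ J, g i ⊆ Gd) → (∀ i ∈ J, ∀ j ∈ J, i ≠ j → Disjoint (g i) (g j)) →
    (∀ i ∈ J, ∀ U : Finset V, Gd ⊆ U → U0 ⊆ U → U.card ≤ B →
      ∃ l, Pr i l ∧ l.length ≤ L i ∧ ∀ w ∈ l, w ∈ g i ∨ w ∉ U) →
    Gd ⊆ U0 → U0.card + ∑ i ∈ J, L i ≤ B →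
    ∃ l : ι → List V, (∀ i ∈ J, Pr i (l i) ∧ ∀ w ∈ l i, w ∈ g i ∨ w ∉ U0) ∧
      (∀ i ∈ J, ∀ j ∈ J, i ≠ j → ∀ w ∈ l i, w ∉ l j) := by
  induction J using Finset.induction_on with
  | empty => intro U0 _ _ _ _ _; exact ⟨fun _ => [], by simp, by simp⟩
  | insert a J ha ih =>
    intro U0 hg hgd hex hGU hB
    rw [Finset.sum_insert ha] at hB
    obtain ⟨la, p1, p2, p3⟩ := hex a (Finset.mem_insert_self _ _) U0 hGU (Finset.Subset.refl _) (by omega)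
    have hc := Finset.card_union_le U0 la.toFinset
    have hc2 := List.toFinset_card_le la
    obtain ⟨l, q1, q2⟩ := ih (U0 ∪ la.toFinset) (fun i hi => hg i (Finset.mem_insert_of_mem hi))
      (fun i hi j hj => hgd i (Finset.mem_insert_of_mem hi) j (Finset.mem_insert_of_mem hj))
      (fun i hi U hU hU' => hex i (Finset.mem_insert_of_mem hi) U hU (Finset.union_subset_left hU'))
      (hGU.trans Finset.subset_union_left) (by omega)
    have hne : ∀ i ∈ J, i ≠ a := fun i hi h => ha (h ▸ hi)
    have hdis : ∀ i ∈ J, ∀ w ∈ la, w ∉ l i := by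
      intro i hi w hw hw'
      rcases (q1 i hi).2 w hw' with h | h
      · rcases p3 w hw with h' | h'
        · exact Finset.disjoint_left.1 (hgd i (Finset.mem_insert_of_mem hi) a (Finset.mem_insert_self _ _) (hne i hi)) h h'
        · exact h' (hGU (hg i (Finset.mem_insert_of_mem hi) h))
      · exact h (Finset.mem_union_right _ (List.mem_toFinset.2 hw))
    refine ⟨fun i => if i = a then la else l i, ?_, ?_⟩
    · intro i hi
      by_cases hia : i = a
      · subst hia; simp only [if_true]; exact ⟨p1, p3⟩
      · have hiJ := Finset.mem_of_mem_insert_of_ne hi hia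
        simp only [hia, if_false]
        refine ⟨(q1 i hiJ).1, fun w hw => ?_⟩
        rcases (q1 i hiJ).2 w hw with h | h
        · exact Or.inl h
        · exact Or.inr fun h' => h (Finset.mem_union_left _ h')
    · intro i hi j hj hij w hw hw'
      by_cases hia : i = a
      · subst hia
        have hja : j ≠ i := fun h => hij h.symm
        simp only [if_true, hja, if_false] at hw hw'
        exact hdis j (Finset.mem_of_mem_insert_of_ne hj hja) w hw hw'
      · have hiJ := Finset.mem_of_mem_insert_of_ne hi hia
        by_cases hja : j = a
        · subst hja
          simp only [if_true, hia, if_false] at hw hw'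
          exact hdis i hiJ w hw' hw
        · simp only [hja, hia, if_false] at hw hw'
          exact q2 i hiJ j (Finset.mem_of_mem_insert_of_ne hj hja) hij w hw hw'

lemma sc_gadget2 {G : SimpleGraph V} {x y : Fin k → V} {N : Fin k → ℕ} {o : Fin k} {s B : ℕ}
    (g : Fin k → Finset V) (U0 : Finset V) (Pr : Fin k → List V → Prop)
    (hs : ∑ i ∈ Finset.univ.erase o, N i ≤ s)
    (hgE : ∀ i, i ≠ o → ∀ w ∈ g i, w ∉ Ends x y)
    (hgd : ∀ i j, i ≠ o → j ≠ o → i ≠ j → Disjoint (g i) (g j))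
    (hgl : ∀ i, i ≠ o → (g i).card ≤ N i)
    (hB : U0.card + 2 * k + 2 * s ≤ B)
    (hex : ∀ i, i ≠ o → ∀ U : Finset V, U.card ≤ B → U0 ⊆ U → g i ⊆ U → Ends x y ⊆ U →
      ∃ l, Conn G (y i) (x i) l ∧ l.length + 2 = N i ∧ Pr i l ∧ ∀ w ∈ l, w ∈ g i ∨ w ∉ U) :
    ∃ l : Fin k → List V, SC G x y N o l ∧ ∀ i, i ≠ o → Pr i (l i) ∧ ∀ w ∈ l i, w ∈ g i ∨ w ∉ U0 := by
  set Gd : Finset V := (Finset.univ.erase o).biUnion g with hGd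
  have hGc : Gd.card ≤ s := by
    refine le_trans Finset.card_biUnion_le (le_trans (Finset.sum_le_sum fun i hi => ?_) hs)
    exact hgl i (Finset.ne_of_mem_erase hi)
  have hmemG : ∀ i, i ≠ o → g i ⊆ Gd := by
    intro i hi w hw
    simp only [hGd, Finset.mem_biUnion]
    exact ⟨i, Finset.mem_erase.2 ⟨hi, Finset.mem_univ _⟩, hw⟩
  have hEc := card_Ends x y
  have hc1 := Finset.card_union_le (U0 ∪ Ends x y) Gd
  have hc2 := Finset.card_union_le U0 (Ends x y)
  obtain ⟨l, hl1, hl2⟩ := greedy2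
    (fun i l => Conn G (y i) (x i) l ∧ l.length + 2 = N i ∧ Pr i l)
    N (U0.card + 2 * k + 2 * s) g Gd (Finset.univ.erase o) (U0 ∪ Ends x y ∪ Gd)
    (fun i hi => hmemG i (Finset.ne_of_mem_erase hi))
    (fun i hi j hj hij => hgd i j (Finset.ne_of_mem_erase hi) (Finset.ne_of_mem_erase hj) hij) (by
      intro i hi U hGU hU0 hU
      have hio := Finset.ne_of_mem_erase hi
      obtain ⟨l, h1, h2, h3, h4⟩ := hex i hio U (by omega) (Finset.union_subset_left (Finset.union_subset_left hU0)) ((hmemG i hio).trans hGU)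
          (Finset.union_subset_right (Finset.union_subset_left hU0))
      exact ⟨l, ⟨h1, h2, h3⟩, by omega, h4⟩) Finset.subset_union_right (by omega)
  have hl : ∀ i, i ≠ o → _ := fun i hi => hl1 i (Finset.mem_erase.2 ⟨hi, Finset.mem_univ _⟩)
  refine ⟨l, ⟨?_, ?_⟩, ?_⟩
  · intro i hi
    refine ⟨(hl i hi).1.1, (hl i hi).1.2.1, ?_⟩
    intro w hw j
    have : w ∉ Ends x y := by
      rcases (hl i hi).2 w hw with h | h
      · exact hgE i hi w h
      · exact fun h' => h (Finset.mem_union_left _ (Finset.mem_union_right _ h'))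
    exact not_mem_Ends.1 this j
  · intro i j hi hj hij w hw hw'
    exact hl2 i (Finset.mem_erase.2 ⟨hi, Finset.mem_univ _⟩) j (Finset.mem_erase.2 ⟨hj, Finset.mem_univ _⟩) hij w hw hw'
  · intro i hi
    refine ⟨(hl i hi).1.2.2, fun w hw => ?_⟩
    rcases (hl i hi).2 w hw with h | h
    · exact Or.inl h
    · exact Or.inr fun h' => h (Finset.mem_union_left _ (Finset.mem_union_left _ h'))

lemma links [hV : Nonempty V] {ι : Type} {G : SimpleGraph V} (cand : ι → Finset V) (Bs : Finset V) (m : ℕ) (J : Finset ι) :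
    J.card ≤ m → (∀ i ∈ J, m ≤ (cand i).card) → (∀ i ∈ J, ∀ a ∈ cand i, m ≤ dg G a Bs) →
    ∃ a b : ι → V, (∀ i ∈ J, a i ∈ cand i ∧ b i ∈ Bs ∧ G.Adj (a i) (b i)) ∧
      (∀ i ∈ J, ∀ j ∈ J, i ≠ j → a i ≠ a j ∧ b i ≠ b j) := by
  induction J using Finset.induction_on with
  | empty =>
    intro _ _ _
    obtain ⟨v⟩ := hV; exact ⟨fun _ => v, fun _ => v, by simp, by simp⟩
  | insert c J hc ih =>
    intro hm h1 h2
    rw [Finset.card_insert_of_notMem hc] at hm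
    obtain ⟨a, b, p, q⟩ := ih (by omega) (fun i hi => h1 i (Finset.mem_insert_of_mem hi)) (fun i hi => h2 i (Finset.mem_insert_of_mem hi))
    have hia : (J.image a).card ≤ J.card := Finset.card_image_le
    have hib : (J.image b).card ≤ J.card := Finset.card_image_le
    obtain ⟨a', ha', hna⟩ := exists_avoid (A := cand c) (U := J.image a) (by
      have := h1 c (Finset.mem_insert_self _ _); omega)
    obtain ⟨b', hb', hnb⟩ := exists_avoid (A := Bs.filter (fun z => G.Adj a' z)) (U := J.image b) (by
      have := h2 c (Finset.mem_insert_self _ _) a' ha'; unfold dg at this; omega)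
    simp only [Finset.mem_filter] at hb'
    have hne : ∀ i ∈ J, i ≠ c := fun i hi h => hc (h ▸ hi)
    refine ⟨fun i => if i = c then a' else a i, fun i => if i = c then b' else b i, ?_, ?_⟩
    · intro i hi
      by_cases hic : i = c
      · subst hic; simp only [if_true]; exact ⟨ha', hb'.1, hb'.2⟩
      · simp only [hic, if_false]; exact p i (Finset.mem_of_mem_insert_of_ne hi hic)
    · intro i hi j hj hij
      by_cases hic : i = c
      · subst hic
        have hji : j ≠ i := fun h => hij h.symm
        have hjJ := Finset.mem_of_mem_insert_of_ne hj hji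
        simp only [if_true, hji, if_false]
        exact ⟨fun h => hna (h ▸ Finset.mem_image_of_mem a hjJ), fun h => hnb (h ▸ Finset.mem_image_of_mem b hjJ)⟩
      · have hiJ := Finset.mem_of_mem_insert_of_ne hi hic
        by_cases hjc : j = c
        · subst hjc
          simp only [if_true, hic, if_false]
          exact ⟨fun h => hna (h ▸ Finset.mem_image_of_mem a hiJ), fun h => hnb (h ▸ Finset.mem_image_of_mem b hiJ)⟩
        · simp only [hjc, hic, if_false]
          exact q i hiJ j (Finset.mem_of_mem_insert_of_ne hj hjc) hij

lemma HP.join {G : SimpleGraph V} {R1 R2 : Finset V} {u a b v : V} (h1 : HP G R1 u a) (h2 : HP G R2 b v)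
    (hab : G.Adj a b) (hd : Disjoint R1 R2) : HP G (R1 ∪ R2) u v := by
  obtain ⟨f, hf, hf1, hf2, hf3, hf4⟩ := h1
  obtain ⟨f', hg, hg1, hg2, hg3, hg4⟩ := h2
  have hc : (R1 ∪ R2).card = R1.card + R2.card := Finset.card_union_of_disjoint hd
  refine ⟨fun i => if i < R1.card then f i else f' (i - R1.card), ⟨?_, ?_⟩, ?_, ?_, ?_, by omega⟩
  · intro i hi
    rw [hc] at hi
    beta_reduce
    split_ifs with h
    · exact Finset.mem_union_left _ (hf.1 i h)
    · exact Finset.mem_union_right _ (hg.1 _ (by omega))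
  · intro i j hi hj hij
    rw [hc] at hi hj
    beta_reduce at hij
    split_ifs at hij with h h' h'
    · exact hf.2 i j h h' hij
    · exact (Finset.disjoint_left.1 hd (hf.1 i h) (hij ▸ hg.1 _ (by omega))).elim
    · exact (Finset.disjoint_left.1 hd (hf.1 j h') (hij ▸ hg.1 _ (by omega))).elim
    · have := hg.2 _ _ (by omega) (by omega) hij; omega
  · intro i hi
    rw [hc] at hi
    beta_reduce
    by_cases h : i + 1 < R1.card
    · rw [if_pos (by omega), if_pos h]; exact hf1 i h
    · by_cases h' : i < R1.card
      · have e1 : i = R1.card - 1 := by omega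
        rw [if_pos h', if_neg h, e1, hf3, show R1.card - 1 + 1 - R1.card = 0 by omega, hg2]; exact hab
      · rw [if_neg h', if_neg h, show i + 1 - R1.card = i - R1.card + 1 by omega]
        exact hg1 _ (by omega)
  · beta_reduce; rw [if_pos hf4]; exact hf2
  · beta_reduce; rw [hc, if_neg (by omega), show R1.card + R2.card - 1 - R1.card = R2.card - 1 by omega]; exact hg3

lemma HP.single {G : SimpleGraph V} (u : V) : HP G {u} u u := by
  refine ⟨fun _ => u, ⟨by simp, ?_⟩, ?_, rfl, rfl, by simp⟩
  · intro i j hi hj _; simp at hi hj; omega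
  · intro i hi; simp at hi

lemma HP.cons {G : SimpleGraph V} {R : Finset V} {w u v : V} (h : HP G R u v) (hw : G.Adj w u) (hR : w ∉ R) :
    HP G (insert w R) w v := by
  rw [Finset.insert_eq]
  exact (HP.single w).join h hw (by simpa using hR)

/-- near-clique side -/
structure CSide (G : SimpleGraph V) (A A0 : Finset V) (h t : ℕ) : Prop where
  sub : A0 ⊆ A
  core : ∀ a ∈ A0, ms G a A0 ≤ h
  nb : ∀ v ∈ A, t ≤ dg G v A0
  card : A.card ≤ A0.card + 2 * h

lemma CSide.ham [Finite V] {G : SimpleGraph V} {A A0 U : Finset V} {h t : ℕ} (hA : CSide G A A0 h t) {u v : V}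
    (hU : 3 * h + 4 + U.card ≤ t) (hu : u ∈ A) (hu' : u ∉ U) (hv : v ∈ A) (hv' : v ∉ U) (huv : u ≠ v) :
    HP G (A \ U) u v := by
  refine ham_clique (C := A0 \ U) (h := h) (τ := t - U.card) (by simp [hu, hu']) (by simp [hv, hv']) huv
    (Finset.sdiff_subset_sdiff hA.sub (Finset.Subset.refl _)) ?_ ?_ ?_
  · intro w hw
    have h1 := hA.nb w (Finset.mem_sdiff.1 hw).1
    have h2 := dg_sdiff_le G w A0 U
    unfold dg at *; omega
  · intro c hc
    exact le_trans (ms_mono G c Finset.sdiff_subset) (hA.core c (Finset.mem_sdiff.1 hc).1)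
  · have h1 : (A \ U).card ≤ (A0 \ U).card + (A \ A0).card := by
      refine le_trans (Finset.card_le_card ?_) (Finset.card_union_le _ _)
      intro z; simp only [Finset.mem_sdiff, Finset.mem_union]; tauto
    have h2 := Finset.card_sdiff_add_card_eq_card hA.sub
    have h3 := hA.card
    omega

end
end W

namespace W
section
variable {V : Type} {k : ℕ}

lemma small_cross {G : SimpleGraph V} {B0 U : Finset V} {p q a b : V} {h t N : ℕ} (hpa : G.Adj p a) (hab : G.Adj a b)
    (hq : ms G q B0 ≤ h) (hb : t ≤ dg G b B0) (hcore : ∀ z ∈ B0, ms G z B0 ≤ h) (hN : 5 ≤ N)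
    (hU : U.card + N + h < t) (haU : a ∈ U) (hbU : b ∈ U) :
    ∃ l, Conn G p q l ∧ l.length + 2 = N ∧ ∀ w ∈ l, w ∈ ({a, b} : Finset V) ∨ w ∉ U := by
  obtain ⟨r, h1, h2, h3, -⟩ := alt1 G h t (N - 4) (fun _ => B0) q b U (by omega) (fun _ => hcore) hq hb
    (fun _ => hb.trans (dg_le_card _ _ _)) (by omega)
  have hbr : b ∉ r.reverse := by simp only [List.mem_reverse]; exact fun h => h3 b h hbU
  have har : a ∉ b :: r.reverse := by
    simp only [List.mem_cons, List.mem_reverse, not_or]; exact ⟨hab.ne, fun h => h3 a h haU⟩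
  refine ⟨a :: b :: r.reverse, (h1.symm.cons hab hbr).cons hpa har, by simp [h2]; omega, ?_⟩
  intro w hw
  simp only [List.mem_cons, List.mem_reverse] at hw
  rcases hw with rfl | rfl | hw
  · left; simp
  · left; simp
  · right; exact h3 w hw

lemma big_cross [Fintype V] {G : SimpleGraph V} {A B A0 B0 U : Finset V} {h t : ℕ} (hA : CSide G A A0 h t) (hB : CSide G B B0 h t)
    (hAB : ∀ v, v ∈ A ↔ v ∉ B) (hU : 3 * h + 4 + U.card ≤ t) {x y a b : V} (hx : x ∈ A) (hy : y ∈ B) (ha : a ∈ A) (hb : b ∈ B)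
    (hxU : x ∉ U) (hyU : y ∉ U) (haU : a ∉ U) (hbU : b ∉ U) (hxa : x ≠ a) (hyb : y ≠ b) (hab : G.Adj a b) :
    HP G (Finset.univ \ U) x y := by
  have h1 := hA.ham hU hx hxU ha haU hxa
  have h2 := hB.ham hU hb hbU hy hyU hyb.symm
  have := h1.join h2 hab (by
    rw [Finset.disjoint_left]; intro z hz hz'
    simp only [Finset.mem_sdiff] at hz hz'
    exact (hAB z).1 hz.1 hz'.1)
  convert this using 1
  ext z; simp only [Finset.mem_sdiff, Finset.mem_union, Finset.mem_univ, true_and, hAB z]; tauto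

lemma big_same [Fintype V] {G : SimpleGraph V} {A B A0 B0 U : Finset V} {h t h' t' : ℕ} (hA : CSide G A A0 h t) (hB : CSide G B B0 h t)
    (hAB : ∀ v, v ∈ A ↔ v ∉ B) (hU : 3 * h + 7 + U.card ≤ t) {x y a b a' b' : V} (hx : x ∈ A) (hy : y ∈ A) (ha : a ∈ A) (hb : b ∈ B)
    (ha' : a' ∈ A) (hb' : b' ∈ B)
    (hxU : x ∉ U) (hyU : y ∉ U) (haU : a ∉ U) (hbU : b ∉ U) (haU' : a' ∉ U) (hbU' : b' ∉ U)
    (hxy : x ≠ y) (hxa : x ≠ a) (hxa' : x ≠ a') (hya : y ≠ a) (hya' : y ≠ a') (haa : a ≠ a') (hbb : b ≠ b')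
    (hab : G.Adj a b) (hab' : G.Adj a' b') (hym : ms G y A0 ≤ h') (hat : t' ≤ dg G a A0) (ht' : h' + U.card + 4 < t') :
    HP G (Finset.univ \ U) y x := by
  obtain ⟨c, hc, hc'⟩ := exists_avoid (A := A0.filter (fun z => G.Adj a z))
    (U := A0.filter (fun z => ¬ G.Adj y z) ∪ (U ∪ {x, y, a, a'})) (by
      have h1 := Finset.card_union_le (A0.filter (fun z => ¬ G.Adj y z)) (U ∪ {x, y, a, a'})
      have h2 := Finset.card_union_le U {x, y, a, a'}
      have h3 : ({x, y, a, a'} : Finset V).card ≤ 4 := Finset.card_le_four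
      unfold dg at hat; unfold ms at hym; omega)
  simp only [Finset.mem_filter, Finset.mem_union, Finset.mem_insert, Finset.mem_singleton, not_or, not_and, not_not] at hc hc'
  obtain ⟨hcA0, hac⟩ := hc
  obtain ⟨hyc, hcU, hcx, hcy, hca, hca'⟩ := hc'
  have hyc := hyc hcA0
  have hcA := hA.sub hcA0
  have h1 : HP G (A \ (U ∪ {y, c, a})) a' x := hA.ham (by
      have h2 := Finset.card_union_le U {y, c, a}
      have h3 : ({y, c, a} : Finset V).card ≤ 3 := Finset.card_le_three
      omega) ha' (by simp [haU', hya'.symm, Ne.symm hca', haa.symm]) hx (by simp [hxU, hxy, Ne.symm hcx, hxa]) hxa'.symm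
  have h2 : HP G (B \ U) b b' := hB.ham (by omega) hb hbU hb' hbU' hbb
  have hnB : ∀ z, z ∈ A → z ∉ B := fun z hz => (hAB z).1 hz
  have h3 := h2.join h1 hab'.symm (by
    rw [Finset.disjoint_left]; intro z hz hz'
    simp only [Finset.mem_sdiff] at hz hz'
    exact (hAB z).1 hz'.1 hz.1)
  have h4 := h3.cons hab (by simp [hnB a ha])
  have h5 := h4.cons hac.symm (by simp [hnB c hcA, hca])
  have h6 := h5.cons hyc (by simp [hnB y hy, hya, Ne.symm hcy])
  convert h6 using 1
  ext z
  simp only [Finset.mem_sdiff, Finset.mem_union, Finset.mem_univ, true_and, Finset.mem_insert, Finset.mem_singleton]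
  have := hAB z
  by_cases e1 : z = y
  · subst e1; simp [hyU]
  by_cases e2 : z = c
  · subst e2; simp [hcU]
  by_cases e3 : z = a
  · subst e3; simp [haU]
  simp only [e1, e2, e3, false_or, or_false]
  tauto

/-- hypotheses for the two-cliques case -/
structure CA [Fintype V] (G : SimpleGraph V) (x y : Fin k → V) (o : Fin k) (A B A0 B0 : Finset V) (h : ℕ) : Prop where
  AB : ∀ v, v ∈ A ↔ v ∉ B
  sA : CSide G A A0 h (20 * h)
  sB : CSide G B B0 h (20 * h)
  nA : ∀ v ∈ A, v ∉ Ends x y → 100 * h ≤ dg G v A0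
  nB : ∀ v ∈ B, v ∉ Ends x y → 100 * h ≤ dg G v B0
  mA : ∀ v, dg G v A0 < 20 * h → ms G v B0 ≤ 23 * h
  mB : ∀ v, dg G v B0 < 20 * h → ms G v A0 ≤ 23 * h
  eA : ∀ v ∈ A0, v ∉ Ends x y
  eB : ∀ v ∈ B0, v ∉ Ends x y
  cA : 100 * (k * h) ≤ A0.card
  cB : 100 * (k * h) ≤ B0.card
  sm : ∀ i, i ≠ o → (x i ∈ A ∧ y i ∈ A) ∨ (x i ∈ B ∧ y i ∈ B) ∨
    (x i ∈ A ∧ y i ∈ B ∧ dg G (x i) B0 < 20 * h ∧ dg G (y i) A0 < 20 * h) ∨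
    (y i ∈ A ∧ x i ∈ B ∧ dg G (y i) B0 < 20 * h ∧ dg G (x i) A0 < 20 * h)
  ob : (x o ∈ A ∧ y o ∈ B) ∨ (y o ∈ A ∧ x o ∈ B) ∨
    (x o ∈ A ∧ y o ∈ A ∧ dg G (x o) B0 < 20 * h ∧ dg G (y o) B0 < 20 * h) ∨
    (x o ∈ B ∧ y o ∈ B ∧ dg G (x o) A0 < 20 * h ∧ dg G (y o) A0 < 20 * h)

lemma CA.symm [Fintype V] {G : SimpleGraph V} {x y : Fin k → V} {o : Fin k} {A B A0 B0 : Finset V} {h : ℕ}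
    (c : CA G x y o A B A0 B0 h) : CA G x y o B A B0 A0 h where
  AB := fun v => by have := c.AB v; tauto
  sA := c.sB
  sB := c.sA
  nA := c.nB
  nB := c.nA
  mA := c.mB
  mB := c.mA
  eA := c.eB
  eB := c.eA
  cA := c.cB
  cB := c.cA
  sm := fun i hi => by have := c.sm i hi; tauto
  ob := by have := c.ob; tauto

noncomputable def NC (x y : Fin k → V) (o : Fin k) (A : Finset V) : Finset V :=
  (Finset.univ.filter (fun i => i ≠ o ∧ (x i ∈ A ↔ y i ∈ A))).biUnion (fun i => {x i, y i})

noncomputable def CR (x y : Fin k → V) (o : Fin k) (A : Finset V) : Finset (Fin k) :=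
  Finset.univ.filter (fun i => i ≠ o ∧ ¬ (x i ∈ A ↔ y i ∈ A))

lemma NC_card (x y : Fin k → V) (o : Fin k) (A : Finset V) : (NC x y o A).card + 2 * (CR x y o A).card + 2 ≤ 2 * k := by
  have h1 : (NC x y o A).card ≤ 2 * (Finset.univ.filter (fun i => i ≠ o ∧ (x i ∈ A ↔ y i ∈ A))).card := by
    refine le_trans Finset.card_biUnion_le ?_
    rw [Nat.mul_comm]
    exact sum_le_mul _ _ _ 2 le_rfl (fun i _ => Finset.card_le_two)
  have h2 := filter_not_card' (Finset.univ.erase o) (fun i => (x i ∈ A ↔ y i ∈ A))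
  have e1 : (Finset.univ.erase o).filter (fun i => (x i ∈ A ↔ y i ∈ A)) = Finset.univ.filter (fun i => i ≠ o ∧ (x i ∈ A ↔ y i ∈ A)) := by
    ext i; simp
  have e2 : (Finset.univ.erase o).filter (fun i => ¬ (x i ∈ A ↔ y i ∈ A)) = CR x y o A := by
    ext i; simp [CR]
  rw [e1, e2, Finset.card_erase_of_mem (Finset.mem_univ _)] at h2
  simp only [Finset.card_univ, Fintype.card_fin] at h2
  have := o.2
  omega

lemma NC_symm {x y : Fin k → V} {o : Fin k} {A B : Finset V} (hAB : ∀ v, v ∈ A ↔ v ∉ B) : NC x y o B = NC x y o A := by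
  unfold NC
  congr 1
  refine Finset.filter_congr fun i _ => ?_
  rw [hAB, hAB]; tauto

lemma CA.count [Fintype V] {G : SimpleGraph V} {x y : Fin k → V} {N : Fin k → ℕ} {o : Fin k} {s : ℕ} (hS : Setup G x y N o s)
    {A B A0 B0 : Finset V} {h : ℕ} (c : CA G x y o A B A0 B0 h)
    (hle : (A \ NC x y o A).card ≤ (B \ NC x y o A).card) (a : V) (ha : a ∈ A0)
    (hgen : ∀ v ∈ Ends x y, dg G v A0 < 20 * h → ¬ G.Adj a v) :
    (CR x y o A).card + (if (x o ∈ A ↔ y o ∈ A) then 2 else 1) ≤ dg G a (B \ Ends x y) := by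
  have hNE : NC x y o A ⊆ Ends x y := by
    intro z hz
    simp only [NC, Finset.mem_biUnion, Finset.mem_insert, Finset.mem_singleton] at hz
    obtain ⟨i, -, hi⟩ := hz
    exact mem_Ends.2 ⟨i, hi⟩
  have haE := c.eA a ha
  have haA := c.sA.sub ha
  have hdeg := hS.deg a
  have hNC := NC_card x y o A
  set nc := NC x y o A with hnc
  have huniv : (Finset.univ : Finset V) = (A \ nc) ∪ ((B \ nc) ∪ nc) := by
    ext z; simp only [Finset.mem_univ, Finset.mem_union, Finset.mem_sdiff, true_iff]
    have := c.AB z; tauto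
  have h1 := dg_union_le G a (A \ nc) ((B \ nc) ∪ nc)
  have h2 := dg_union_le G a (B \ nc) nc
  have h3 := dg_le_card G a nc
  have h4 := dg_ms G a (A \ nc)
  have h5 : 0 < ms G a (A \ nc) := by
    refine Finset.card_pos.2 ⟨a, ?_⟩
    simp only [Finset.mem_filter, Finset.mem_sdiff]
    exact ⟨⟨haA, fun h => haE (hNE h)⟩, G.loopless.irrefl a⟩
  have h6 : (A \ nc).card + ((B \ nc).card + nc.card) = Fintype.card V := by
    rw [← Finset.card_univ, huniv, Finset.card_union_of_disjoint, Finset.card_union_of_disjoint]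
    · exact Finset.sdiff_disjoint
    · rw [Finset.disjoint_left]; intro z hz hz'
      simp only [Finset.mem_union, Finset.mem_sdiff] at hz hz'
      have := c.AB z; tauto
  have hd : dg G a Finset.univ ≤ dg G a (A \ nc) + (dg G a (B \ nc) + nc.card) := by
    rw [huniv]; omega
  change _ ≤ 2 * dg G a Finset.univ at hdeg
  have h7 : (CR x y o A).card + 2 ≤ dg G a (B \ nc) := by omega
  have notsm : ∀ z, z ∈ B → z ∉ nc → G.Adj a z → z ∈ Ends x y → z = x o ∨ z = y o := by
    intro z hzB hznc haz hzE
    obtain ⟨i, hi⟩ := mem_Ends.1 hzE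
    by_cases hio : i = o
    · subst hio; exact hi
    exfalso
    have hncr : ¬ (x i ∈ A ↔ y i ∈ A) := by
      intro hcon
      apply hznc
      simp only [hnc, NC, Finset.mem_biUnion, Finset.mem_filter, Finset.mem_univ, true_and, Finset.mem_insert, Finset.mem_singleton]
      exact ⟨i, ⟨hio, hcon⟩, hi⟩
    have hzA := c.AB z
    have hs := c.sm i hio
    have hxA := c.AB (x i)
    have hyA := c.AB (y i)
    have hg : ¬ dg G z A0 < 20 * h := fun hh => hgen z hzE hh haz
    rcases hi with rfl | rfl
    · rcases hs with ⟨s1, s2⟩ | ⟨s1, s2⟩ | ⟨s1, s2, s3, s4⟩ | ⟨s1, s2, s3, s4⟩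
      · exact hxA.1 s1 hzB
      · exact hncr ⟨fun h => (hxA.1 h s1).elim, fun h => (hyA.1 h s2).elim⟩
      · exact hxA.1 s1 hzB
      · exact hg s4
    · rcases hs with ⟨s1, s2⟩ | ⟨s1, s2⟩ | ⟨s1, s2, s3, s4⟩ | ⟨s1, s2, s3, s4⟩
      · exact hyA.1 s2 hzB
      · exact hncr ⟨fun h => (hxA.1 h s1).elim, fun h => (hyA.1 h s2).elim⟩
      · exact hg s4
      · exact hyA.1 s1 hzB
  have hgx := hgen (x o) (mem_Ends.2 ⟨o, Or.inl rfl⟩)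
  have hgy := hgen (y o) (mem_Ends.2 ⟨o, Or.inr rfl⟩)
  have hxA := c.AB (x o)
  have hyA := c.AB (y o)
  have hob := c.ob
  split_ifs with hcr
  · refine h7.trans (Finset.card_le_card ?_)
    intro z hz
    simp only [Finset.mem_filter, Finset.mem_sdiff] at hz ⊢
    refine ⟨⟨hz.1.1, fun hzE => ?_⟩, hz.2⟩
    have hzB := hz.1.1
    have haz := hz.2
    have hor := notsm z hz.1.1 hz.1.2 hz.2 hzE
    rcases hob with ⟨s1, s2⟩ | ⟨s1, s2⟩ | ⟨s1, s2, s3, s4⟩ | ⟨s1, s2, s3, s4⟩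
    · exact hyA.1 (hcr.1 s1) s2
    · exact hxA.1 (hcr.2 s1) s2
    · rcases hor with rfl | rfl
      · exact hxA.1 s1 hzB
      · exact hyA.1 s2 hzB
    · rcases hor with rfl | rfl
      · exact hgx s3 haz
      · exact hgy s4 haz
  · have hsub : (B \ nc).filter (fun b => G.Adj a b) ⊆ insert (if x o ∈ B then x o else y o) ((B \ Ends x y).filter (fun b => G.Adj a b)) := by
      intro z hz
      simp only [Finset.mem_insert, Finset.mem_filter, Finset.mem_sdiff] at hz ⊢
      by_cases hzE : z ∈ Ends x y
      · left
        rcases notsm z hz.1.1 hz.1.2 hz.2 hzE with rfl | rfl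
        · rw [if_pos hz.1.1]
        · rw [if_neg (fun hxB => hcr ⟨fun h => (hxA.1 h hxB).elim, fun h => (hyA.1 h hz.1.1).elim⟩)]
      · right; exact ⟨⟨hz.1.1, hzE⟩, hz.2⟩
    have h8 := Finset.card_le_card hsub
    have h9 := Finset.card_insert_le (if x o ∈ B then x o else y o) ((B \ Ends x y).filter (fun b => G.Adj a b))
    unfold dg at h7 ⊢
    omega

end
end W

namespace W
section
variable {V : Type} {k : ℕ}

lemma Setup.o_not_used [Fintype V] {G : SimpleGraph V} {x y : Fin k → V} {N : Fin k → ℕ} {o : Fin k} {s : ℕ}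
    (h : Setup G x y N o s) {l : Fin k → List V} (hSC : SC G x y N o l) : y o ∉ used x y o l ∧ x o ∉ used x y o l := by
  constructor <;> rw [mem_used] <;> rintro ⟨i, hi, h' | h' | h'⟩
  · exact h.inj.2.2 _ _ h'.symm
  · exact hi (h.inj.2.1 _ _ h').symm
  · exact ((hSC.1 i hi).2.2 _ h' o).2 rfl
  · exact hi (h.inj.1 _ _ h').symm
  · exact h.inj.2.2 _ _ h'
  · exact ((hSC.1 i hi).2.2 _ h' o).1 rfl

lemma gen_card {G : SimpleGraph V} {A0 E : Finset V} {t m : ℕ} (hE : E.card ≤ m) :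
    A0.card ≤ (A0.filter (fun a => ∀ v ∈ E, dg G v A0 < t → ¬ G.Adj a v)).card + m * t := by
  have hsub : A0 ⊆ (A0.filter (fun a => ∀ v ∈ E, dg G v A0 < t → ¬ G.Adj a v)) ∪
      (E.filter (fun v => dg G v A0 < t)).biUnion (fun v => A0.filter (fun a => G.Adj v a)) := by
    intro a ha
    simp only [Finset.mem_union, Finset.mem_filter, Finset.mem_biUnion]
    by_cases hh : ∀ v ∈ E, dg G v A0 < t → ¬ G.Adj a v
    · left; exact ⟨ha, hh⟩
    · right; push Not at hh
      obtain ⟨v, h1, h2, h3⟩ := hh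
      exact ⟨v, ⟨h1, h2⟩, ha, h3.symm⟩
  refine (Finset.card_le_card hsub).trans ((Finset.card_union_le _ _).trans (Nat.add_le_add_left ?_ _))
  refine Finset.card_biUnion_le.trans ?_
  refine sum_le_mul _ _ _ _ ((Finset.card_filter_le _ _).trans hE) ?_
  intro v hv
  exact (Finset.mem_filter.1 hv).2.le

theorem caseA_le [Fintype V] {G : SimpleGraph V} {x y : Fin k → V} {N : Fin k → ℕ} {o : Fin k} {s : ℕ} (hS : Setup G x y N o s)
    {A B A0 B0 : Finset V} {h : ℕ} (c : CA G x y o A B A0 B0 h)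
    (hle : (A \ NC x y o A).card ≤ (B \ NC x y o A).card) (hk : 4 * k + 8 ≤ h) (hsh : s ≤ h) : Concl G x y N := by
  have hVne : Nonempty V := ⟨x o⟩
  have hk1 : 1 ≤ k := by have := o.2; omega
  have hkh : h ≤ k * h := Nat.le_mul_of_pos_left h hk1
  have hcA := c.cA
  set Γ := A0.filter (fun a => ∀ v ∈ Ends x y, dg G v A0 < 20 * h → ¬ G.Adj a v) with hΓ
  have hΓA : Γ ⊆ A0 := Finset.filter_subset _ _
  have hΓc : 60 * (k * h) ≤ Γ.card := by
    have h1 : A0.card ≤ Γ.card + 2 * k * (20 * h) := by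
      convert gen_card (G := G) (A0 := A0) (t := 20 * h) (card_Ends x y)
    have h2 : 2 * k * (20 * h) = 40 * (k * h) := by ring
    rw [h2] at h1
    omega
  set pv : Fin k → V := fun i => if x i ∈ A then x i else y i with hpv
  set cand : Fin k ⊕ Bool → Finset V := fun j => Sum.elim (fun i => Γ.filter (fun a => G.Adj (pv i) a)) (fun _ => Γ) j with hcand
  have hcandΓ : ∀ j, cand j ⊆ Γ := by
    rintro (i | i)
    · exact Finset.filter_subset _ _
    · exact Finset.Subset.refl _
  set m := (CR x y o A).card + (if (x o ∈ A ↔ y o ∈ A) then 2 else 1) with hm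
  have hNCc := NC_card x y o A
  have hmk : m ≤ k + 1 := by rw [hm]; split_ifs <;> omega
  set J : Finset (Fin k ⊕ Bool) := (CR x y o A).disjSum (if (x o ∈ A ↔ y o ∈ A) then Finset.univ else {false}) with hJ
  have hJc : J.card = m := by rw [hJ, Finset.card_disjSum, hm]; split_ifs <;> simp
  have hcrd : ∀ i ∈ CR x y o A, (x i ∈ A ∧ y i ∈ B ∧ dg G (x i) B0 < 20 * h ∧ dg G (y i) A0 < 20 * h) ∨
      (y i ∈ A ∧ x i ∈ B ∧ dg G (y i) B0 < 20 * h ∧ dg G (x i) A0 < 20 * h) := by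
    intro i hi
    simp only [CR, Finset.mem_filter, Finset.mem_univ, true_and] at hi
    rcases c.sm i hi.1 with h' | h' | h' | h'
    · exact (hi.2 ⟨fun _ => h'.2, fun _ => h'.1⟩).elim
    · exact (hi.2 ⟨fun h => ((c.AB _).1 h h'.1).elim, fun h => ((c.AB _).1 h h'.2).elim⟩).elim
    · exact Or.inl h'
    · exact Or.inr h'
  obtain ⟨a, b, hab, hinj⟩ := links (G := G) cand (B \ Ends x y) m J hJc.le (by
    rintro (i | i) hi
    · have hiC : i ∈ CR x y o A := by simpa [hJ] using hi
      have hpm : ms G (pv i) A0 ≤ 23 * h := by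
        apply c.mB
        rcases hcrd i hiC with h' | h'
        · simp only [hpv, if_pos h'.1]; exact h'.2.2.1
        · have : x i ∉ A := fun hx => (c.AB _).1 hx h'.2.1
          simp only [hpv, if_neg this]; exact h'.2.2.1
      have h1 := dg_ms G (pv i) Γ
      have h2 := ms_mono G (pv i) hΓA
      change m ≤ dg G (pv i) Γ
      omega
    · change m ≤ Γ.card; omega) (by
    intro j _ a ha
    have := Finset.mem_filter.1 (hcandΓ j ha)
    exact c.count hS hle a this.1 this.2)
  have hJl : ∀ i, Sum.inl i ∈ J ↔ i ∈ CR x y o A := by intro i; simp [hJ]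
  have hJf : Sum.inr false ∈ J := by simp only [hJ, Finset.inr_mem_disjSum]; split_ifs <;> simp
  have hJt : (x o ∈ A ↔ y o ∈ A) → Sum.inr true ∈ J := by intro hh; simp only [hJ, Finset.inr_mem_disjSum, if_pos hh]; simp
  have haA0 : ∀ j ∈ J, a j ∈ A0 := fun j hj => hΓA (hcandΓ j (hab j hj).1)
  have haA : ∀ j ∈ J, a j ∈ A := fun j hj => c.sA.sub (haA0 j hj)
  have haE : ∀ j ∈ J, a j ∉ Ends x y := fun j hj => c.eA _ (haA0 j hj)
  have hbB : ∀ j ∈ J, b j ∈ B ∧ b j ∉ Ends x y := fun j hj => Finset.mem_sdiff.1 (hab j hj).2.1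
  have hABne : ∀ j ∈ J, ∀ j' ∈ J, a j ≠ b j' := by
    intro j hj j' hj' he
    exact (c.AB _).1 (haA j hj) (he ▸ (hbB j' hj').1)
  set g : Fin k → Finset V := fun i => if i ∈ CR x y o A then {a (Sum.inl i), b (Sum.inl i)} else ∅ with hg
  have hgm : ∀ i w, w ∈ g i → i ∈ CR x y o A ∧ (w = a (Sum.inl i) ∨ w = b (Sum.inl i)) := by
    intro i w hw
    simp only [hg] at hw
    split_ifs at hw with hc
    · exact ⟨hc, by simpa using hw⟩
    · simp at hw
  set U0 : Finset V := {a (Sum.inr false), b (Sum.inr false), a (Sum.inr true), b (Sum.inr true)} with hU0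
  have hU0c : U0.card ≤ 4 := Finset.card_le_four
  obtain ⟨l, hSC, hl⟩ := sc_gadget2 (G := G) (x := x) (y := y) (N := N) (o := o) (s := s) (B := 4 * h) g U0 (fun _ _ => True) hS.small
    (by
      intro i hi w hw
      obtain ⟨hc, rfl | rfl⟩ := hgm i w hw
      · exact haE _ ((hJl i).2 hc)
      · exact (hbB _ ((hJl i).2 hc)).2)
    (by
      intro i j hi hj hij
      rw [Finset.disjoint_left]
      intro w hw hw'
      obtain ⟨hc, hw⟩ := hgm i w hw
      obtain ⟨hc', hw'⟩ := hgm j w hw'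
      have hne : (Sum.inl i : Fin k ⊕ Bool) ≠ Sum.inl j := by simpa using hij
      have h1 := hinj _ ((hJl i).2 hc) _ ((hJl j).2 hc') hne
      rcases hw with rfl | rfl <;> rcases hw' with hw' | hw'
      · exact h1.1 hw'
      · exact hABne _ ((hJl i).2 hc) _ ((hJl j).2 hc') hw'
      · exact hABne _ ((hJl j).2 hc') _ ((hJl i).2 hc) hw'.symm
      · exact h1.2 hw')
    (by
      intro i hi
      have := hS.five i
      simp only [hg]; split_ifs
      · exact Finset.card_le_two.trans (by omega)
      · simp)
    (by omega)
    (by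
      intro i hi U hU hU0U hgU hEU
      have h5 := hS.five i
      have hNs := hS.Nle hi
      by_cases hcr : i ∈ CR x y o A
      · have hgi : g i = {a (Sum.inl i), b (Sum.inl i)} := by simp only [hg, if_pos hcr]
        have hjJ := (hJl i).2 hcr
        have hA := hab _ hjJ
        have hadj : G.Adj (pv i) (a (Sum.inl i)) := (Finset.mem_filter.1 hA.1).2
        have hb := hbB _ hjJ
        have main : ∀ p q, G.Adj p (a (Sum.inl i)) → dg G q A0 < 20 * h →
            ∃ l, Conn G p q l ∧ l.length + 2 = N i ∧ ∀ w ∈ l, w ∈ g i ∨ w ∉ U := by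
          intro p q hp hq
          rw [hgi]
          refine small_cross (B0 := B0) (h := 23 * h) (t := 100 * h) hp hA.2.2 (c.mA q hq) (c.nB _ hb.1 hb.2) ?_ h5 (by omega) ?_ ?_
          · intro z hz; exact (c.sB.core z hz).trans (by omega)
          · exact hgU (by rw [hgi]; simp)
          · exact hgU (by rw [hgi]; simp)
        rcases hcrd i hcr with h' | h'
        · have e1 : pv i = x i := by simp only [hpv, if_pos h'.1]
          obtain ⟨l, l1, l2, l3⟩ := main (x i) (y i) (e1 ▸ hadj) h'.2.2.2
          exact ⟨l.reverse, l1.symm, by simpa using l2, trivial, fun w hw => l3 w (List.mem_reverse.1 hw)⟩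
        · have : x i ∉ A := fun hx => (c.AB _).1 hx h'.2.1
          have e1 : pv i = y i := by simp only [hpv, if_neg this]
          obtain ⟨l, l1, l2, l3⟩ := main (y i) (x i) (e1 ▸ hadj) h'.2.2.2
          exact ⟨l, l1, l2, trivial, l3⟩
      · have same : ∀ S S0 : Finset V, CSide G S S0 h (20 * h) → x i ∈ S → y i ∈ S →
            ∃ l, Conn G (y i) (x i) l ∧ l.length + 2 = N i ∧ True ∧ ∀ w ∈ l, w ∈ g i ∨ w ∉ U := by
          intro S S0 hCS hx hy
          obtain ⟨l, l1, l2, l3, -⟩ := alt2 G h (20 * h) (N i - 2) (fun _ => S0) (y i) (x i) U (by omega) (fun _ => hCS.core)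
            (hCS.nb _ hy) (hCS.nb _ hx) (fun _ => (hCS.nb _ hx).trans (dg_le_card _ _ _)) (by omega)
          exact ⟨l, l1, by omega, trivial, fun w hw => Or.inr (l3 w hw)⟩
        have hnc : (x i ∈ A ↔ y i ∈ A) := by
          by_contra hcon; exact hcr (by simp only [CR, Finset.mem_filter, Finset.mem_univ, true_and]; exact ⟨hi, hcon⟩)
        by_cases hxA : x i ∈ A
        · exact same A A0 c.sA hxA (hnc.1 hxA)
        · have hyA : y i ∉ A := fun h => hxA (hnc.2 h)
          exact same B B0 c.sB (by have := c.AB (x i); tauto) (by have := c.AB (y i); tauto))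
  refine finish hS.adj hS.inj hS.sum hSC ?_
  have hcard := sc_card hS.inj hSC
  have hsm := hS.small
  have hou := hS.o_not_used hSC
  -- the links of `o` are not used
  have hnu : ∀ β : Bool, Sum.inr β ∈ J → a (Sum.inr β) ∉ used x y o l ∧ b (Sum.inr β) ∉ used x y o l := by
    intro β hβ
    have hU : a (Sum.inr β) ∈ U0 ∧ b (Sum.inr β) ∈ U0 := by cases β <;> simp [hU0]
    constructor <;> rw [mem_used] <;> rintro ⟨i, hi, h' | h' | h'⟩
    · exact haE _ hβ (mem_Ends.2 ⟨i, Or.inl h'⟩)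
    · exact haE _ hβ (mem_Ends.2 ⟨i, Or.inr h'⟩)
    · rcases (hl i hi).2 _ h' with h2 | h2
      · obtain ⟨hc, h3⟩ := hgm i _ h2
        rcases h3 with h3 | h3
        · exact (hinj _ hβ _ ((hJl i).2 hc) (by simp)).1 h3
        · exact hABne _ hβ _ ((hJl i).2 hc) h3
      · exact h2 hU.1
    · exact (hbB _ hβ).2 (mem_Ends.2 ⟨i, Or.inl h'⟩)
    · exact (hbB _ hβ).2 (mem_Ends.2 ⟨i, Or.inr h'⟩)
    · rcases (hl i hi).2 _ h' with h2 | h2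
      · obtain ⟨hc, h3⟩ := hgm i _ h2
        rcases h3 with h3 | h3
        · exact hABne _ ((hJl i).2 hc) _ hβ h3.symm
        · exact (hinj _ hβ _ ((hJl i).2 hc) (by simp)).2 h3
      · exact h2 hU.2
  have hxE : x o ∈ Ends x y := mem_Ends.2 ⟨o, Or.inl rfl⟩
  have hyE : y o ∈ Ends x y := mem_Ends.2 ⟨o, Or.inr rfl⟩
  have nE : ∀ {p q : V}, p ∈ Ends x y → q ∉ Ends x y → p ≠ q := fun hp hq he => hq (he ▸ hp)
  set U := used x y o l with hU
  rcases c.ob with ⟨s1, s2⟩ | ⟨s1, s2⟩ | ⟨s1, s2, s3, s4⟩ | ⟨s1, s2, s3, s4⟩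
  · exact (big_cross c.sA c.sB c.AB (by omega) s1 s2 (haA _ hJf) (hbB _ hJf).1 hou.2 hou.1 (hnu _ hJf).1 (hnu _ hJf).2
      (nE hxE (haE _ hJf)) (nE hyE (hbB _ hJf).2) (hab _ hJf).2.2).symm
  · exact (big_cross c.sA c.sB c.AB (by omega) s1 s2 (haA _ hJf) (hbB _ hJf).1 hou.1 hou.2 (hnu _ hJf).1 (hnu _ hJf).2
      (nE hyE (haE _ hJf)) (nE hxE (hbB _ hJf).2) (hab _ hJf).2.2)
  · have hJt' := hJt ⟨fun _ => s2, fun _ => s1⟩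
    have hd := hinj _ hJf _ hJt' (by simp)
    exact big_same c.sA c.sB c.AB (by omega) s1 s2 (haA _ hJf) (hbB _ hJf).1 (haA _ hJt') (hbB _ hJt').1
      hou.2 hou.1 (hnu _ hJf).1 (hnu _ hJf).2 (hnu _ hJt').1 (hnu _ hJt').2 (hS.adj o).ne
      (nE hxE (haE _ hJf)) (nE hxE (haE _ hJt')) (nE hyE (haE _ hJf)) (nE hyE (haE _ hJt')) hd.1 hd.2
      (hab _ hJf).2.2 (hab _ hJt').2.2 (c.mB _ s4) (c.nA _ (haA _ hJf) (haE _ hJf)) (by omega)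
  · have hJt' := hJt ⟨fun h => ((c.AB _).1 h s1).elim, fun h => ((c.AB _).1 h s2).elim⟩
    have hd := hinj _ hJf _ hJt' (by simp)
    exact big_same c.sB c.sA c.symm.AB (by omega) s1 s2 (hbB _ hJf).1 (haA _ hJf) (hbB _ hJt').1 (haA _ hJt')
      hou.2 hou.1 (hnu _ hJf).2 (hnu _ hJf).1 (hnu _ hJt').2 (hnu _ hJt').1 (hS.adj o).ne
      (nE hxE (hbB _ hJf).2) (nE hxE (hbB _ hJt').2) (nE hyE (hbB _ hJf).2) (nE hyE (hbB _ hJt').2) hd.2 hd.1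
      (hab _ hJf).2.2.symm (hab _ hJt').2.2.symm (c.mA _ s4) (c.nB _ (hbB _ hJf).1 (hbB _ hJf).2) (by omega)

theorem caseA [Fintype V] {G : SimpleGraph V} {x y : Fin k → V} {N : Fin k → ℕ} {o : Fin k} {s : ℕ} (hS : Setup G x y N o s)
    {A B A0 B0 : Finset V} {h : ℕ} (c : CA G x y o A B A0 B0 h) (hk : 4 * k + 8 ≤ h) (hsh : s ≤ h) : Concl G x y N := by
  rcases le_total (A \ NC x y o A).card (B \ NC x y o A).card with hle | hle
  · exact caseA_le hS c hle hk hsh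
  · refine caseA_le hS c.symm ?_ hk hsh
    rw [NC_symm c.AB]; exact hle

end
end W

namespace W
section
variable {V : Type} {k : ℕ}

lemma core_deg [Fintype V] {G : SimpleGraph V} {A0 B0 : Finset V} {h m : ℕ} (hd : Disjoint A0 B0)
    (hA : Fintype.card V ≤ 2 * A0.card + 2 * h) (hB : Fintype.card V ≤ 2 * B0.card + 2 * h)
    (hdeg : ∀ v, Fintype.card V + m ≤ 2 * (Finset.univ.filter (G.Adj v ·)).card) (v : V) :
    Fintype.card V + m ≤ 2 * dg G v A0 + 2 * dg G v B0 + 4 * h ∧ 2 * A0.card ≤ Fintype.card V + 2 * h ∧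
      2 * B0.card ≤ Fintype.card V + 2 * h := by
  have h1 : Fintype.card V + m ≤ 2 * dg G v Finset.univ := hdeg v
  have h2 := dg_split G v Finset.univ (A0 ∪ B0)
  have h3 := dg_union G v hd
  have h4 := Finset.card_sdiff_add_card_eq_card (Finset.subset_univ (A0 ∪ B0))
  rw [Finset.card_union_of_disjoint hd, Finset.card_univ] at h4
  omega

theorem caseA' [Fintype V] {G : SimpleGraph V} {x y : Fin k → V} {N : Fin k → ℕ} {o : Fin k} {s : ℕ} (hS : Setup G x y N o s)
    {A0 B0 : Finset V} {h : ℕ} (hd : Disjoint A0 B0)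
    (hA : Fintype.card V ≤ 2 * A0.card + 2 * h) (hB : Fintype.card V ≤ 2 * B0.card + 2 * h)
    (mA : ∀ a ∈ A0, ms G a A0 ≤ h) (mB : ∀ a ∈ B0, ms G a B0 ≤ h)
    (eA : ∀ v ∈ A0, v ∉ Ends x y) (eB : ∀ v ∈ B0, v ∉ Ends x y)
    (hk : 4 * k + 8 ≤ h) (hsh : s ≤ h) (hn : 1000 * (k * h) ≤ Fintype.card V) : Concl G x y N := by
  have hk1 : 1 ≤ k := by have := o.2; omega
  have hkh : h ≤ k * h := Nat.le_mul_of_pos_left h hk1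
  have hcd := core_deg hd hA hB hS.deg
  have hcan : ∀ v, ¬ 20 * h ≤ dg G v A0 → 20 * h ≤ dg G v B0 := by
    intro v hv; have := hcd v; omega
  have hcan' : ∀ v, ¬ 100 * h ≤ dg G v A0 → 100 * h ≤ dg G v B0 := by
    intro v hv; have := hcd v; omega
  have key : ∀ i, ∃ sx sy : Prop, (sx → 20 * h ≤ dg G (x i) A0) ∧ (¬ sx → 20 * h ≤ dg G (x i) B0) ∧
      (sy → 20 * h ≤ dg G (y i) A0) ∧ (¬ sy → 20 * h ≤ dg G (y i) B0) ∧
      (i ≠ o → (sx ∧ sy) ∨ (¬ sx ∧ ¬ sy) ∨ (sx ∧ ¬ sy ∧ dg G (x i) B0 < 20 * h ∧ dg G (y i) A0 < 20 * h) ∨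
        (sy ∧ ¬ sx ∧ dg G (y i) B0 < 20 * h ∧ dg G (x i) A0 < 20 * h)) ∧
      (i = o → (sx ∧ ¬ sy) ∨ (sy ∧ ¬ sx) ∨ (sx ∧ sy ∧ dg G (x i) B0 < 20 * h ∧ dg G (y i) B0 < 20 * h) ∨
        (¬ sx ∧ ¬ sy ∧ dg G (x i) A0 < 20 * h ∧ dg G (y i) A0 < 20 * h)) := by
    intro i
    have h1 := hcan (x i)
    have h2 := hcan (y i)
    by_cases hi : i = o
    · by_cases a1 : 20 * h ≤ dg G (x i) A0 <;> by_cases b1 : 20 * h ≤ dg G (x i) B0 <;>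
        by_cases a2 : 20 * h ≤ dg G (y i) A0 <;> by_cases b2 : 20 * h ≤ dg G (y i) B0 <;>
        first
        | exact absurd (h1 a1) b1
        | exact absurd (h2 a2) b2
        | (refine ⟨True, False, ?_⟩; clear hcd hcan hcan' mA mB eA eB; simp_all; done)
        | (refine ⟨False, True, ?_⟩; clear hcd hcan hcan' mA mB eA eB; simp_all; done)
        | (refine ⟨True, True, ?_⟩; clear hcd hcan hcan' mA mB eA eB; simp_all; done)
        | (refine ⟨False, False, ?_⟩; clear hcd hcan hcan' mA mB eA eB; simp_all; done)
    · by_cases a1 : 20 * h ≤ dg G (x i) A0 <;> by_cases b1 : 20 * h ≤ dg G (x i) B0 <;>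
        by_cases a2 : 20 * h ≤ dg G (y i) A0 <;> by_cases b2 : 20 * h ≤ dg G (y i) B0 <;>
        first
        | exact absurd (h1 a1) b1
        | exact absurd (h2 a2) b2
        | (refine ⟨True, True, ?_⟩; clear hcd hcan hcan' mA mB eA eB; simp_all; done)
        | (refine ⟨False, False, ?_⟩; clear hcd hcan hcan' mA mB eA eB; simp_all; done)
        | (refine ⟨True, False, ?_⟩; clear hcd hcan hcan' mA mB eA eB; simp_all; done)
        | (refine ⟨False, True, ?_⟩; clear hcd hcan hcan' mA mB eA eB; simp_all; done)
  choose sx sy k1 k2 k3 k4 k5 k6 using key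
  obtain ⟨A, hAdef⟩ : ∃ A : Finset V, ∀ v, v ∈ A ↔ (v ∈ A0 ∨ (v ∉ Ends x y ∧ v ∉ B0 ∧ 100 * h ≤ dg G v A0) ∨ (∃ i, v = x i ∧ sx i) ∨
      ∃ i, v = y i ∧ sy i) := ⟨(Set.toFinite {v | v ∈ A0 ∨ (v ∉ Ends x y ∧ v ∉ B0 ∧ 100 * h ≤ dg G v A0) ∨ (∃ i, v = x i ∧ sx i) ∨
      ∃ i, v = y i ∧ sy i}).toFinset, fun v => by rw [Set.Finite.mem_toFinset, Set.mem_setOf_eq]⟩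
  have hBdef : ∀ v, v ∈ Aᶜ ↔ v ∉ A := fun v => Finset.mem_compl
  have hxE : ∀ i, x i ∈ Ends x y := fun i => mem_Ends.2 ⟨i, Or.inl rfl⟩
  have hyE : ∀ i, y i ∈ Ends x y := fun i => mem_Ends.2 ⟨i, Or.inr rfl⟩
  have hxA : ∀ i, x i ∈ A ↔ sx i := by
    intro i
    rw [hAdef]
    constructor
    · rintro (h' | h' | ⟨j, h', h''⟩ | ⟨j, h', h''⟩)
      · exact (eA _ h' (hxE i)).elim
      · exact (h'.1 (hxE i)).elim
      · rwa [hS.inj.1 _ _ h']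
      · exact (hS.inj.2.2 _ _ h').elim
    · intro h'; exact Or.inr (Or.inr (Or.inl ⟨i, rfl, h'⟩))
  have hyA : ∀ i, y i ∈ A ↔ sy i := by
    intro i
    rw [hAdef]
    constructor
    · rintro (h' | h' | ⟨j, h', h''⟩ | ⟨j, h', h''⟩)
      · exact (eA _ h' (hyE i)).elim
      · exact (h'.1 (hyE i)).elim
      · exact (hS.inj.2.2 _ _ h'.symm).elim
      · rwa [hS.inj.2.1 _ _ h']
    · intro h'; exact Or.inr (Or.inr (Or.inr ⟨i, rfl, h'⟩))
  have sA0 : A0 ⊆ A := fun v hv => (hAdef v).2 (Or.inl hv)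
  have sB0 : B0 ⊆ Aᶜ := by
    intro v hv
    rw [hBdef, hAdef]
    rintro (h' | h' | ⟨j, h', h''⟩ | ⟨j, h', h''⟩)
    · exact Finset.disjoint_left.1 hd h' hv
    · exact h'.2.1 hv
    · exact eB v hv (h' ▸ hxE j)
    · exact eB v hv (h' ▸ hyE j)
  have cc : A.card + Aᶜ.card = Fintype.card V := Finset.card_add_card_compl A
  have cA0 := Finset.card_le_card sA0
  have cB0 := Finset.card_le_card sB0
  have nA : ∀ v ∈ A, v ∉ Ends x y → 100 * h ≤ dg G v A0 := by
    intro v hv hvE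
    rcases (hAdef v).1 hv with h' | h' | ⟨j, h', h''⟩ | ⟨j, h', h''⟩
    · have := mA v h'; have := dg_ms G v A0; omega
    · exact h'.2.2
    · exact (hvE (h' ▸ hxE j)).elim
    · exact (hvE (h' ▸ hyE j)).elim
  have nB : ∀ v ∈ Aᶜ, v ∉ Ends x y → 100 * h ≤ dg G v B0 := by
    intro v hv hvE
    by_cases hvB : v ∈ B0
    · have := mB v hvB; have := dg_ms G v B0; omega
    · apply hcan'
      intro h'
      exact (hBdef v).1 hv ((hAdef v).2 (Or.inr (Or.inl ⟨hvE, hvB, h'⟩)))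
  refine caseA (A := A) (B := Aᶜ) (A0 := A0) (B0 := B0) (h := h) hS ⟨?_, ⟨sA0, mA, ?_, by omega⟩, ⟨sB0, mB, ?_, by omega⟩, nA, nB, ?_, ?_, eA, eB, by omega, by omega, ?_, ?_⟩ hk hsh
  · intro v; rw [hBdef, not_not]
  · intro v hv
    by_cases hvE : v ∈ Ends x y
    · obtain ⟨i, rfl | rfl⟩ := mem_Ends.1 hvE
      · exact k1 i ((hxA i).1 hv)
      · exact k3 i ((hyA i).1 hv)
    · have := nA v hv hvE; omega
  · intro v hv
    by_cases hvE : v ∈ Ends x y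
    · obtain ⟨i, rfl | rfl⟩ := mem_Ends.1 hvE
      · exact k2 i (fun h' => (hBdef _).1 hv ((hxA i).2 h'))
      · exact k4 i (fun h' => (hBdef _).1 hv ((hyA i).2 h'))
    · have := nB v hv hvE; omega
  · intro v hv
    have := hcd v; have := dg_ms G v B0; omega
  · intro v hv
    have := hcd v; have := dg_ms G v A0; omega
  · intro i hi
    have := k5 i hi
    simpa only [hBdef, hxA, hyA] using this
  · have := k6 o rfl
    simpa only [hBdef, hxA, hyA] using this

end
end W

namespace W
section
variable {V : Type} {k : ℕ}

/-- a matching of edges from `X` to `Y` -/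
def Mt (G : SimpleGraph V) (X Y : Finset V) (M : List (V × V)) : Prop :=
  (∀ e ∈ M, G.Adj e.1 e.2 ∧ e.1 ∈ X ∧ e.2 ∈ Y) ∧ (fl M).Nodup

lemma Mt.nil (G : SimpleGraph V) (X Y : Finset V) : Mt G X Y [] := ⟨by simp, by simp [fl]⟩

lemma Mt.cons {G : SimpleGraph V} {X Y : Finset V} {M : List (V × V)} (h : Mt G X Y M) {a b : V} (hab : G.Adj a b) (ha : a ∈ X) (hb : b ∈ Y)
    (ha' : a ∉ fl M) (hb' : b ∉ fl M) : Mt G X Y ((a, b) :: M) := by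
  refine ⟨?_, ?_⟩
  · intro e he
    rcases List.mem_cons.1 he with rfl | he
    · exact ⟨hab, ha, hb⟩
    · exact h.1 e he
  · rw [fl_cons]
    simp only [List.nodup_cons, List.mem_cons, not_or]
    exact ⟨⟨hab.ne, ha'⟩, hb', h.2⟩

lemma exists_of_mem_fl {M : List (V × V)} {a : V} (h : a ∈ fl M) : ∃ e ∈ M, a = e.1 ∨ a = e.2 := by
  simp only [fl, List.mem_flatMap] at h
  obtain ⟨e, he, h⟩ := h
  exact ⟨e, he, by simpa using h⟩

lemma fl_card (M : List (V × V)) : (fl M).toFinset.card ≤ 2 * M.length := by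
  have := List.toFinset_card_le (fl M); rw [fl_length] at this; omega

lemma match_bdd {G : SimpleGraph V} {X Y : Finset V} {d D : ℕ} (hd : ∀ a ∈ X, d ≤ dg G a Y) (hD : ∀ v ∈ Y, dg G v X ≤ D) (hXY : X ⊆ Y) :
    ∀ m, 2 * m * (D + d) < d * X.card + 2 * (D + d) → ∃ M, Mt G X Y M ∧ M.length = m := by
  intro m
  induction m with
  | zero => intro _; exact ⟨[], Mt.nil _ _ _, rfl⟩
  | succ m ih =>
    intro hm
    obtain ⟨M, hM, hl⟩ := ih (by
      have : 2 * (m + 1) * (D + d) = 2 * m * (D + d) + 2 * (D + d) := by ring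
      omega)
    have hSc := fl_card M
    rw [hl] at hSc
    set S := (fl M).toFinset with hS
    have hSY : S ⊆ Y := by
      intro v hv
      rw [hS, List.mem_toFinset] at hv
      obtain ⟨e, he, h'⟩ := exists_of_mem_fl hv
      have := hM.1 e he
      rcases h' with rfl | rfl
      · exact hXY this.2.1
      · exact this.2.2
    by_cases hex : ∃ a ∈ X \ S, ∃ b ∈ Y \ S, G.Adj a b
    · obtain ⟨a, ha, b, hb, hab⟩ := hex
      simp only [Finset.mem_sdiff, hS, List.mem_toFinset] at ha hb
      exact ⟨_, hM.cons hab ha.1 hb.1 ha.2 hb.2, by simp [hl]⟩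
    · exfalso
      push Not at hex
      have h1 : ∀ a ∈ X \ S, d ≤ (S.filter (fun b => G.Adj a b)).card := by
        intro a ha
        refine (hd a (Finset.mem_sdiff.1 ha).1).trans (Finset.card_le_card ?_)
        intro b hb
        simp only [Finset.mem_filter] at hb ⊢
        refine ⟨?_, hb.2⟩
        by_contra hbS
        exact hex a ha b (Finset.mem_sdiff.2 ⟨hb.1, hbS⟩) hb.2
      have h2 : (X \ S).card * d ≤ ∑ a ∈ X \ S, (S.filter (fun b => G.Adj a b)).card := by
        rw [← smul_eq_mul]; exact Finset.card_nsmul_le_sum _ _ _ h1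
      have h3 : ∑ a ∈ X \ S, (S.filter (fun b => G.Adj a b)).card = ∑ b ∈ S, ((X \ S).filter (fun a => G.Adj b a)).card := by
        rw [pc_comm]
        refine Finset.sum_congr rfl fun b _ => ?_
        congr 1
        exact Finset.filter_congr fun a _ => G.adj_comm a b
      have h4 : ∑ b ∈ S, ((X \ S).filter (fun a => G.Adj b a)).card ≤ (2 * m) * D := by
        refine sum_le_mul _ _ _ _ hSc ?_
        intro b hb
        exact (dg_mono G b Finset.sdiff_subset).trans (hD b (hSY hb))
      have h5 := Finset.le_card_sdiff S X
      have h6 : X.card ≤ (X \ S).card + 2 * m := by omega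
      have h7 := Nat.mul_le_mul_left d h6
      nlinarith

lemma match_deg {G : SimpleGraph V} : ∀ (r : ℕ) (X Y : Finset V), (∀ a ∈ X, r ≤ dg G a Y) → X ⊆ Y → 4 * r * r + 3 * r < X.card →
    ∃ M, Mt G X Y M ∧ M.length = r := by
  intro r
  induction r with
  | zero => intro X Y _ _ _; exact ⟨[], Mt.nil _ _ _, rfl⟩
  | succ r ih =>
    intro X Y hd hXY hc
    by_cases hex : ∃ v ∈ Y, 2 * r + 2 ≤ dg G v X
    · obtain ⟨v, hv, hvd⟩ := hex
      obtain ⟨M, hM, hl⟩ := ih (X.erase v) (Y.erase v) (by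
        intro a ha
        have h1 := hd a (Finset.mem_of_mem_erase ha)
        have h2 := dg_sdiff_le G a Y {v}
        rw [Finset.sdiff_singleton_eq_erase] at h2
        simp only [Finset.card_singleton] at h2; omega)
        (Finset.erase_subset_erase _ hXY) (by
          have := Finset.pred_card_le_card_erase (a := v) (s := X)
          have e1 : 4 * (r + 1) * (r + 1) + 3 * (r + 1) = 4 * r * r + 3 * r + (8 * r + 7) := by ring
          omega)
      obtain ⟨w, hw, hw'⟩ := exists_avoid (A := X.filter (fun w => G.Adj v w)) (U := (fl M).toFinset) (by
        have := fl_card M; unfold dg at hvd; omega)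
      simp only [Finset.mem_filter, List.mem_toFinset] at hw hw'
      have hM' : Mt G X Y M := ⟨fun e he => by
        have := hM.1 e he
        exact ⟨this.1, Finset.mem_of_mem_erase this.2.1, Finset.mem_of_mem_erase this.2.2⟩, hM.2⟩
      refine ⟨_, hM'.cons hw.2.symm hw.1 hv hw' ?_, by simp [hl]⟩
      intro hvM
      obtain ⟨e, he, h'⟩ := exists_of_mem_fl hvM
      have := hM.1 e he
      rcases h' with h' | h'
      · exact Finset.ne_of_mem_erase this.2.1 h'.symm
      · exact Finset.ne_of_mem_erase this.2.2 h'.symm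
    · push Not at hex
      refine match_bdd (d := r + 1) (D := 2 * r + 1) hd (fun v hv => by have := hex v hv; omega) hXY (r + 1) ?_
      have e1 := Nat.mul_le_mul_left (r + 1) hc.le
      have e2 : (r + 1) * (4 * (r + 1) * (r + 1) + 3 * (r + 1)) = 2 * (r + 1) * (2 * r + 1 + (r + 1)) + (4 * (r * r * r) + 9 * (r * r) + 8 * r + 3) := by ring
      rw [e2] at e1
      omega

lemma match_slack {G : SimpleGraph V} {X Y Z : Finset V} {m : ℕ} (hZ : Z ⊆ Y) (hz : ∀ v ∈ Z, 2 * m ≤ dg G v X) (hc : 2 * m ≤ Z.card) :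
    ∀ r, r ≤ m → ∃ M, Mt G X Y M ∧ M.length = r := by
  intro r
  induction r with
  | zero => intro _; exact ⟨[], Mt.nil _ _ _, rfl⟩
  | succ r ih =>
    intro hr
    obtain ⟨M, hM, hl⟩ := ih (by omega)
    have hf := fl_card M
    obtain ⟨v, hv, hv'⟩ := exists_avoid (A := Z) (U := (fl M).toFinset) (by omega)
    obtain ⟨w, hw, hw'⟩ := exists_avoid (A := X.filter (fun w => G.Adj v w)) (U := (fl M).toFinset) (by
      have := hz v hv; unfold dg at this; omega)
    simp only [Finset.mem_filter, List.mem_toFinset] at hw hw' hv'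
    exact ⟨_, hM.cons hw.2.symm hw.1 (hZ hv) hw' hv', by simp [hl]⟩

end
end W

namespace W
section
variable {V : Type} {k : ℕ}

def Qa (A0 B0 : Finset V) (i : ℕ) : Finset V := if i % 2 = 0 then A0 else B0

lemma Qa_even {A0 B0 : Finset V} {i : ℕ} (h : i % 2 = 0) : Qa A0 B0 i = A0 := if_pos h
lemma Qa_odd {A0 B0 : Finset V} {i : ℕ} (h : i % 2 = 1) : Qa A0 B0 i = B0 := if_neg (by omega)
lemma Qa_succ (A0 B0 : Finset V) (i : ℕ) : Qa A0 B0 (i + 1) = Qa B0 A0 i := by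
  rcases Nat.mod_two_eq_zero_or_one i with h | h
  · rw [Qa_odd (by omega), Qa_even h]
  · rw [Qa_even (by omega), Qa_odd h]

lemma alt_sum (f : V → ℤ) : ∀ (l : List V) (ε : ℤ) (A0 B0 : Finset V), (∀ v ∈ A0, f v = ε) → (∀ v ∈ B0, f v = -ε) →
    (∀ i (hi : i < l.length), l[i] ∈ Qa A0 B0 i) → (l.map f).sum = if l.length % 2 = 1 then ε else 0 := by
  intro l
  induction l with
  | nil => intro ε A0 B0 _ _ _; simp
  | cons a l ih =>
    intro ε A0 B0 h1 h2 h3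
    have ha := h3 0 (by simp)
    rw [Qa_even rfl] at ha
    have := ih (-ε) B0 A0 h2 (by simpa using h1) (by
      intro i hi
      have := h3 (i + 1) (by simpa using hi)
      rw [Qa_succ] at this
      simpa using this)
    rw [List.map_cons, List.sum_cons, this, h1 a (by simpa using ha), List.length_cons]
    rcases Nat.mod_two_eq_zero_or_one l.length with h | h
    · rw [if_neg (by omega), if_pos (by omega)]; ring
    · rw [if_pos (by omega), if_neg (by omega)]; ring

lemma Qa_ms {G : SimpleGraph V} {A0 B0 : Finset V} {h : ℕ} (mA : ∀ a ∈ A0, ms G a B0 ≤ h) (mB : ∀ b ∈ B0, ms G b A0 ≤ h) (l : ℕ) :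
    ∀ w ∈ Qa A0 B0 l, ((Qa A0 B0 (l+1)).filter (fun a => ¬ G.Adj w a)).card ≤ h := by
  intro w hw
  rcases Nat.mod_two_eq_zero_or_one l with h' | h'
  · rw [Qa_even h'] at hw; rw [Qa_odd (by omega)]; exact mA w hw
  · rw [Qa_odd h'] at hw; rw [Qa_even (by omega)]; exact mB w hw

lemma Qa_card {A0 B0 : Finset V} {t : ℕ} (hA : t ≤ A0.card) (hB : t ≤ B0.card) (l : ℕ) : t ≤ (Qa A0 B0 l).card := by
  unfold Qa; split_ifs <;> assumption

structure CB (G : SimpleGraph V) (x y : Fin k → V) (A B A0 B0 : Finset V) (h t T : ℕ) : Prop where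
  AB : ∀ v, v ∈ A ↔ v ∉ B
  sA : A0 ⊆ A
  sB : B0 ⊆ B
  mA : ∀ a ∈ A0, ms G a B0 ≤ h
  mB : ∀ a ∈ B0, ms G a A0 ≤ h
  nA : ∀ v ∈ A, t ≤ dg G v B0
  nB : ∀ v ∈ B, t ≤ dg G v A0
  TA : ∀ v ∈ A, v ∉ Ends x y → T ≤ dg G v B0
  TB : ∀ v ∈ B, v ∉ Ends x y → T ≤ dg G v A0
  eA : ∀ v ∈ A0, v ∉ Ends x y
  eB : ∀ v ∈ B0, v ∉ Ends x y
  tA : T ≤ A0.card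
  tB : T ≤ B0.card
  cAA : A.card ≤ A0.card + 4 * h
  cAB : A.card ≤ B0.card + 4 * h
  cBA : B.card ≤ A0.card + 4 * h
  cBB : B.card ≤ B0.card + 4 * h

lemma CB.symm {G : SimpleGraph V} {x y : Fin k → V} {A B A0 B0 : Finset V} {h t T : ℕ} (c : CB G x y A B A0 B0 h t T) :
    CB G x y B A B0 A0 h t T where
  AB := fun v => by have := c.AB v; tauto
  sA := c.sB
  sB := c.sA
  mA := c.mB
  mB := c.mA
  nA := c.nB
  nB := c.nA
  TA := c.TB
  TB := c.TA
  eA := c.eB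
  eB := c.eA
  tA := c.tB
  tB := c.tA
  cAA := c.cBB
  cAB := c.cBA
  cBA := c.cAB
  cBB := c.cAA

/-- connection with correct parity, starting in `A` -/
lemma CB.direct_aux {G : SimpleGraph V} {x y : Fin k → V} {A B A0 B0 U : Finset V} {h t T N : ℕ} (c : CB G x y A B A0 B0 h t T)
    {f : V → ℤ} {ε : ℤ} (fA : ∀ v ∈ A, f v = ε) (fB : ∀ v ∈ B, f v = -ε) {p q : V} (hp : p ∈ A) (hN : 5 ≤ N)
    (hpar : (p ∈ A ↔ q ∈ A) ↔ N % 2 = 1) (hU : U.card + N + h < t) (htT : t ≤ T) :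
    ∃ l, Conn G p q l ∧ l.length + 2 = N ∧ 2 * (l.map f).sum = - f p - f q ∧ ∀ w ∈ l, w ∉ U := by
  have hq : t ≤ ((Qa B0 A0 (N - 2 - 1)).filter (fun a => G.Adj q a)).card ∧
      2 * (if (N - 2) % 2 = 1 then -ε else 0) = - f p - f q := by
    rcases Nat.mod_two_eq_zero_or_one N with h' | h'
    · have hq : q ∈ B := by
        by_contra hq
        have := hpar.1 ⟨fun _ => (c.AB q).2 hq, fun _ => hp⟩
        omega
      rw [Qa_odd (by omega), if_neg (by omega), fA p hp, fB q hq]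
      exact ⟨c.nB q hq, by ring⟩
    · have hq : q ∈ A := (hpar.2 h').1 hp
      rw [Qa_even (by omega), if_pos (by omega), fA p hp, fA q hq]
      exact ⟨c.nA q hq, by ring⟩
  obtain ⟨l, h1, h2, h3, h4⟩ := alt2 G h t (N - 2) (Qa B0 A0) p q U (by omega) (Qa_ms c.mB c.mA)
    (by rw [Qa_even rfl]; exact c.nA p hp) hq.1 (Qa_card (htT.trans c.tB) (htT.trans c.tA)) (by omega)
  refine ⟨l, h1, by omega, ?_, h3⟩
  rw [alt_sum f l (-ε) B0 A0 (fun v hv => fB v (c.sB hv)) (fun v hv => by rw [fA v (c.sA hv)]; ring) h4, h2]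
  exact hq.2

lemma CB.direct {G : SimpleGraph V} {x y : Fin k → V} {A B A0 B0 U : Finset V} {h t T N : ℕ} (c : CB G x y A B A0 B0 h t T)
    {f : V → ℤ} {ε : ℤ} (fA : ∀ v ∈ A, f v = ε) (fB : ∀ v ∈ B, f v = -ε) {p q : V} (hN : 5 ≤ N)
    (hpar : (p ∈ A ↔ q ∈ A) ↔ N % 2 = 1) (hU : U.card + N + h < t) (htT : t ≤ T) :
    ∃ l, Conn G p q l ∧ l.length + 2 = N ∧ 2 * (l.map f).sum = - f p - f q ∧ ∀ w ∈ l, w ∉ U := by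
  by_cases hp : p ∈ A
  · exact c.direct_aux fA fB hp hN hpar hU htT
  · have hp' : p ∈ B := by by_contra h'; exact hp ((c.AB p).2 h')
    refine c.symm.direct_aux (ε := -ε) fB (by simpa using fA) hp' hN ?_ hU htT
    rw [← hpar, c.AB, c.AB, not_iff_not]

/-- connection with wrong parity, using an edge inside `A` -/
lemma CB.gadget_aux {G : SimpleGraph V} {x y : Fin k → V} {A B A0 B0 U : Finset V} {h t T N : ℕ} (c : CB G x y A B A0 B0 h t T)
    {f : V → ℤ} {ε : ℤ} (fA : ∀ v ∈ A, f v = ε) (fB : ∀ v ∈ B, f v = -ε) {p q a a' : V} (hN : 5 ≤ N)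
    (hpar : ¬ ((p ∈ A ↔ q ∈ A) ↔ N % 2 = 1)) (hpq : p ∈ A → q ∈ A) (ha : a ∈ A0) (ha' : a' ∈ A) (haE : a' ∉ Ends x y) (haa : G.Adj a a')
    (haU : a ∈ U) (haU' : a' ∈ U)
    (hpA : p ∈ A → ms G p B0 ≤ 2 * t) (hqA : q ∈ A → ms G q B0 ≤ 2 * t) (hqB : q ∈ B → ms G q A0 ≤ 2 * t) (hpa : p ∈ B → G.Adj p a)
    (hU : U.card + N + 2 * t + h + 1 < T) (hht : h ≤ t) :
    ∃ l, Conn G p q l ∧ l.length + 2 = N ∧ 2 * (l.map f).sum = 2 * ε - f p - f q ∧ ∀ w ∈ l, w ∈ ({a, a'} : Finset V) ∨ w ∉ U := by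
  have hAB : ∀ v, v ∉ A → v ∈ B := fun v hv => by by_contra h'; exact hv ((c.AB v).2 h')
  have hBA : ∀ v, v ∈ B → v ∉ A := fun v hv h' => (c.AB v).1 h' hv
  have ha'T := c.TA a' ha' haE
  have haA := c.sA ha
  have mA' : ∀ a ∈ A0, ms G a B0 ≤ 2 * t := fun a h' => (c.mA a h').trans (by omega)
  have mB' : ∀ a ∈ B0, ms G a A0 ≤ 2 * t := fun a h' => (c.mB a h').trans (by omega)
  by_cases hp : p ∈ A
  · have hq := hpq hp
    have hNe : N % 2 = 0 := by
      rcases Nat.mod_two_eq_zero_or_one N with h' | h'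
      · exact h'
      · exact (hpar ⟨fun _ => h', fun _ => ⟨fun _ => hq, fun _ => hp⟩⟩).elim
    obtain ⟨b, hb, hb'⟩ := exists_avoid (A := B0) (U := B0.filter (fun z => ¬ G.Adj p z) ∪ (B0.filter (fun z => ¬ G.Adj a z) ∪ U)) (by
      have h1 := Finset.card_union_le (B0.filter (fun z => ¬ G.Adj p z)) (B0.filter (fun z => ¬ G.Adj a z) ∪ U)
      have h2 := Finset.card_union_le (B0.filter (fun z => ¬ G.Adj a z)) U
      have h3 := hpA hp
      have h4 := c.mA a ha
      have h5 := c.tB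
      unfold ms at h3 h4; omega)
    simp only [Finset.mem_filter, Finset.mem_union, not_or, not_and, not_not] at hb'
    have hpb := hb'.1 hb
    have hab := hb'.2.1 hb
    have hbU := hb'.2.2
    obtain ⟨r, h1, h2, h3, h4⟩ := alt1 G (2 * t) T (N - 5) (Qa B0 A0) q a' (insert b U) (by omega) (Qa_ms mB' mA')
      (by rw [Qa_even rfl]; exact hqA hq) (by rw [Qa_even (by omega)]; exact ha'T) (Qa_card c.tB c.tA) (by
        have := Finset.card_insert_le b U; omega)
    have hsum := alt_sum f r (-ε) B0 A0 (fun v hv => fB v (c.sB hv)) (fun v hv => by rw [fA v (c.sA hv)]; ring) h4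
    rw [h2, if_pos (by omega)] at hsum
    simp only [Finset.mem_insert, not_or] at h3
    have e1 : a' ∉ r.reverse := by simp only [List.mem_reverse]; exact fun h => (h3 _ h).2 haU'
    have e2 : a ∉ a' :: r.reverse := by
      simp only [List.mem_cons, List.mem_reverse, not_or]; exact ⟨haa.ne, fun h => (h3 _ h).2 haU⟩
    have e3 : b ∉ a :: a' :: r.reverse := by
      simp only [List.mem_cons, List.mem_reverse, not_or]
      exact ⟨fun h => hbU (h ▸ haU), fun h => hbU (h ▸ haU'), fun h => (h3 _ h).1 rfl⟩
    refine ⟨b :: a :: a' :: r.reverse, ((h1.symm.cons haa e1).cons hab.symm e2).cons hpb e3, by simp [h2]; omega, ?_, ?_⟩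
    · simp only [List.map_cons, List.sum_cons, List.map_reverse, List.sum_reverse]
      rw [hsum, fA p hp, fA q hq, fA a haA, fA a' ha', fB b (c.sB hb)]; ring
    · intro w hw
      simp only [List.mem_cons, List.mem_reverse] at hw
      rcases hw with rfl | rfl | rfl | hw
      · right; exact hbU
      · left; simp
      · left; simp
      · right; exact (h3 w hw).2
  · have hp' := hAB p hp
    have hr : ∃ r, Conn G q a' r ∧ r.length = N - 4 ∧ (∀ w ∈ r, w ∉ U) ∧ 2 * (r.map f).sum = -ε - f q := by
      by_cases hq : q ∈ A
      · have hNo : N % 2 = 1 := by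
          by_contra h'
          exact hpar ⟨fun e => (hp (e.2 hq)).elim, fun e => (h' e).elim⟩
        obtain ⟨r, h1, h2, h3, h4⟩ := alt1 G (2 * t) T (N - 4) (Qa B0 A0) q a' U (by omega) (Qa_ms mB' mA')
          (by rw [Qa_even rfl]; exact hqA hq) (by rw [Qa_even (by omega)]; exact ha'T) (Qa_card c.tB c.tA) (by omega)
        refine ⟨r, h1, h2, h3, ?_⟩
        rw [alt_sum f r (-ε) B0 A0 (fun v hv => fB v (c.sB hv)) (fun v hv => by rw [fA v (c.sA hv)]; ring) h4,
          h2, if_pos (by omega), fA q hq]; ring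
      · have hNe : N % 2 = 0 := by
          rcases Nat.mod_two_eq_zero_or_one N with h' | h'
          · exact h'
          · exact (hpar ⟨fun _ => h', fun _ => ⟨fun e => (hp e).elim, fun e => (hq e).elim⟩⟩).elim
        have hq' := hAB q hq
        obtain ⟨r, h1, h2, h3, h4⟩ := alt1 G (2 * t) T (N - 4) (Qa A0 B0) q a' U (by omega) (Qa_ms mA' mB')
          (by rw [Qa_even rfl]; exact hqB hq') (by rw [Qa_odd (by omega)]; exact ha'T) (Qa_card c.tA c.tB) (by omega)
        refine ⟨r, h1, h2, h3, ?_⟩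
        rw [alt_sum f r ε A0 B0 (fun v hv => fA v (c.sA hv)) (fun v hv => fB v (c.sB hv)) h4,
          h2, if_neg (by omega), fB q hq']; ring
    obtain ⟨r, h1, h2, h3, hsum⟩ := hr
    have e1 : a' ∉ r.reverse := by simp only [List.mem_reverse]; exact fun h => (h3 _ h) haU'
    have e2 : a ∉ a' :: r.reverse := by
      simp only [List.mem_cons, List.mem_reverse, not_or]; exact ⟨haa.ne, fun h => (h3 _ h) haU⟩
    refine ⟨a :: a' :: r.reverse, (h1.symm.cons haa e1).cons (hpa hp') e2, by simp [h2]; omega, ?_, ?_⟩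
    · simp only [List.map_cons, List.sum_cons, List.map_reverse, List.sum_reverse]
      rw [fB p hp', fA a haA, fA a' ha']; linarith
    · intro w hw
      simp only [List.mem_cons, List.mem_reverse] at hw
      rcases hw with rfl | rfl | hw
      · left; simp
      · left; simp
      · right; exact h3 w hw

lemma CB.gadget {G : SimpleGraph V} {x y : Fin k → V} {A B A0 B0 U : Finset V} {h t T N : ℕ} (c : CB G x y A B A0 B0 h t T)
    {f : V → ℤ} {ε : ℤ} (fA : ∀ v ∈ A, f v = ε) (fB : ∀ v ∈ B, f v = -ε) {p q a a' : V} (hN : 5 ≤ N)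
    (hpar : ¬ ((p ∈ A ↔ q ∈ A) ↔ N % 2 = 1)) (ha : a ∈ A0) (ha' : a' ∈ A) (haE : a' ∉ Ends x y) (haa : G.Adj a a')
    (haU : a ∈ U) (haU' : a' ∈ U)
    (hpA : p ∈ A → ms G p B0 ≤ 2 * t) (hqA : q ∈ A → ms G q B0 ≤ 2 * t)
    (hpB : p ∈ B → ms G p A0 ≤ 2 * t) (hqB : q ∈ B → ms G q A0 ≤ 2 * t) (hpa : p ∈ B → G.Adj p a) (hqa : q ∈ B → G.Adj q a)
    (hU : U.card + N + 2 * t + h + 1 < T) (hht : h ≤ t) :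
    ∃ l, Conn G p q l ∧ l.length + 2 = N ∧ 2 * (l.map f).sum = 2 * ε - f p - f q ∧ ∀ w ∈ l, w ∈ ({a, a'} : Finset V) ∨ w ∉ U := by
  by_cases hpq : p ∈ A → q ∈ A
  · exact c.gadget_aux fA fB hN hpar hpq ha ha' haE haa haU haU' hpA hqA hqB hpa hU hht
  · push Not at hpq
    obtain ⟨l, h1, h2, h3, h4⟩ := c.gadget_aux (p := q) (q := p) fA fB hN (by rwa [iff_comm (a := q ∈ A)]) (fun _ => hpq.1) ha ha' haE haa haU haU' hqA hpA hpB hqa hU hht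
    exact ⟨l.reverse, h1.symm, by simpa using h2, by rw [List.map_reverse, List.sum_reverse, h3]; ring, fun w hw => h4 w (by simpa using hw)⟩

end
end W

namespace W
section
variable {V : Type} {k : ℕ}

lemma sc_sum {G : SimpleGraph V} {x y : Fin k → V} {N : Fin k → ℕ} {o : Fin k} {l : Fin k → List V}
    (hI : Inj x y) (h : SC G x y N o l) (f : V → ℤ) :
    ∑ v ∈ used x y o l, f v = ∑ i ∈ Finset.univ.erase o, (f (x i) + f (y i) + ((l i).map f).sum) := by
  rw [used, Finset.sum_biUnion]
  · apply Finset.sum_congr rfl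
    intro i hi
    have hi' : i ≠ o := (Finset.mem_erase.1 hi).1
    obtain ⟨h1, h2, h3⟩ := h.1 i hi'
    rw [Finset.sum_insert, Finset.sum_insert, List.sum_toFinset _ h1.1]
    · ring
    · intro hm; exact (h3 _ (List.mem_toFinset.1 hm) i).2 rfl
    · intro hm
      rcases Finset.mem_insert.1 hm with hm | hm
      · exact hI.2.2 i i hm
      · exact (h3 _ (List.mem_toFinset.1 hm) i).1 rfl
  · intro i hi j hj hij
    have hi' : i ≠ o := by simpa using hi
    have hj' : j ≠ o := by simpa using hj
    rw [Function.onFun, Finset.disjoint_left]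
    intro w hw hw'
    simp only [Finset.mem_insert, List.mem_toFinset] at hw hw'
    have hi3 := (h.1 i hi').2.2
    have hj3 := (h.1 j hj').2.2
    rcases hw with rfl | rfl | hw <;> rcases hw' with hw' | hw' | hw'
    · exact hij (hI.1 _ _ hw')
    · exact hI.2.2 _ _ hw'
    · exact (hj3 _ hw' i).1 rfl
    · exact hI.2.2 _ _ hw'.symm
    · exact hij (hI.2.1 _ _ hw')
    · exact (hj3 _ hw' i).2 rfl
    · exact (hi3 _ hw j).1 hw'
    · exact (hi3 _ hw j).2 hw'
    · exact h.2 i j hi' hj' hij w hw hw'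

noncomputable def sg (A : Finset V) (v : V) : ℤ := if v ∈ A then 1 else -1

lemma sg_pos {A : Finset V} {v : V} (h : v ∈ A) : sg A v = 1 := if_pos h
lemma sg_neg {A : Finset V} {v : V} (h : v ∉ A) : sg A v = -1 := if_neg h

lemma sg_sum [Fintype V] {A B : Finset V} (hAB : ∀ v, v ∈ A ↔ v ∉ B) (U : Finset V) :
    ∑ v ∈ Finset.univ \ U, sg A v = ((A \ U).card : ℤ) - (B \ U).card := by
  have e : Finset.univ \ U = (A \ U) ∪ (B \ U) := by
    ext v; have := hAB v; simp only [Finset.mem_sdiff, Finset.mem_union, Finset.mem_univ, true_and]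
    by_cases hB : v ∈ B <;> simp [this, hB]
  have hd : Disjoint (A \ U) (B \ U) := by
    rw [Finset.disjoint_left]; intro v h1 h2
    exact (hAB v).1 (Finset.mem_sdiff.1 h1).1 (Finset.mem_sdiff.1 h2).1
  rw [e, Finset.sum_union hd, Finset.sum_congr rfl (g := fun _ => (1 : ℤ)) (fun v hv => sg_pos (Finset.mem_sdiff.1 hv).1),
    Finset.sum_congr rfl (s₁ := B \ U) (g := fun _ => (-1 : ℤ)) (fun v hv => sg_neg (fun h => (hAB v).1 h (Finset.mem_sdiff.1 hv).1))]
  simp; ring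

lemma CB.ham [Fintype V] {G : SimpleGraph V} {x y : Fin k → V} {A B A0 B0 U : Finset V} {h t T : ℕ} (c : CB G x y A B A0 B0 h t T)
    {p q : V} (hp : p ∈ A) (hq : q ∈ B) (hpU : p ∉ U) (hqU : q ∉ U) {M : List (V × V)} (hM : ∀ e ∈ M, G.Adj e.1 e.2)
    (hnd : (fl M).Nodup) (hfl : ∀ a ∈ fl M, a ∈ A ∧ a ∉ U ∧ a ≠ p) (hc : (A \ U).card = (B \ U).card + M.length)
    (hU : 5 * h + 2 + 2 * U.card ≤ t) : HP G (Finset.univ \ U) p q := by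
  have hd : Disjoint (A \ U) (B \ U) := by
    rw [Finset.disjoint_left]; intro v h1 h2
    exact (c.AB v).1 (Finset.mem_sdiff.1 h1).1 (Finset.mem_sdiff.1 h2).1
  have e : Finset.univ \ U = (A \ U) ∪ (B \ U) := by
    ext v; have := c.AB v; simp only [Finset.mem_sdiff, Finset.mem_union, Finset.mem_univ, true_and]
    by_cases hB : v ∈ B <;> simp [this, hB]
  rw [e]
  have i1 := Finset.card_le_card (Finset.sdiff_subset (s := A) (t := U))
  have i2 := Finset.le_card_sdiff U A0
  have i3 := Finset.le_card_sdiff U B0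
  have := c.cAA
  have := c.cAB
  refine ham_bip (P0 := A0 \ U) (Q0 := B0 \ U) (M := M) (h := h) (τ := t - U.card) hd (Finset.sdiff_subset_sdiff c.sA (Finset.Subset.refl _))
    (Finset.sdiff_subset_sdiff c.sB (Finset.Subset.refl _)) ?_ ?_ ?_ ?_ hM hnd ?_ hc (by simp [hp, hpU]) (by simp [hq, hqU]) (by omega) (by omega)
  · intro v hv
    have h1 := c.nA v (Finset.mem_sdiff.1 hv).1
    have h2 := dg_sdiff_le G v B0 U
    unfold dg at h1 h2; omega
  · intro v hv
    have h1 := c.nB v (Finset.mem_sdiff.1 hv).1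
    have h2 := dg_sdiff_le G v A0 U
    unfold dg at h1 h2; omega
  · intro v hv
    exact (ms_mono G v Finset.sdiff_subset).trans (c.mA v (Finset.mem_sdiff.1 hv).1)
  · intro v hv
    exact (ms_mono G v Finset.sdiff_subset).trans (c.mB v (Finset.mem_sdiff.1 hv).1)
  · intro a ha
    have := hfl a ha
    exact ⟨Finset.mem_sdiff.2 ⟨this.1, this.2.1⟩, this.2.2⟩

lemma card_sdiff_insert {A U : Finset V} {y : V} (hy : y ∈ A) (hyU : y ∉ U) : (A \ insert y U).card + 1 = (A \ U).card := by
  rw [Finset.sdiff_insert, Finset.card_erase_add_one (by simp [hy, hyU])]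

lemma card_sdiff_insert' {A U : Finset V} {y : V} (hy : y ∉ A) : (A \ insert y U).card = (A \ U).card := by
  rw [Finset.sdiff_insert, Finset.erase_eq_of_notMem (by simp [hy])]

lemma CB.big [Fintype V] {G : SimpleGraph V} {x y : Fin k → V} {A B A0 B0 U : Finset V} {h t T : ℕ} (c : CB G x y A B A0 B0 h t T)
    {p q : V} (hp : p ∈ Ends x y) (hq : q ∈ Ends x y) (hpq : p ≠ q) (hpU : p ∉ U) (hqU : q ∉ U) {M : List (V × V)} (hM : ∀ e ∈ M, G.Adj e.1 e.2)
    (hnd : (fl M).Nodup) (hfl : ∀ a ∈ fl M, a ∈ A ∧ a ∉ U ∧ a ∉ Ends x y)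
    (hc : 2 * ∑ v ∈ Finset.univ \ U, sg A v = sg A p + sg A q + 2 * M.length)
    (hU : 5 * h + 6 + 2 * U.card + 2 * M.length ≤ t) : HP G (Finset.univ \ U) p q := by
  have hAB : ∀ v, v ∉ A → v ∈ B := fun v hv => by by_contra h'; exact hv ((c.AB v).2 h')
  have hBA : ∀ v, v ∈ B → v ∉ A := fun v hv h' => (c.AB v).1 h' hv
  have hflp : ∀ {z}, z ∈ Ends x y → ∀ a ∈ fl M, a ∈ A ∧ a ∉ U ∧ a ≠ z := fun hz a ha =>
    ⟨(hfl a ha).1, (hfl a ha).2.1, fun e => (hfl a ha).2.2 (e ▸ hz)⟩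
  rw [sg_sum c.AB] at hc
  have hins : insert p (Finset.univ \ insert p U) = Finset.univ \ U := by
    ext z
    simp only [Finset.mem_insert, Finset.mem_sdiff, Finset.mem_univ, true_and, not_or]
    by_cases e : z = p
    · simp [e, hpU]
    · simp [e]
  have hUi := Finset.card_insert_le p U
  by_cases hpA : p ∈ A <;> by_cases hqA : q ∈ A
  · rw [sg_pos hpA, sg_pos hqA] at hc
    obtain ⟨b, hb, hb'⟩ := exists_avoid (A := B0.filter (fun z => G.Adj p z)) (U := U) (by
      have := c.nA p hpA; unfold dg at this; omega)
    rw [Finset.mem_filter] at hb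
    have hbB := c.sB hb.1
    have i1 := card_sdiff_insert hpA hpU
    have i2 := card_sdiff_insert' (A := B) (U := U) ((c.AB p).1 hpA)
    have hbp : b ≠ p := fun e => hBA b hbB (e ▸ hpA)
    have := c.ham (U := insert p U) hqA hbB (by simp [hqU, hpq.symm]) (by simp [hb', hbp]) hM hnd (by
      intro a ha
      have e1 := hflp hp a ha
      have e2 := hflp hq a ha
      exact ⟨e1.1, by simp [e1.2.1, e1.2.2], e2.2.2⟩) (by omega) (by omega)
    rw [← hins]
    exact this.symm.cons hb.2 (by simp)
  · have hqB := hAB q hqA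
    rw [sg_pos hpA, sg_neg hqA] at hc
    exact c.ham hpA hqB hpU hqU hM hnd (hflp hp) (by omega) (by omega)
  · have hpB := hAB p hpA
    rw [sg_neg hpA, sg_pos hqA] at hc
    exact (c.ham hqA hpB hqU hpU hM hnd (hflp hq) (by omega) (by omega)).symm
  · rw [sg_neg hpA, sg_neg hqA] at hc
    have hpB := hAB p hpA
    have hqB := hAB q hqA
    obtain ⟨a, ha, ha'⟩ := exists_avoid (A := A0.filter (fun z => G.Adj p z)) (U := U ∪ (fl M).toFinset) (by
      have := c.nB p hpB
      have h2 := Finset.card_union_le U (fl M).toFinset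
      have h3 := fl_card M
      unfold dg at this; omega)
    simp only [Finset.mem_filter, Finset.mem_union, List.mem_toFinset, not_or] at ha ha'
    have haA := c.sA ha.1
    have i1 := card_sdiff_insert hpB hpU
    have i2 := card_sdiff_insert' (A := A) (U := U) hpA
    have hap : a ≠ p := fun e => hpA (e ▸ haA)
    have := c.ham (U := insert p U) haA hqB (by simp [ha'.1, hap]) (by simp [hqU, hpq.symm]) hM hnd (by
      intro z hz
      have e1 := hflp hp z hz
      exact ⟨e1.1, by simp [e1.2.1, e1.2.2], fun e => ha'.2 (e ▸ hz)⟩) (by omega) (by omega)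
    rw [← hins]
    exact this.cons ha.2 (by simp)

end
end W

namespace W
section
variable {V : Type} {k : ℕ}

/-- gadget edge for pair `i` inside `A`. -/
def Gad (G : SimpleGraph V) (x y : Fin k → V) (A B A0 : Finset V) (i : Fin k) (e : V × V) : Prop :=
  G.Adj e.1 e.2 ∧ e.1 ∈ A0 ∧ e.2 ∈ A ∧ e.2 ∉ Ends x y ∧ (x i ∈ B → G.Adj (x i) e.1) ∧ (y i ∈ B → G.Adj (y i) e.1)

/-- both ends of pair `i` are rigid. -/
def Rig (G : SimpleGraph V) (x y : Fin k → V) (A B A0 B0 : Finset V) (t : ℕ) (i : Fin k) : Prop :=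
  (x i ∈ A → ms G (x i) B0 ≤ 2 * t) ∧ (y i ∈ A → ms G (y i) B0 ≤ 2 * t) ∧
  (x i ∈ B → ms G (x i) A0 ≤ 2 * t) ∧ (y i ∈ B → ms G (y i) A0 ≤ 2 * t)

lemma CB.core [Fintype V] {G : SimpleGraph V} {x y : Fin k → V} {N : Fin k → ℕ} {o : Fin k} {s : ℕ}
    (hS : Setup G x y N o s) {A B A0 B0 : Finset V} {h t T : ℕ} (c : CB G x y A B A0 B0 h t T)
    (γ : Fin k → ℤ) (e : Fin k → V × V) (M : List (V × V))
    (hγ : ∀ i, γ i = 0 ∨ γ i = 1 ∨ γ i = -1)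
    (h1 : ∀ i, i ≠ o → γ i = 0 → ((y i ∈ A ↔ x i ∈ A) ↔ N i % 2 = 1))
    (h2 : ∀ i, i ≠ o → γ i ≠ 0 → ¬ ((y i ∈ A ↔ x i ∈ A) ↔ N i % 2 = 1) ∧ Rig G x y A B A0 B0 t i)
    (hA : ∀ i, i ≠ o → γ i = 1 → Gad G x y A B A0 i (e i))
    (hB : ∀ i, i ≠ o → γ i = -1 → Gad G x y B A B0 i (e i))
    (hd : ∀ i j, i ≠ o → j ≠ o → i ≠ j → γ i ≠ 0 → γ j ≠ 0 →
      Disjoint ({(e i).1, (e i).2} : Finset V) {(e j).1, (e j).2})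
    (hdM : ∀ i, i ≠ o → γ i ≠ 0 → (e i).1 ∉ fl M ∧ (e i).2 ∉ fl M)
    (hM : ∀ e ∈ M, G.Adj e.1 e.2) (hnd : (fl M).Nodup) (hfl : ∀ a ∈ fl M, a ∈ A ∧ a ∉ Ends x y)
    (hc : 2 * ((A.card : ℤ) - B.card) = ∑ i, (sg A (x i) + sg A (y i)) + ∑ i ∈ Finset.univ.erase o, 2 * γ i + 2 * M.length)
    (ht : 6 * h + 4 * M.length + 2 * k + 5 * s + 7 ≤ t) (hT : 4 * t ≤ T) : Concl G x y N := by
  have fA : ∀ v ∈ A, sg A v = 1 := fun v hv => sg_pos hv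
  have fB : ∀ v ∈ B, sg A v = -1 := fun v hv => sg_neg (fun h' => (c.AB v).1 h' hv)
  have hflc := fl_card M
  obtain ⟨l, hSC, hl⟩ := sc_gadget2 (G := G) (x := x) (y := y) (N := N) (o := o) (s := s) (B := 2 * M.length + 2 * k + 2 * s)
    (fun i => if γ i = 0 then ∅ else {(e i).1, (e i).2}) (fl M).toFinset
    (fun i l => 2 * (l.map (sg A)).sum = 2 * γ i - sg A (x i) - sg A (y i)) hS.small
    (by
      intro i hi w hw
      by_cases h0 : γ i = 0
      · simp [h0] at hw
      · simp only [h0, if_false, Finset.mem_insert, Finset.mem_singleton] at hw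
        rcases hγ i with h' | h' | h'
        · exact absurd h' h0
        · have := hA i hi h'
          rcases hw with rfl | rfl
          · exact c.eA _ this.2.1
          · exact this.2.2.2.1
        · have := hB i hi h'
          rcases hw with rfl | rfl
          · exact c.eB _ this.2.1
          · exact this.2.2.2.1)
    (by
      intro i j hi hj hij
      by_cases h0 : γ i = 0
      · simp [h0]
      by_cases h0' : γ j = 0
      · simp [h0']
      simp only [h0, h0', if_false]
      exact hd i j hi hj hij h0 h0')
    (by
      intro i hi
      have := hS.five i
      have h3 := Finset.card_le_two (a := (e i).1) (b := (e i).2)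
      split_ifs
      · simp
      · omega)
    (by omega)
    (by
      intro i hi U hU hU0 hg hE
      have h5 := hS.five i
      have hNs := hS.Nle hi
      rcases hγ i with h' | h' | h'
      · obtain ⟨l, a1, a2, a3, a4⟩ := c.direct fA fB (U := U) h5 (h1 i hi h') (by omega) (by omega)
        exact ⟨l, a1, a2, by rw [a3, h']; ring, fun w hw => Or.inr (a4 w hw)⟩
      · have h0 : γ i ≠ 0 := by omega
        obtain ⟨g1, g2, g3, g4, g5, g6⟩ := hA i hi h'
        obtain ⟨hp, r1, r2, r3, r4⟩ := h2 i hi h0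
        simp only [h0, if_false] at hg ⊢
        obtain ⟨l, a1, a2, a3, a4⟩ := c.gadget fA fB (U := U) h5 hp g2 g3 g4 g1 (hg (by simp)) (hg (by simp))
          r2 r1 r4 r3 g6 g5 (by omega) (by omega)
        exact ⟨l, a1, a2, by rw [a3, h']; ring, a4⟩
      · have h0 : γ i ≠ 0 := by omega
        obtain ⟨g1, g2, g3, g4, g5, g6⟩ := hB i hi h'
        obtain ⟨hp, r1, r2, r3, r4⟩ := h2 i hi h0
        simp only [h0, if_false] at hg ⊢
        have hx := c.AB (x i)
        have hy := c.AB (y i)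
        obtain ⟨l, a1, a2, a3, a4⟩ := c.symm.gadget (f := sg A) (ε := -1) fB (by simpa using fA) (U := U) h5 (p := y i) (q := x i)
          (by rw [hx, hy] at hp; rwa [not_iff_not] at hp) g2 g3 g4 g1 (hg (by simp)) (hg (by simp))
          r4 r3 r2 r1 g6 g5 (by omega) (by omega)
        exact ⟨l, a1, a2, by rw [a3, h']; ring, a4⟩)
  have hoU := hS.o_not_used hSC
  have hsum := sc_sum hS.inj hSC (sg A)
  have hcard := sc_card hS.inj hSC
  have hsm := hS.small
  have tot := sg_sum c.AB ∅
  have split : ∑ v ∈ Finset.univ \ used x y o l, sg A v + ∑ v ∈ used x y o l, sg A v = ∑ v, sg A v :=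
    Finset.sum_sdiff (Finset.subset_univ _)
  simp only [Finset.sdiff_empty] at tot
  have h2s : 2 * ∑ v ∈ used x y o l, sg A v =
      ∑ i ∈ Finset.univ.erase o, (sg A (x i) + sg A (y i)) + ∑ i ∈ Finset.univ.erase o, 2 * γ i := by
    rw [hsum, Finset.mul_sum, ← Finset.sum_add_distrib]
    refine Finset.sum_congr rfl fun i hi => ?_
    have := (hl i (Finset.ne_of_mem_erase hi)).1
    linarith
  have h3s := Finset.add_sum_erase Finset.univ (fun i => sg A (x i) + sg A (y i)) (Finset.mem_univ o)
  refine finish hS.adj hS.inj hS.sum hSC (c.big (M := M) ?_ ?_ ?_ hoU.1 hoU.2 hM hnd ?_ ?_ ?_)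
  · rw [mem_Ends]; exact ⟨o, Or.inr rfl⟩
  · rw [mem_Ends]; exact ⟨o, Or.inl rfl⟩
  · exact fun h' => hS.inj.2.2 o o h'.symm
  · intro a ha
    obtain ⟨b1, b2⟩ := hfl a ha
    refine ⟨b1, fun hu => ?_, b2⟩
    rw [mem_used] at hu
    obtain ⟨i, hi, hu⟩ := hu
    rw [mem_Ends] at b2
    rcases hu with hu | hu | hu
    · exact b2 ⟨i, Or.inl hu⟩
    · exact b2 ⟨i, Or.inr hu⟩
    · rcases (hl i hi).2 a hu with h' | h'
      · by_cases h0 : γ i = 0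
        · simp [h0] at h'
        · simp only [h0, if_false, Finset.mem_insert, Finset.mem_singleton] at h'
          rcases h' with rfl | rfl
          · exact (hdM i hi h0).1 ha
          · exact (hdM i hi h0).2 ha
      · exact h' (List.mem_toFinset.2 ha)
  · linarith
  · omega

end
end W

namespace W
section
variable {V : Type} {k : ℕ}

lemma assign (e0 : V × V) (S : Finset (Fin k)) : ∀ M : List (V × V), (fl M).Nodup → S.card ≤ M.length →
    ∃ (e : Fin k → V × V) (M' : List (V × V)), M'.length + S.card = M.length ∧ (∀ i ∈ S, e i ∈ M) ∧
      (∀ m ∈ M', m ∈ M) ∧ (fl M').Nodup ∧ (∀ i ∈ S, (e i).1 ∉ fl M' ∧ (e i).2 ∉ fl M') ∧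
      ∀ i ∈ S, ∀ j ∈ S, i ≠ j → Disjoint ({(e i).1, (e i).2} : Finset V) {(e j).1, (e j).2} := by
  induction S using Finset.induction_on with
  | empty => intro M hM _; exact ⟨fun _ => e0, M, by simp, by simp, by simp, hM, by simp, by simp⟩
  | insert a S ha ih =>
    intro M hM hl
    rw [Finset.card_insert_of_notMem ha] at hl ⊢
    match M, hM, hl with
    | [], _, hl => simp at hl
    | m :: M1, hM, hl =>
      rw [fl_cons] at hM
      have hM1 : (fl M1).Nodup := by
        simp only [List.nodup_cons] at hM; exact hM.2.2
      have hm1 : m.1 ∉ fl M1 := by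
        simp only [List.nodup_cons, List.mem_cons, not_or] at hM; exact hM.1.2
      have hm2 : m.2 ∉ fl M1 := by
        simp only [List.nodup_cons, List.mem_cons, not_or] at hM; exact hM.2.1
      obtain ⟨e, M', b1, b2, b3, b4, b5, b6⟩ := ih M1 hM1 (by simp at hl; omega)
      have hsub : ∀ z, z ∈ fl M' → z ∈ fl M1 := by
        intro z hz
        obtain ⟨q, hq, hz⟩ := exists_of_mem_fl hz
        have := mem_fl_of (b3 q hq)
        rcases hz with rfl | rfl
        exacts [this.1, this.2]
      have hne : ∀ i ∈ S, i ≠ a := fun i hi h' => ha (h' ▸ hi)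
      have hdj : ∀ i ∈ S, Disjoint ({m.1, m.2} : Finset V) {(e i).1, (e i).2} := by
        intro i hi
        have := mem_fl_of (b2 i hi)
        rw [Finset.disjoint_left]
        intro z hz hz'
        simp only [Finset.mem_insert, Finset.mem_singleton] at hz hz'
        have h1 : z ∈ fl M1 := by rcases hz' with rfl | rfl; exacts [this.1, this.2]
        rcases hz with rfl | rfl
        exacts [hm1 h1, hm2 h1]
      refine ⟨Function.update e a m, M', by simp; omega, ?_, fun q hq => List.mem_cons_of_mem _ (b3 q hq), b4, ?_, ?_⟩
      · intro i hi
        rcases Finset.mem_insert.1 hi with rfl | hi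
        · simp
        · rw [Function.update_of_ne (hne i hi)]; exact List.mem_cons_of_mem _ (b2 i hi)
      · intro i hi
        rcases Finset.mem_insert.1 hi with rfl | hi
        · simp only [Function.update_self]; exact ⟨fun h' => hm1 (hsub _ h'), fun h' => hm2 (hsub _ h')⟩
        · rw [Function.update_of_ne (hne i hi)]; exact b5 i hi
      · intro i hi j hj hij
        rcases Finset.mem_insert.1 hi with rfl | hi' <;> rcases Finset.mem_insert.1 hj with rfl | hj'
        · exact absurd rfl hij
        · rw [Function.update_self, Function.update_of_ne (hne j hj')]; exact hdj j hj'
        · rw [Function.update_self, Function.update_of_ne (hne i hi')]; exact (hdj i hi').symm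
        · rw [Function.update_of_ne (hne i hi'), Function.update_of_ne (hne j hj')]; exact b6 i hi' j hj' hij

def Wr (x y : Fin k → V) (N : Fin k → ℕ) (A : Finset V) (i : Fin k) : Prop :=
  ¬ ((y i ∈ A ↔ x i ∈ A) ↔ N i % 2 = 1)

lemma CB.wrap1 [Fintype V] {G : SimpleGraph V} {x y : Fin k → V} {N : Fin k → ℕ} {o : Fin k} {s : ℕ}
    (hS : Setup G x y N o s) {A B A0 B0 : Finset V} {h t T : ℕ} (c : CB G x y A B A0 B0 h t T)
    {XA XB : Finset V} {MA MB : List (V × V)}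
    (hMA : Mt G XA (A \ Ends x y) MA) (hMB : Mt G XB (B \ Ends x y) MB)
    (sXA : XA ⊆ A0) (sXB : XB ⊆ B0)
    (aXA : ∀ a ∈ XA, ∀ i, i ≠ o → Wr x y N A i → (x i ∈ B → G.Adj (x i) a) ∧ (y i ∈ B → G.Adj (y i) a))
    (aXB : ∀ a ∈ XB, ∀ i, i ≠ o → Wr x y N A i → (x i ∈ A → G.Adj (x i) a) ∧ (y i ∈ A → G.Adj (y i) a))
    (hrig : ∀ i, i ≠ o → Wr x y N A i → Rig G x y A B A0 B0 t i)
    (hW1 : MB.length ≤ ((Finset.univ.erase o).filter (fun i => Wr x y N A i)).card)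
    (hW2 : ((Finset.univ.erase o).filter (fun i => Wr x y N A i)).card ≤ MA.length + MB.length)
    (hc : 2 * ((A.card : ℤ) - B.card) = ∑ i, (sg A (x i) + sg A (y i)) + 2 * MA.length - 2 * MB.length)
    (ht : 6 * h + 4 * MA.length + 2 * k + 5 * s + 7 ≤ t) (hT : 4 * t ≤ T) : Concl G x y N := by
  set W := (Finset.univ.erase o).filter (fun i => Wr x y N A i) with hWdef
  have memW : ∀ i, i ∈ W ↔ i ≠ o ∧ Wr x y N A i := by
    intro i; simp [hWdef]
  obtain ⟨WB, sWB, cWB⟩ := Finset.exists_subset_card_eq hW1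
  have cWA : (W \ WB).card + WB.card = W.card := Finset.card_sdiff_add_card_eq_card sWB
  obtain ⟨eA, MA', a1, a2, a3, a4, a5, a6⟩ := assign (x o, x o) (W \ WB) MA hMA.2 (by omega)
  obtain ⟨eB, MB', b1, b2, b3, b4, b5, b6⟩ := assign (x o, x o) WB MB hMB.2 (by omega)
  have dWA : ∀ i, i ∈ W \ WB → i ∉ WB := fun i hi => (Finset.mem_sdiff.1 hi).2
  have sWA : ∀ i, i ∈ W \ WB → i ∈ W := fun i hi => (Finset.mem_sdiff.1 hi).1
  have spl : ∀ i, i ∈ W → i ∉ WB → i ∈ W \ WB := fun i h1 h2 => Finset.mem_sdiff.2 ⟨h1, h2⟩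
  have memA : ∀ m ∈ MA, m.1 ∈ XA ∧ m.1 ∈ A ∧ m.2 ∈ A ∧ m.2 ∉ Ends x y ∧ m.1 ∉ Ends x y ∧ G.Adj m.1 m.2 := by
    intro m hm
    have := hMA.1 m hm
    rw [Finset.mem_sdiff] at this
    exact ⟨this.2.1, c.sA (sXA this.2.1), this.2.2.1, this.2.2.2, c.eA _ (sXA this.2.1), this.1⟩
  have memB : ∀ m ∈ MB, m.1 ∈ XB ∧ m.1 ∈ B ∧ m.2 ∈ B ∧ m.2 ∉ Ends x y ∧ G.Adj m.1 m.2 := by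
    intro m hm
    have := hMB.1 m hm
    rw [Finset.mem_sdiff] at this
    exact ⟨this.2.1, c.sB (sXB this.2.1), this.2.2.1, this.2.2.2, this.1⟩
  have dAB : ∀ v, v ∈ A → v ∈ B → False := fun v h1 h2 => (c.AB v).1 h1 h2
  set γ : Fin k → ℤ := fun i => if i ∈ WB then -1 else if i ∈ W then 1 else 0 with hγ
  set e : Fin k → V × V := fun i => if i ∈ WB then eB i else eA i with he
  have γ0 : ∀ i, γ i = 0 → i ∉ W := by
    intro i h' hw; simp only [hγ, hw, if_true] at h'; split_ifs at h' <;> omega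
  have γ0' : ∀ i, γ i ≠ 0 → i ∈ W := by
    intro i h'; simp only [hγ] at h'; split_ifs at h' with h1 h2
    · exact sWB h1
    · exact h2
    · exact absurd rfl h'
  have γ1 : ∀ i, γ i = 1 → i ∈ W \ WB := by
    intro i h'
    have h1 : i ∉ WB := fun h1 => by simp [hγ, h1] at h'
    exact spl i (γ0' i (by omega)) h1
  have γ2 : ∀ i, γ i = -1 → i ∈ WB := by
    intro i h'
    by_contra h1
    have h2 := γ0' i (by omega)
    simp [hγ, h1, h2] at h'
  have eWA : ∀ i ∈ W \ WB, e i = eA i := fun i hi => if_neg (dWA i hi)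
  have eWB : ∀ i ∈ WB, e i = eB i := fun i hi => if_pos hi
  have inA : ∀ i ∈ W \ WB, ∀ z ∈ ({(e i).1, (e i).2} : Finset V), z ∈ A := by
    intro i hi z hz
    rw [eWA i hi] at hz
    have := memA _ (a2 i hi)
    simp only [Finset.mem_insert, Finset.mem_singleton] at hz
    rcases hz with rfl | rfl
    exacts [this.2.1, this.2.2.1]
  have inB : ∀ i ∈ WB, ∀ z ∈ ({(e i).1, (e i).2} : Finset V), z ∈ B := by
    intro i hi z hz
    rw [eWB i hi] at hz
    have := memB _ (b2 i hi)
    simp only [Finset.mem_insert, Finset.mem_singleton] at hz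
    rcases hz with rfl | rfl
    exacts [this.2.1, this.2.2.1]
  have flA : ∀ a ∈ fl MA', a ∈ A ∧ a ∉ Ends x y := by
    intro a ha
    obtain ⟨q, hq, hz⟩ := exists_of_mem_fl ha
    have := memA q (a3 q hq)
    rcases hz with rfl | rfl
    · exact ⟨this.2.1, this.2.2.2.2.1⟩
    · exact ⟨this.2.2.1, this.2.2.2.1⟩
  refine c.core hS γ e MA' ?_ ?_ ?_ ?_ ?_ ?_ ?_ (fun q hq => (memA q (a3 q hq)).2.2.2.2.2) a4 flA ?_ (by omega) hT
  · intro i; simp only [hγ]; split_ifs <;> simp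
  · intro i hi h0
    have := γ0 i h0
    rw [memW] at this
    by_contra h'
    exact this ⟨hi, h'⟩
  · intro i hi h0
    have := (memW i).1 (γ0' i h0)
    exact ⟨this.2, hrig i hi this.2⟩
  · intro i hi h'
    have hw := γ1 i h'
    rw [eWA i hw]
    have := memA _ (a2 i hw)
    have hx := aXA _ this.1 i hi ((memW i).1 (sWA i hw)).2
    exact ⟨this.2.2.2.2.2, sXA this.1, this.2.2.1, this.2.2.2.1, hx.1, hx.2⟩
  · intro i hi h'
    have hw := γ2 i h'
    rw [eWB i hw]
    have := memB _ (b2 i hw)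
    have hx := aXB _ this.1 i hi ((memW i).1 (sWB hw)).2
    exact ⟨this.2.2.2.2, sXB this.1, this.2.2.1, this.2.2.2.1, hx.1, hx.2⟩
  · intro i j hi hj hij h0 h0'
    have wi := γ0' i h0
    have wj := γ0' j h0'
    by_cases hiB : i ∈ WB <;> by_cases hjB : j ∈ WB
    · rw [eWB i hiB, eWB j hjB]; exact b6 i hiB j hjB hij
    · rw [Finset.disjoint_left]
      intro z hz hz'
      exact dAB z (inA j (spl j wj hjB) z hz') (inB i hiB z hz)
    · rw [Finset.disjoint_left]
      intro z hz hz'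
      exact dAB z (inA i (spl i wi hiB) z hz) (inB j hjB z hz')
    · rw [eWA i (spl i wi hiB), eWA j (spl j wj hjB)]; exact a6 i (spl i wi hiB) j (spl j wj hjB) hij
  · intro i hi h0
    have wi := γ0' i h0
    by_cases hiB : i ∈ WB
    · exact ⟨fun h' => dAB _ (flA _ h').1 (inB i hiB _ (by simp)), fun h' => dAB _ (flA _ h').1 (inB i hiB _ (by simp))⟩
    · rw [eWA i (spl i wi hiB)]; exact a5 i (spl i wi hiB)
  · have hsum : ∑ i ∈ Finset.univ.erase o, 2 * γ i = 2 * ((W \ WB).card : ℤ) - 2 * WB.card := by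
      have e1 : ∀ i ∈ Finset.univ.erase o, 2 * γ i = (if i ∈ W \ WB then 2 else 0) - (if i ∈ WB then 2 else 0) := by
        intro i hi
        by_cases h1 : i ∈ WB
        · simp [hγ, h1]
        · by_cases h2 : i ∈ W <;> simp [hγ, h1, h2]
      rw [Finset.sum_congr rfl e1, Finset.sum_sub_distrib, ← Finset.sum_filter, ← Finset.sum_filter]
      have sub : ∀ S : Finset (Fin k), S ⊆ W → (Finset.univ.erase o).filter (fun i => i ∈ S) = S := by
        intro S hSW
        ext i
        simp only [Finset.mem_filter, Finset.mem_erase, Finset.mem_univ, and_true]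
        exact ⟨fun h' => h'.2, fun h' => ⟨((memW i).1 (hSW h')).1, h'⟩⟩
      rw [sub _ Finset.sdiff_subset, sub _ sWB]
      simp only [Finset.sum_const, nsmul_eq_mul]
      ring
    rw [hsum, hc]
    push_cast [← cWB, ← a1]
    ring

lemma CB.wrap [Fintype V] {G : SimpleGraph V} {x y : Fin k → V} {N : Fin k → ℕ} {o : Fin k} {s : ℕ}
    (hS : Setup G x y N o s) {A B A0 B0 : Finset V} {h t T : ℕ} (c : CB G x y A B A0 B0 h t T)
    {XA XB : Finset V} {MA MB : List (V × V)}
    (hMA : Mt G XA (A \ Ends x y) MA) (hMB : Mt G XB (B \ Ends x y) MB)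
    (sXA : XA ⊆ A0) (sXB : XB ⊆ B0)
    (aXA : ∀ a ∈ XA, ∀ i, i ≠ o → Wr x y N A i → (x i ∈ B → G.Adj (x i) a) ∧ (y i ∈ B → G.Adj (y i) a))
    (aXB : ∀ a ∈ XB, ∀ i, i ≠ o → Wr x y N A i → (x i ∈ A → G.Adj (x i) a) ∧ (y i ∈ A → G.Adj (y i) a))
    (hrig : ∀ i, i ≠ o → Wr x y N A i → Rig G x y A B A0 B0 t i)
    (hW1 : MB.length ≤ ((Finset.univ.erase o).filter (fun i => Wr x y N A i)).card ∨
      MA.length ≤ ((Finset.univ.erase o).filter (fun i => Wr x y N A i)).card)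
    (hW2 : ((Finset.univ.erase o).filter (fun i => Wr x y N A i)).card ≤ MA.length + MB.length)
    (hc : 2 * ((A.card : ℤ) - B.card) = ∑ i, (sg A (x i) + sg A (y i)) + 2 * MA.length - 2 * MB.length)
    (ht : 6 * h + 4 * MA.length + 4 * MB.length + 2 * k + 5 * s + 7 ≤ t) (hT : 4 * t ≤ T) : Concl G x y N := by
  rcases hW1 with hW1 | hW1
  · exact c.wrap1 hS hMA hMB sXA sXB aXA aXB hrig hW1 hW2 hc (by omega) hT
  · have hw : ∀ i, Wr x y N B i ↔ Wr x y N A i := by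
      intro i
      unfold Wr
      rw [c.AB (x i), c.AB (y i), not_iff_not (a := y i ∈ B)]
    have hsg : ∀ v, sg A v = - sg B v := by
      intro v
      by_cases hv : v ∈ B
      · rw [sg_pos hv, sg_neg (fun h' => (c.AB v).1 h' hv)]
      · rw [sg_neg hv, sg_pos ((c.AB v).2 hv)]; rfl
    have hcard : ((Finset.univ.erase o).filter (fun i => Wr x y N B i)) = ((Finset.univ.erase o).filter (fun i => Wr x y N A i)) :=
      Finset.filter_congr (fun i _ => hw i)
    refine c.symm.wrap1 hS hMB hMA sXB sXA ?_ ?_ ?_ ?_ ?_ ?_ (by omega) hT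
    · intro a ha i hi h'; exact aXB a ha i hi ((hw i).1 h')
    · intro a ha i hi h'; exact aXA a ha i hi ((hw i).1 h')
    · intro i hi h'
      obtain ⟨r1, r2, r3, r4⟩ := hrig i hi ((hw i).1 h')
      exact ⟨r3, r4, r1, r2⟩
    · rw [hcard]; exact hW1
    · rw [hcard]; omega
    · have : ∑ i, (sg A (x i) + sg A (y i)) = - ∑ i, (sg B (x i) + sg B (y i)) := by
        rw [← Finset.sum_neg_distrib]
        exact Finset.sum_congr rfl fun i _ => by rw [hsg, hsg]; ring
      rw [this] at hc
      linarith

end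
end W

namespace W
section
variable {V : Type} {k : ℕ}

/-- number of flexible endpoints of pair `i` in `A` -/
noncomputable def fc (x y : Fin k → V) (A : Finset V) (F : V → Prop) (i : Fin k) : ℕ :=
  (if x i ∈ A ∧ F (x i) then 1 else 0) + (if y i ∈ A ∧ F (y i) then 1 else 0)

/-- non-flexible endpoints are rigid -/
def RF (G : SimpleGraph V) (x y : Fin k → V) (A B A0 B0 : Finset V) (t : ℕ) (F : V → Prop) : Prop :=
  ∀ v ∈ Ends x y, ¬ F v → (v ∈ A → ms G v B0 ≤ 2 * t ∧ dg G v A0 ≤ 2 * t) ∧ (v ∈ B → ms G v A0 ≤ 2 * t ∧ dg G v B0 ≤ 2 * t)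

lemma RF.symm {G : SimpleGraph V} {x y : Fin k → V} {A B A0 B0 : Finset V} {t : ℕ} {F : V → Prop}
    (h : RF G x y A B A0 B0 t F) : RF G x y B A B0 A0 t F :=
  fun v hv hF => ⟨(h v hv hF).2, (h v hv hF).1⟩

lemma fc_card (x y : Fin k → V) (A : Finset V) (F : V → Prop) :
    ((Ends x y).filter (fun v => v ∈ A ∧ F v)).card ≤ ∑ i, fc x y A F i := by
  have hsub : (Ends x y).filter (fun v => v ∈ A ∧ F v) ⊆
      (Finset.univ.filter (fun i => x i ∈ A ∧ F (x i))).image x ∪ (Finset.univ.filter (fun i => y i ∈ A ∧ F (y i))).image y := by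
    intro v hv
    rw [Finset.mem_filter, mem_Ends] at hv
    obtain ⟨⟨i, rfl | rfl⟩, h2⟩ := hv
    · exact Finset.mem_union_left _ (Finset.mem_image_of_mem _ (by simpa using h2))
    · exact Finset.mem_union_right _ (Finset.mem_image_of_mem _ (by simpa using h2))
  have h1 := Finset.card_le_card hsub
  have h2 := Finset.card_union_le ((Finset.univ.filter (fun i => x i ∈ A ∧ F (x i))).image x) ((Finset.univ.filter (fun i => y i ∈ A ∧ F (y i))).image y)
  have h3 := Finset.card_image_le (s := Finset.univ.filter (fun i => x i ∈ A ∧ F (x i))) (f := x)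
  have h4 := Finset.card_image_le (s := Finset.univ.filter (fun i => y i ∈ A ∧ F (y i))) (f := y)
  have h5 : ∑ i, fc x y A F i = (Finset.univ.filter (fun i => x i ∈ A ∧ F (x i))).card + (Finset.univ.filter (fun i => y i ∈ A ∧ F (y i))).card := by
    rw [Finset.card_filter, Finset.card_filter, ← Finset.sum_add_distrib]; rfl
  omega

lemma CB.genX [Fintype V] {G : SimpleGraph V} {x y : Fin k → V} {N : Fin k → ℕ} {o : Fin k} {s : ℕ}
    (hS : Setup G x y N o s) {A B A0 B0 : Finset V} {h t T : ℕ} (c : CB G x y A B A0 B0 h t T) {F : V → Prop}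
    (hF : RF G x y A B A0 B0 t F) :
    ∃ X ⊆ A0, (A0 \ X).card ≤ 4 * k * t ∧ X ⊆ A \ Ends x y ∧ (∀ a ∈ X, ∀ v ∈ Ends x y, ¬ F v → v ∈ B → G.Adj v a) ∧
      ∀ a ∈ X, A.card + 2 * k ≤ 2 * dg G a (A \ Ends x y) + B.card + 2 * ∑ i, fc x y A F i := by
  set bad : V → Finset V := fun v => A0.filter (fun a => (v ∈ B ∧ ¬ G.Adj v a) ∨ (v ∈ A ∧ G.Adj v a)) with hbad
  set X : Finset V := A0 \ ((Ends x y).filter (fun v => ¬ F v)).biUnion bad with hX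
  have hXA : X ⊆ A0 := Finset.sdiff_subset
  have hBA : ∀ v, v ∈ B → v ∉ A := fun v hv h' => (c.AB v).1 h' hv
  have key : ∀ a ∈ X, ∀ v ∈ Ends x y, ¬ F v → (v ∈ B → G.Adj v a) ∧ (v ∈ A → ¬ G.Adj v a) := by
    intro a ha v hv hFv
    rw [hX, Finset.mem_sdiff, Finset.mem_biUnion] at ha
    have := fun h' => ha.2 ⟨v, Finset.mem_filter.2 ⟨hv, hFv⟩, h'⟩
    simp only [hbad, Finset.mem_filter, ha.1, true_and] at this
    exact ⟨fun h1 => by by_contra h2; exact this (Or.inl ⟨h1, h2⟩), fun h1 h2 => this (Or.inr ⟨h1, h2⟩)⟩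
  refine ⟨X, hXA, ?_, ?_, fun a ha v hv hFv => (key a ha v hv hFv).1, ?_⟩
  · have h1 : A0 \ X ⊆ ((Ends x y).filter (fun v => ¬ F v)).biUnion bad := by
      intro a ha
      rw [hX, Finset.mem_sdiff, Finset.mem_sdiff] at ha
      by_contra h'
      exact ha.2 ⟨ha.1, h'⟩
    have h2 : (((Ends x y).filter (fun v => ¬ F v)).biUnion bad).card ≤ ∑ v ∈ (Ends x y).filter (fun v => ¬ F v), (bad v).card := Finset.card_biUnion_le
    have h3 := sum_le_mul ((Ends x y).filter (fun v => ¬ F v)) (fun v => (bad v).card) (2 * k) (2 * t)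
      ((Finset.card_filter_le _ _).trans (card_Ends x y)) (by
        intro v hv
        rw [Finset.mem_filter] at hv
        have := hF v hv.1 hv.2
        by_cases hvA : v ∈ A
        · have e1 : bad v = A0.filter (fun a => G.Adj v a) := by
            have := (c.AB v).1 hvA
            simp only [hbad]
            exact Finset.filter_congr fun a _ => by simp [hvA, this]
          have e2 := (this.1 hvA).2
          rw [e1]; exact e2
        · have hvB : v ∈ B := by by_contra h'; exact hvA ((c.AB v).2 h')
          have e1 : bad v = A0.filter (fun a => ¬ G.Adj v a) := by
            simp only [hbad]
            exact Finset.filter_congr fun a _ => by simp [hvA, hvB]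
          have e2 := (this.2 hvB).1
          rw [e1]; exact e2)
    have h4 := Finset.card_le_card h1
    nlinarith
  · intro a ha
    exact Finset.mem_sdiff.2 ⟨c.sA (hXA ha), c.eA a (hXA ha)⟩
  · intro a ha
    have h1 := hS.deg a
    have h1' : Fintype.card V + 2 * k ≤ 2 * dg G a Finset.univ := h1
    have hd : Disjoint A B := by
      rw [Finset.disjoint_left]; intro v h1 h2; exact hBA v h2 h1
    have hu : A ∪ B = Finset.univ := by
      ext v; have := c.AB v; simp only [Finset.mem_union, Finset.mem_univ, iff_true]
      by_cases hv : v ∈ B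
      · exact Or.inr hv
      · exact Or.inl (this.2 hv)
    have h2 : A.card + B.card = Fintype.card V := by
      rw [← Finset.card_union_of_disjoint hd, hu, Finset.card_univ]
    have h3 := dg_union G a hd
    rw [hu] at h3
    have h4 := dg_le_card G a B
    have h5 : dg G a A ≤ dg G a (A \ Ends x y) + dg G a (A ∩ Ends x y) := by
      rw [← dg_union G a (Finset.disjoint_sdiff_inter A (Ends x y)), Finset.sdiff_union_inter]
    have h6 : dg G a (A ∩ Ends x y) ≤ ((Ends x y).filter (fun v => v ∈ A ∧ F v)).card := by
      refine Finset.card_le_card ?_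
      intro v hv
      rw [Finset.mem_filter, Finset.mem_inter] at hv
      rw [Finset.mem_filter]
      refine ⟨hv.1.2, hv.1.1, ?_⟩
      by_contra hFv
      exact (key a ha v hv.1.2 hFv).2 hv.1.1 hv.2.symm
    have h7 := fc_card x y A F
    omega

end
end W

namespace W
section
variable {V : Type} {k : ℕ}

/-- The balanced choice of sides. -/
structure Bal [Fintype V] (G : SimpleGraph V) (x y : Fin k → V) (N : Fin k → ℕ) (o : Fin k) (s : ℕ)
    (A B A0 B0 : Finset V) (h T : ℕ) (F : V → Prop) (w : ℕ) : Prop where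
  S : Setup G x y N o s
  c : CB G x y A B A0 B0 h (40 * h) T
  rf : RF G x y A B A0 B0 (40 * h) F
  wr : ∀ i, Wr x y N A i → ¬ F (x i) ∧ ¬ F (y i)
  hw : w = (Finset.univ.filter (fun i => Wr x y N A i)).card
  qA : -2 ≤ 4 * (k : ℤ) + ∑ i, (sg A (x i) + sg A (y i)) - 4 * ((∑ i, fc x y A F i : ℕ) : ℤ) - 2 * w
  qB : -2 ≤ 4 * (k : ℤ) - ∑ i, (sg A (x i) + sg A (y i)) - 4 * ((∑ i, fc x y B F i : ℕ) : ℤ) - 2 * w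
  par : (4 : ℤ) ∣ 2 * ((A.card : ℤ) - B.card) - ∑ i, (sg A (x i) + sg A (y i)) - 2 * w
  hk : 4 * k + 8 ≤ h
  hs : s ≤ h
  hT : 1000 * (k * h) ≤ T
  nA : 100 * (k * T) ≤ A0.card
  nB : 100 * (k * T) ≤ B0.card

lemma Wr_symm {x y : Fin k → V} {N : Fin k → ℕ} {A B : Finset V} (hAB : ∀ v, v ∈ A ↔ v ∉ B) (i : Fin k) :
    Wr x y N B i ↔ Wr x y N A i := by
  unfold Wr
  rw [hAB (x i), hAB (y i), not_iff_not (a := y i ∈ B)]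

lemma sgs_symm {x y : Fin k → V} {A B : Finset V} (hAB : ∀ v, v ∈ A ↔ v ∉ B) :
    ∑ i, (sg B (x i) + sg B (y i)) = - ∑ i, (sg A (x i) + sg A (y i)) := by
  have hsg : ∀ v, sg B v = - sg A v := by
    intro v
    by_cases hv : v ∈ B
    · rw [sg_pos hv, sg_neg (fun h' => (hAB v).1 h' hv)]; rfl
    · rw [sg_neg hv, sg_pos ((hAB v).2 hv)]
  rw [← Finset.sum_neg_distrib]
  exact Finset.sum_congr rfl fun i _ => by rw [hsg, hsg]; ring

lemma Bal.symm [Fintype V] {G : SimpleGraph V} {x y : Fin k → V} {N : Fin k → ℕ} {o : Fin k} {s : ℕ}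
    {A B A0 B0 : Finset V} {h T : ℕ} {F : V → Prop} {w : ℕ} (b : Bal G x y N o s A B A0 B0 h T F w) :
    Bal G x y N o s B A B0 A0 h T F w where
  S := b.S
  c := b.c.symm
  rf := b.rf.symm
  wr := fun i hi => b.wr i ((Wr_symm b.c.AB i).1 hi)
  hw := by rw [b.hw]; congr 1; exact Finset.filter_congr fun i _ => (Wr_symm b.c.AB i).symm
  qA := by rw [sgs_symm b.c.AB]; have := b.qB; linarith
  qB := by rw [sgs_symm b.c.AB]; have := b.qA; linarith
  par := by
    rw [sgs_symm b.c.AB]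
    obtain ⟨q, hq⟩ := b.par
    exact ⟨-q - w, by linarith⟩
  hk := b.hk
  hs := b.hs
  hT := b.hT
  nA := b.nB
  nB := b.nA

lemma Bal.w_le [Fintype V] {G : SimpleGraph V} {x y : Fin k → V} {N : Fin k → ℕ} {o : Fin k} {s : ℕ}
    {A B A0 B0 : Finset V} {h T : ℕ} {F : V → Prop} {w : ℕ} (b : Bal G x y N o s A B A0 B0 h T F w) : w ≤ k := by
  rw [b.hw]; simpa using Finset.card_filter_le (Finset.univ : Finset (Fin k)) (fun i => Wr x y N A i)

lemma Bal.genX [Fintype V] {G : SimpleGraph V} {x y : Fin k → V} {N : Fin k → ℕ} {o : Fin k} {s : ℕ}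
    {A B A0 B0 : Finset V} {h T : ℕ} {F : V → Prop} {w : ℕ} (b : Bal G x y N o s A B A0 B0 h T F w) :
    ∃ X ⊆ A0, (A0 \ X).card ≤ 160 * (k * h) ∧ X ⊆ A \ Ends x y ∧
      (∀ a ∈ X, ∀ i, i ≠ o → Wr x y N A i → (x i ∈ B → G.Adj (x i) a) ∧ (y i ∈ B → G.Adj (y i) a)) ∧
      (∀ a ∈ X, 2 * ((A.card : ℤ) - B.card) - ∑ i, (sg A (x i) + sg A (y i)) + 2 * w - 2 ≤ 4 * dg G a (A \ Ends x y)) ∧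
      100 * (k * T) ≤ X.card + 160 * (k * h) := by
  obtain ⟨X, h1, h2, h3, h4, h5⟩ := b.c.genX b.S b.rf
  have hc : (A0 \ X).card + X.card = A0.card := Finset.card_sdiff_add_card_eq_card h1
  have h2' : (A0 \ X).card ≤ 160 * (k * h) := by
    rw [show 160 * (k * h) = 4 * k * (40 * h) by ring]; exact h2
  refine ⟨X, h1, h2', h3, ?_, ?_, ?_⟩
  · intro a ha i hi hw
    have := b.wr i hw
    exact ⟨h4 a ha _ (mem_Ends.2 ⟨i, Or.inl rfl⟩) this.1, h4 a ha _ (mem_Ends.2 ⟨i, Or.inr rfl⟩) this.2⟩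
  · intro a ha
    have e1 := h5 a ha
    have e2 := b.qA
    zify at e1
    push_cast at e2 e1 ⊢
    linarith
  · have := b.nA; omega

lemma Bal.rig [Fintype V] {G : SimpleGraph V} {x y : Fin k → V} {N : Fin k → ℕ} {o : Fin k} {s : ℕ}
    {A B A0 B0 : Finset V} {h T : ℕ} {F : V → Prop} {w : ℕ} (b : Bal G x y N o s A B A0 B0 h T F w) :
    ∀ i, i ≠ o → Wr x y N A i → Rig G x y A B A0 B0 (40 * h) i := by
  intro i _ hw
  have := b.wr i hw
  have hx := b.rf _ (mem_Ends.2 ⟨i, Or.inl rfl⟩) this.1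
  have hy := b.rf _ (mem_Ends.2 ⟨i, Or.inr rfl⟩) this.2
  exact ⟨fun h' => (hx.1 h').1, fun h' => (hy.1 h').1, fun h' => (hx.2 h').1, fun h' => (hy.2 h').1⟩

lemma Bal.cardW [Fintype V] {G : SimpleGraph V} {x y : Fin k → V} {N : Fin k → ℕ} {o : Fin k} {s : ℕ}
    {A B A0 B0 : Finset V} {h T : ℕ} {F : V → Prop} {w : ℕ} (b : Bal G x y N o s A B A0 B0 h T F w) :
    ((Finset.univ.erase o).filter (fun i => Wr x y N A i)).card ≤ w ∧
    w ≤ ((Finset.univ.erase o).filter (fun i => Wr x y N A i)).card + 1 := by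
  rw [b.hw, Finset.filter_erase]
  refine ⟨Finset.card_le_card (Finset.erase_subset _ _), ?_⟩
  have := Finset.pred_card_le_card_erase (s := Finset.univ.filter (fun i => Wr x y N A i)) (a := o)
  omega

lemma Bal.caseI [Fintype V] {G : SimpleGraph V} {x y : Fin k → V} {N : Fin k → ℕ} {o : Fin k} {s : ℕ}
    {A B A0 B0 : Finset V} {h T : ℕ} {F : V → Prop} {w : ℕ} (b : Bal G x y N o s A B A0 B0 h T F w)
    (h1 : 2 * ((A.card : ℤ) - B.card) - ∑ i, (sg A (x i) + sg A (y i)) ≤ 2 * w)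
    (h2 : -(2 * w : ℤ) ≤ 2 * ((A.card : ℤ) - B.card) - ∑ i, (sg A (x i) + sg A (y i))) : Concl G x y N := by
  have hw := b.w_le
  have hk1 : 1 ≤ k := o.pos
  have hk := b.hk
  have hs := b.hs
  have hT := b.hT
  have hkk : k * k ≤ k * h := Nat.mul_le_mul_left _ (by omega)
  have hkT : T ≤ k * T := Nat.le_mul_of_pos_left _ hk1
  have hkh : h ≤ k * h := Nat.le_mul_of_pos_left _ hk1
  obtain ⟨q, hq⟩ := b.par
  obtain ⟨rA, hrA⟩ : ∃ rA : ℕ, (rA : ℤ) = w + q := ⟨(w + q).toNat, by rw [Int.toNat_of_nonneg]; omega⟩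
  obtain ⟨rB, hrB⟩ : ∃ rB : ℕ, (rB : ℤ) = - q := ⟨(- q).toNat, by rw [Int.toNat_of_nonneg]; omega⟩
  obtain ⟨XA, a1, a2, a3, a4, a5, a6⟩ := b.genX
  obtain ⟨XB, b1, b2, b3, b4, b5, b6⟩ := b.symm.genX
  rw [sgs_symm b.c.AB] at b5
  have hrAw : rA + rB = w := by omega
  have hAA : rA * rA ≤ k * k := Nat.mul_le_mul (by omega) (by omega)
  have hBB : rB * rB ≤ k * k := Nat.mul_le_mul (by omega) (by omega)
  obtain ⟨MA, hMA, lA⟩ := match_deg (G := G) rA XA (A \ Ends x y) (fun a ha => by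
    have := a5 a ha; omega) a3 (by rw [mul_assoc]; omega)
  obtain ⟨MB, hMB, lB⟩ := match_deg (G := G) rB XB (B \ Ends x y) (fun a ha => by
    have := b5 a ha; omega) b3 (by rw [mul_assoc]; omega)
  have hcw := b.cardW
  refine b.c.wrap b.S hMA hMB a1 b1 a4 ?_ b.rig ?_ ?_ ?_ ?_ ?_
  · intro a ha i hi hw; exact b4 a ha i hi ((Wr_symm b.c.AB i).2 hw)
  · omega
  · omega
  · rw [lA, lB]; omega
  · omega
  · omega

lemma Bal.caseII [Fintype V] {G : SimpleGraph V} {x y : Fin k → V} {N : Fin k → ℕ} {o : Fin k} {s : ℕ}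
    {A B A0 B0 : Finset V} {h T : ℕ} {F : V → Prop} {w : ℕ} (b : Bal G x y N o s A B A0 B0 h T F w)
    (h1 : 2 * (w : ℤ) < 2 * ((A.card : ℤ) - B.card) - ∑ i, (sg A (x i) + sg A (y i)))
    (hD : A.card ≤ B.card + 2 * h)
    (hsl : (∀ v ∈ A \ Ends x y, dg G v A0 < T) ∨ 6 * h ≤ (A0.filter (fun a => T ≤ dg G a A0)).card) : Concl G x y N := by
  have hw := b.w_le
  have hk1 : 1 ≤ k := o.pos
  have hk := b.hk
  have hs := b.hs
  have hT := b.hT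
  have hkk : k * k ≤ k * h := Nat.mul_le_mul_left _ (by omega)
  have hkT : T ≤ k * T := Nat.le_mul_of_pos_left _ hk1
  have hkh : h ≤ k * h := Nat.le_mul_of_pos_left _ hk1
  obtain ⟨q, hq⟩ := b.par
  have hSk : - (2 * k : ℤ) ≤ ∑ i, (sg A (x i) + sg A (y i)) := by
    have : ∑ i : Fin k, (-2 : ℤ) ≤ ∑ i, (sg A (x i) + sg A (y i)) := by
      refine Finset.sum_le_sum fun i _ => ?_
      unfold sg; split_ifs <;> norm_num
    simp at this; linarith
  obtain ⟨r, hr⟩ : ∃ r : ℕ, (r : ℤ) = w + 2 * q := ⟨(w + 2 * q).toNat, by rw [Int.toNat_of_nonneg]; omega⟩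
  have hr3 : r ≤ 3 * h := by omega
  have hrw : w + 2 ≤ r := by omega
  obtain ⟨XA, a1, a2, a3, a4, a5, a6⟩ := b.genX
  obtain ⟨XB, b1, b2, b3, b4, b5, b6⟩ := b.symm.genX
  obtain ⟨M, hM, lM⟩ : ∃ M, Mt G XA (A \ Ends x y) M ∧ M.length = r := by
    rcases hsl with hn | hn
    · refine match_bdd (d := r / 2) (D := T) (fun a ha => ?_) (fun v hv => ?_) a3 r ?_
      · have := a5 a ha; omega
      · exact (dg_mono G v a1).trans (hn v hv).le
      · obtain ⟨d, hd⟩ : ∃ d, d = r / 2 := ⟨_, rfl⟩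
        rw [← hd]
        have e1 : 2 * r * (T + d) ≤ 6 * d * (T + d) := Nat.mul_le_mul_right _ (by omega)
        have e2 : d * (6 * (T + d)) ≤ d * XA.card := Nat.mul_le_mul_left _ (by omega)
        have e3 : 6 * d * (T + d) = d * (6 * (T + d)) := by ring
        omega
    · refine match_slack (m := r) (Z := A0.filter (fun a => T ≤ dg G a A0)) ?_ ?_ ?_ r le_rfl
      · intro a ha
        have := (Finset.mem_filter.1 ha).1
        exact Finset.mem_sdiff.2 ⟨b.c.sA this, b.c.eA a this⟩
      · intro v hv
        have e1 := (Finset.mem_filter.1 hv).2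
        have e2 := dg_split G v A0 XA
        omega
      · omega
  have hcw := b.cardW
  refine b.c.wrap b.S hM (Mt.nil G XB (B \ Ends x y)) a1 b1 a4 ?_ b.rig ?_ ?_ ?_ ?_ ?_
  · intro a ha i hi hw; exact b4 a ha i hi ((Wr_symm b.c.AB i).2 hw)
  · simp
  · simp; omega
  · rw [lM]; simp; omega
  · simp; omega
  · omega

end
end W

namespace W
section
variable {V : Type} {k : ℕ}

lemma like1 (r1 r2 r3 r4 p m : Prop) (h1 : ¬ (r1 ∧ r2)) (h2 : ¬ (r3 ∧ r4)) :
    ∃ a b : Prop, (r1 → a) ∧ (r2 → ¬ a) ∧ (r3 → b) ∧ (r4 → ¬ b) ∧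
      ((¬ r1 ∧ ¬ r2) ∨ (¬ r3 ∧ ¬ r4) → ((b ↔ a) ↔ p)) ∧
      ((¬ r1 ∧ ¬ r2) ∧ (¬ r3 ∧ ¬ r4) → (p → (a ↔ m)) ∧ (¬ p → a)) := by
  by_cases f1 : ¬ r1 ∧ ¬ r2
  · by_cases f2 : ¬ r3 ∧ ¬ r4
    · by_cases hp : p
      · exact ⟨m, m, by simp [f1, f2, hp]⟩
      · exact ⟨True, False, by simp [f1, f2, hp]⟩
    · refine ⟨(r3 ↔ p), r3, ?_⟩
      by_cases h3 : r3 <;> by_cases h4 : r4 <;> simp_all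
  · refine ⟨r1, if (¬ r3 ∧ ¬ r4) then (r1 ↔ p) else r3, ?_⟩
    by_cases h1' : r1 <;> by_cases h2' : r2 <;> by_cases h3 : r3 <;> by_cases h4 : r4 <;> by_cases hp : p <;> simp_all

lemma like2 (x y : Fin k → V) (N : Fin k → ℕ) (A B : Finset V) (F : V → Prop) (i : Fin k)
    (hAB : ∀ v, v ∈ A ↔ v ∉ B) (m : Prop) [Decidable m]
    (h1 : F (x i) ∨ F (y i) → ((y i ∈ A ↔ x i ∈ A) ↔ N i % 2 = 1))
    (h2 : F (x i) ∧ F (y i) → (N i % 2 = 1 → (x i ∈ A ↔ m))) :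
    (2 * (if (F (x i) ∧ F (y i) ∧ N i % 2 = 1) then (if m then -1 else 1) else 0) : ℤ) ≤
      4 + (sg A (x i) + sg A (y i)) - 4 * (fc x y A F i : ℤ) - 2 * (if Wr x y N A i then 1 else 0) ∧
    (2 * (if (F (x i) ∧ F (y i) ∧ N i % 2 = 1) then (if m then 1 else -1) else 0) : ℤ) ≤
      4 - (sg A (x i) + sg A (y i)) - 4 * (fc x y B F i : ℤ) - 2 * (if Wr x y N A i then 1 else 0) := by
  have e1 : x i ∈ B ↔ x i ∉ A := by rw [hAB]; simp
  have e2 : y i ∈ B ↔ y i ∉ A := by rw [hAB]; simp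
  unfold fc Wr sg
  simp only [e1, e2]
  by_cases f1 : F (x i) <;> by_cases f2 : F (y i) <;> by_cases a1 : x i ∈ A <;> by_cases a2 : y i ∈ A <;>
    by_cases p : N i % 2 = 1 <;> by_cases hm : m <;>
    simp [f1, f2, a1, a2, p, hm] at h1 h2 ⊢

lemma likes {x y : Fin k → V} (hI : Inj x y) (N : Fin k → ℕ) (RA RB : V → Prop) (hR : ∀ v, ¬ (RA v ∧ RB v)) :
    ∃ E ⊆ Ends x y, (∀ v ∈ Ends x y, (RA v → v ∈ E) ∧ (RB v → v ∉ E)) ∧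
      ∀ A B : Finset V, (∀ v, v ∈ A ↔ v ∉ B) → (∀ v ∈ Ends x y, v ∈ A ↔ v ∈ E) →
        (∀ i, Wr x y N A i → ¬ (¬ RA (x i) ∧ ¬ RB (x i)) ∧ ¬ (¬ RA (y i) ∧ ¬ RB (y i))) ∧
        -2 ≤ 4 * (k : ℤ) + ∑ i, (sg A (x i) + sg A (y i)) - 4 * ((∑ i, fc x y A (fun v => ¬ RA v ∧ ¬ RB v) i : ℕ) : ℤ)
          - 2 * ((Finset.univ.filter (fun i => Wr x y N A i)).card : ℤ) ∧
        -2 ≤ 4 * (k : ℤ) - ∑ i, (sg A (x i) + sg A (y i)) - 4 * ((∑ i, fc x y B (fun v => ¬ RA v ∧ ¬ RB v) i : ℕ) : ℤ)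
          - 2 * ((Finset.univ.filter (fun i => Wr x y N A i)).card : ℤ) := by
  set F : V → Prop := fun v => ¬ RA v ∧ ¬ RB v with hF
  set Q : Finset (Fin k) := Finset.univ.filter (fun i => F (x i) ∧ F (y i) ∧ N i % 2 = 1) with hQ
  obtain ⟨Q1, hQ1, cQ1⟩ := Finset.exists_subset_card_eq (s := Q) (n := Q.card / 2) (by omega)
  choose a b hab using fun i => like1 (RA (x i)) (RB (x i)) (RA (y i)) (RB (y i)) (N i % 2 = 1) (i ∈ Q1) (hR _) (hR _)
  refine ⟨(Finset.univ.filter a).image x ∪ (Finset.univ.filter b).image y, ?_, ?_, ?_⟩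
  · intro v hv
    simp only [Finset.mem_union, Finset.mem_image, Finset.mem_filter] at hv
    rw [mem_Ends]
    rcases hv with ⟨i, _, rfl⟩ | ⟨i, _, rfl⟩
    exacts [⟨i, Or.inl rfl⟩, ⟨i, Or.inr rfl⟩]
  all_goals
    have mx : ∀ i, x i ∈ (Finset.univ.filter a).image x ∪ (Finset.univ.filter b).image y ↔ a i := by
      intro i
      simp only [Finset.mem_union, Finset.mem_image, Finset.mem_filter, Finset.mem_univ, true_and]
      constructor
      · rintro (⟨j, hj, e⟩ | ⟨j, hj, e⟩)
        · rw [← hI.1 _ _ e]; exact hj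
        · exact absurd e.symm (hI.2.2 _ _)
      · exact fun h => Or.inl ⟨i, h, rfl⟩
    have my : ∀ i, y i ∈ (Finset.univ.filter a).image x ∪ (Finset.univ.filter b).image y ↔ b i := by
      intro i
      simp only [Finset.mem_union, Finset.mem_image, Finset.mem_filter, Finset.mem_univ, true_and]
      constructor
      · rintro (⟨j, hj, e⟩ | ⟨j, hj, e⟩)
        · exact absurd e (hI.2.2 _ _)
        · rw [← hI.2.1 _ _ e]; exact hj
      · exact fun h => Or.inr ⟨i, h, rfl⟩
  · intro v hv
    rw [mem_Ends] at hv
    obtain ⟨i, rfl | rfl⟩ := hv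
    · rw [mx]; exact ⟨(hab i).1, (hab i).2.1⟩
    · rw [my]; exact ⟨(hab i).2.2.1, (hab i).2.2.2.1⟩
  · intro A B hAB hE
    have ex : ∀ i, x i ∈ A ↔ a i := fun i => (hE _ (mem_Ends.2 ⟨i, Or.inl rfl⟩)).trans (mx i)
    have ey : ∀ i, y i ∈ A ↔ b i := fun i => (hE _ (mem_Ends.2 ⟨i, Or.inr rfl⟩)).trans (my i)
    have c1 : ∀ i, F (x i) ∨ F (y i) → ((y i ∈ A ↔ x i ∈ A) ↔ N i % 2 = 1) := by
      intro i hi; rw [ex, ey]; exact (hab i).2.2.2.2.1 hi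
    have c2 : ∀ i, F (x i) ∧ F (y i) → (N i % 2 = 1 → (x i ∈ A ↔ i ∈ Q1)) := by
      intro i hi hp; rw [ex]; exact ((hab i).2.2.2.2.2 hi).1 hp
    have c3 := fun i => like2 x y N A B F i hAB (i ∈ Q1) (c1 i) (c2 i)
    have hcQ : (Q \ Q1).card + Q1.card = Q.card := Finset.card_sdiff_add_card_eq_card hQ1
    have hsum : ∑ i : Fin k, (2 * (if (F (x i) ∧ F (y i) ∧ N i % 2 = 1) then (if i ∈ Q1 then -1 else 1) else 0) : ℤ) =
        2 * ((Q \ Q1).card : ℤ) - 2 * Q1.card := by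
      rw [← Finset.mul_sum]
      have : ∀ i : Fin k, (if (F (x i) ∧ F (y i) ∧ N i % 2 = 1) then (if i ∈ Q1 then -1 else 1) else 0 : ℤ) =
          (if i ∈ Q \ Q1 then 1 else 0) - (if i ∈ Q1 then 1 else 0) := by
        intro i
        have hq : (F (x i) ∧ F (y i) ∧ N i % 2 = 1) ↔ i ∈ Q := by simp [hQ]
        rw [if_congr hq rfl rfl]
        by_cases h1 : i ∈ Q1
        · simp [h1, hQ1 h1]
        · by_cases h2 : i ∈ Q <;> simp [h1, h2]
      rw [Finset.sum_congr rfl fun i _ => this i, Finset.sum_sub_distrib, Finset.sum_boole, Finset.sum_boole,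
        Finset.filter_univ_mem, Finset.filter_univ_mem]
      ring
    have hsum' : ∑ i : Fin k, (2 * (if (F (x i) ∧ F (y i) ∧ N i % 2 = 1) then (if i ∈ Q1 then 1 else -1) else 0) : ℤ) =
        2 * Q1.card - 2 * ((Q \ Q1).card : ℤ) := by
      have : ∀ i : Fin k, (2 * (if (F (x i) ∧ F (y i) ∧ N i % 2 = 1) then (if i ∈ Q1 then 1 else -1) else 0) : ℤ) =
          - (2 * (if (F (x i) ∧ F (y i) ∧ N i % 2 = 1) then (if i ∈ Q1 then -1 else 1) else 0) : ℤ) := by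
        intro i; split_ifs <;> norm_num
      rw [Finset.sum_congr rfl fun i _ => this i, Finset.sum_neg_distrib, hsum]; ring
    have s1 := Finset.sum_le_sum (s := Finset.univ) fun i _ => (c3 i).1
    have s2 := Finset.sum_le_sum (s := Finset.univ) fun i _ => (c3 i).2
    replace s1 := hsum.symm.le.trans (le_of_eq_of_le (by congr!) s1)
    replace s2 := hsum'.symm.le.trans (le_of_eq_of_le (by congr!) s2)
    simp only [Finset.sum_sub_distrib, Finset.sum_add_distrib, ← Finset.mul_sum, Finset.sum_boole] at s1 s2
    simp only [Finset.sum_const, Finset.card_univ, Fintype.card_fin, nsmul_eq_mul] at s1 s2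
    simp only [Finset.sum_add_distrib]
    refine ⟨?_, ?_, ?_⟩
    · intro i hw
      exact ⟨fun h' => hw (c1 i (Or.inl h')), fun h' => hw (c1 i (Or.inr h'))⟩
    · push_cast; omega
    · push_cast; omega

end
end W

namespace W
section
variable {V : Type} {k : ℕ}

lemma par_aux {x y : Fin k → V} (N : Fin k → ℕ) (A : Finset V) :
    (4 : ℤ) ∣ 2 * ((∑ i, N i : ℕ) : ℤ) - ∑ i, (sg A (x i) + sg A (y i)) - 2 * ((Finset.univ.filter (fun i => Wr x y N A i)).card : ℤ) := by
  have : 2 * ((∑ i, N i : ℕ) : ℤ) - ∑ i, (sg A (x i) + sg A (y i)) - 2 * ((Finset.univ.filter (fun i => Wr x y N A i)).card : ℤ)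
      = ∑ i, (2 * (N i : ℤ) - (sg A (x i) + sg A (y i)) - 2 * (if Wr x y N A i then 1 else 0)) := by
    simp only [Finset.sum_sub_distrib, ← Finset.mul_sum, Finset.sum_boole]
    push_cast
    rfl
  rw [this]
  refine Finset.dvd_sum fun i _ => ?_
  unfold Wr sg
  by_cases a1 : x i ∈ A <;> by_cases a2 : y i ∈ A <;> by_cases p : N i % 2 = 1 <;> simp [a1, a2, p] <;> omega

/-- Good cores. -/
structure GC [Fintype V] (G : SimpleGraph V) (x y : Fin k → V) (N : Fin k → ℕ) (o : Fin k) (s : ℕ)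
    (A0 B0 : Finset V) (h T : ℕ) : Prop where
  S : Setup G x y N o s
  d : Disjoint A0 B0
  nA : Fintype.card V ≤ 2 * A0.card + 2 * h
  nB : Fintype.card V ≤ 2 * B0.card + 2 * h
  mA : ∀ a ∈ A0, ms G a B0 ≤ h
  mB : ∀ a ∈ B0, ms G a A0 ≤ h
  eA : ∀ v ∈ A0, v ∉ Ends x y
  eB : ∀ v ∈ B0, v ∉ Ends x y
  hk : 4 * k + 8 ≤ h
  hs : s ≤ h
  hT : 1000 * (k * h) ≤ T
  hn : 300 * (k * T) ≤ Fintype.card V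

lemma GC.symm [Fintype V] {G : SimpleGraph V} {x y : Fin k → V} {N : Fin k → ℕ} {o : Fin k} {s : ℕ}
    {A0 B0 : Finset V} {h T : ℕ} (g : GC G x y N o s A0 B0 h T) : GC G x y N o s B0 A0 h T :=
  ⟨g.S, g.d.symm, g.nB, g.nA, g.mB, g.mA, g.eB, g.eA, g.hk, g.hs, g.hT, g.hn⟩

lemma GC.bal [Fintype V] {G : SimpleGraph V} {x y : Fin k → V} {N : Fin k → ℕ} {o : Fin k} {s : ℕ}
    {A0 B0 : Finset V} {h T : ℕ} (g : GC G x y N o s A0 B0 h T) {A B : Finset V}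
    (hAB : ∀ v, v ∈ A ↔ v ∉ B) (sA : A0 ⊆ A) (sB : B0 ⊆ B)
    (tA : ∀ v ∈ A, v ∉ Ends x y → v ∉ A0 → T ≤ dg G v B0) (tB : ∀ v ∈ B, v ∉ Ends x y → v ∉ B0 → T ≤ dg G v A0)
    (rA : ∀ v ∈ Ends x y, dg G v A0 < 40 * h → v ∈ A) (rB : ∀ v ∈ Ends x y, dg G v B0 < 40 * h → v ∉ A)
    (wr : ∀ i, Wr x y N A i → ¬ (¬ dg G (x i) A0 < 40 * h ∧ ¬ dg G (x i) B0 < 40 * h) ∧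
      ¬ (¬ dg G (y i) A0 < 40 * h ∧ ¬ dg G (y i) B0 < 40 * h))
    (qA : -2 ≤ 4 * (k : ℤ) + ∑ i, (sg A (x i) + sg A (y i))
      - 4 * ((∑ i, fc x y A (fun v => ¬ dg G v A0 < 40 * h ∧ ¬ dg G v B0 < 40 * h) i : ℕ) : ℤ)
      - 2 * ((Finset.univ.filter (fun i => Wr x y N A i)).card : ℤ))
    (qB : -2 ≤ 4 * (k : ℤ) - ∑ i, (sg A (x i) + sg A (y i))
      - 4 * ((∑ i, fc x y B (fun v => ¬ dg G v A0 < 40 * h ∧ ¬ dg G v B0 < 40 * h) i : ℕ) : ℤ)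
      - 2 * ((Finset.univ.filter (fun i => Wr x y N A i)).card : ℤ)) :
    Bal G x y N o s A B A0 B0 h T (fun v => ¬ dg G v A0 < 40 * h ∧ ¬ dg G v B0 < 40 * h)
      (Finset.univ.filter (fun i => Wr x y N A i)).card ∧ A.card + B.card = Fintype.card V ∧
      A.card ≤ B.card + 2 * h ∧ B.card ≤ A.card + 2 * h := by
  have hk := g.hk
  have hs := g.hs
  have hT := g.hT
  have hn := g.hn
  have nA := g.nA
  have nB := g.nB
  have hk1 : 1 ≤ k := o.pos
  have hkT : T ≤ k * T := Nat.le_mul_of_pos_left _ hk1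
  have hkh : h ≤ k * h := Nat.le_mul_of_pos_left _ hk1
  have hdeg := fun v => core_deg (m := 2 * k) g.d g.nA g.nB g.S.deg v
  have hBA : ∀ v, v ∈ B → v ∉ A := fun v hv h' => (hAB v).1 h' hv
  have hd : Disjoint A B := by
    rw [Finset.disjoint_left]; intro v h1 h2; exact hBA v h2 h1
  have hu : A ∪ B = Finset.univ := by
    ext v; have := hAB v; simp only [Finset.mem_union, Finset.mem_univ, iff_true]
    by_cases hv : v ∈ B
    · exact Or.inr hv
    · exact Or.inl (this.2 hv)
  have hcard : A.card + B.card = Fintype.card V := by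
    rw [← Finset.card_union_of_disjoint hd, hu, Finset.card_univ]
  have cA := Finset.card_le_card sA
  have cB := Finset.card_le_card sB
  have dmA : ∀ v, dg G v A0 + ms G v A0 = A0.card := fun v => dg_ms G v A0
  have dmB : ∀ v, dg G v B0 + ms G v B0 = B0.card := fun v => dg_ms G v B0
  have coA : ∀ v ∈ A0, T ≤ dg G v B0 := by
    intro v hv; have := g.mA v hv; have := dmB v; omega
  have coB : ∀ v ∈ B0, T ≤ dg G v A0 := by
    intro v hv; have := g.mB v hv; have := dmA v; omega
  have TA : ∀ v ∈ A, v ∉ Ends x y → T ≤ dg G v B0 := by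
    intro v hv he
    by_cases h' : v ∈ A0
    exacts [coA v h', tA v hv he h']
  have TB : ∀ v ∈ B, v ∉ Ends x y → T ≤ dg G v A0 := by
    intro v hv he
    by_cases h' : v ∈ B0
    exacts [coB v h', tB v hv he h']
  have c : CB G x y A B A0 B0 h (40 * h) T :=
    { AB := hAB, sA := sA, sB := sB, mA := g.mA, mB := g.mB
      nA := by
        intro v hv
        by_cases he : v ∈ Ends x y
        · by_contra h'; exact rB v he (by omega) hv
        · have := TA v hv he; omega
      nB := by
        intro v hv
        by_cases he : v ∈ Ends x y
        · by_contra h'; exact hBA v hv (rA v he (by omega))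
        · have := TB v hv he; omega
      TA := TA, TB := TB, eA := g.eA, eB := g.eB, tA := by omega, tB := by omega
      cAA := by omega
      cAB := by omega
      cBA := by omega
      cBB := by omega }
  refine ⟨⟨g.S, c, ?_, wr, rfl, qA, qB, ?_, hk, hs, hT, by omega, by omega⟩, hcard, by omega, by omega⟩
  · intro v hv hF
    have e1 := hdeg v
    have e2 := dmA v
    have e3 := dmB v
    constructor
    · intro hvA
      have : ¬ dg G v B0 < 40 * h := fun h' => rB v hv h' hvA
      have : dg G v A0 < 40 * h := by by_contra h'; exact hF ⟨h', this⟩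
      omega
    · intro hvB
      have : ¬ dg G v A0 < 40 * h := fun h' => hBA v hvB (rA v hv h')
      have : dg G v B0 < 40 * h := by by_contra h'; exact hF ⟨this, h'⟩
      omega
  · obtain ⟨q, hq⟩ := par_aux (x := x) (y := y) N A
    rw [g.S.sum] at hq
    have : (A.card : ℤ) + B.card = Fintype.card V := by exact_mod_cast hcard
    exact ⟨q - B.card, by linarith⟩

lemma GC.done [Fintype V] {G : SimpleGraph V} {x y : Fin k → V} {N : Fin k → ℕ} {o : Fin k} {s : ℕ}
    {A0 B0 : Finset V} {h T : ℕ} (g : GC G x y N o s A0 B0 h T)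
    (slA : (∀ v ∈ A0, dg G v A0 < T) ∨ 6 * h ≤ (A0.filter (fun a => T ≤ dg G a A0)).card)
    (slB : (∀ v ∈ B0, dg G v B0 < T) ∨ 6 * h ≤ (B0.filter (fun a => T ≤ dg G a B0)).card) : Concl G x y N := by
  have hk := g.hk
  have hT := g.hT
  have hn := g.hn
  have hk1 : 1 ≤ k := o.pos
  have hkT : T ≤ k * T := Nat.le_mul_of_pos_left _ hk1
  have hkh : h ≤ k * h := Nat.le_mul_of_pos_left _ hk1
  have hdeg := fun v => core_deg (m := 2 * k) g.d g.nA g.nB g.S.deg v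
  have hdd : ∀ v, v ∈ A0 → v ∉ B0 := fun v h1 h2 => Finset.disjoint_left.1 g.d h1 h2
  obtain ⟨E, hE, hRE, hlk⟩ := likes g.S.inj N (fun v => dg G v A0 < 40 * h) (fun v => dg G v B0 < 40 * h) (by
    intro v; have := hdeg v; omega)
  set FA : Finset V := Finset.univ.filter (fun v => v ∉ Ends x y ∧ (v ∈ A0 ∨ (v ∉ B0 ∧ dg G v A0 < T))) with hFA
  set Φ : Finset V := Finset.univ.filter (fun v => v ∉ Ends x y ∧ v ∉ A0 ∧ v ∉ B0 ∧ T ≤ dg G v A0 ∧ T ≤ dg G v B0) with hΦ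
  have mFA : ∀ v, v ∈ FA ↔ v ∉ Ends x y ∧ (v ∈ A0 ∨ (v ∉ B0 ∧ dg G v A0 < T)) := by intro v; simp [hFA]
  have mΦ : ∀ v, v ∈ Φ ↔ v ∉ Ends x y ∧ v ∉ A0 ∧ v ∉ B0 ∧ T ≤ dg G v A0 ∧ T ≤ dg G v B0 := by intro v; simp [hΦ]
  have key : ∀ P ⊆ Φ, ∃ A B : Finset V, Bal G x y N o s A B A0 B0 h T (fun v => ¬ dg G v A0 < 40 * h ∧ ¬ dg G v B0 < 40 * h)
      (Finset.univ.filter (fun i => Wr x y N E i)).card ∧ ∑ i, (sg A (x i) + sg A (y i)) = ∑ i, (sg E (x i) + sg E (y i)) ∧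
      A.card + B.card = Fintype.card V ∧ A.card ≤ B.card + 2 * h ∧ B.card ≤ A.card + 2 * h ∧
      A.card = FA.card + E.card + P.card ∧ (∀ v, v ∈ A ↔ v ∈ FA ∨ v ∈ E ∨ v ∈ P) ∧ (∀ v, v ∈ A ↔ v ∉ B) := by
    intro P hP
    set A : Finset V := FA ∪ (E ∪ P) with hA
    have mA : ∀ v, v ∈ A ↔ v ∈ FA ∨ v ∈ E ∨ v ∈ P := by intro v; simp [hA]
    have hAB : ∀ v, v ∈ A ↔ v ∉ Finset.univ \ A := by intro v; simp
    have hAE : ∀ v ∈ Ends x y, v ∈ A ↔ v ∈ E := by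
      intro v hv
      rw [mA]
      refine ⟨fun h' => ?_, fun h' => Or.inr (Or.inl h')⟩
      rcases h' with h' | h' | h'
      · exact absurd hv ((mFA v).1 h').1
      · exact h'
      · exact absurd hv ((mΦ v).1 (hP h')).1
    obtain ⟨l1, l2, l3⟩ := hlk A (Finset.univ \ A) hAB hAE
    have hxE : ∀ i, x i ∈ A ↔ x i ∈ E := fun i => hAE _ (mem_Ends.2 ⟨i, Or.inl rfl⟩)
    have hyE : ∀ i, y i ∈ A ↔ y i ∈ E := fun i => hAE _ (mem_Ends.2 ⟨i, Or.inr rfl⟩)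
    have hWE : Finset.univ.filter (fun i => Wr x y N A i) = Finset.univ.filter (fun i => Wr x y N E i) := by
      refine Finset.filter_congr fun i _ => ?_
      unfold Wr; rw [hxE, hyE]
    have hsg : ∑ i, (sg A (x i) + sg A (y i)) = ∑ i, (sg E (x i) + sg E (y i)) := by
      refine Finset.sum_congr rfl fun i _ => ?_
      unfold sg; simp only [hxE, hyE]
    obtain ⟨b1, b2, b3, b4⟩ := g.bal (A := A) (B := Finset.univ \ A) hAB
      (fun v hv => (mA v).2 (Or.inl ((mFA v).2 ⟨g.eA v hv, Or.inl hv⟩)))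
      (fun v hv => by
        rw [Finset.mem_sdiff, mA]
        refine ⟨Finset.mem_univ _, ?_⟩
        rintro (h' | h' | h')
        · rcases ((mFA v).1 h').2 with h'' | h''
          · exact hdd v h'' hv
          · exact h''.1 hv
        · exact g.eB v hv (hE h')
        · exact ((mΦ v).1 (hP h')).2.2.1 hv)
      (fun v hv he ha => by
        rw [mA] at hv
        rcases hv with h' | h' | h'
        · rcases ((mFA v).1 h').2 with h'' | h''
          · exact absurd h'' ha
          · have := hdeg v; omega
        · exact absurd (hE h') he
        · exact ((mΦ v).1 (hP h')).2.2.2.2)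
      (fun v hv he hb => by
        rw [Finset.mem_sdiff, mA] at hv
        by_contra h'
        exact hv.2 (Or.inl ((mFA v).2 ⟨he, Or.inr ⟨hb, by omega⟩⟩)))
      (fun v hv h' => (hAE v hv).2 ((hRE v hv).1 h'))
      (fun v hv h' h'' => (hRE v hv).2 h' ((hAE v hv).1 h''))
      l1 l2 l3
    rw [hWE] at b1
    refine ⟨A, Finset.univ \ A, b1, hsg, b2, b3, b4, ?_, mA, hAB⟩
    rw [hA, Finset.card_union_of_disjoint, Finset.card_union_of_disjoint]
    · ring
    · rw [Finset.disjoint_left]; intro v h1 h2; exact ((mΦ v).1 (hP h2)).1 (hE h1)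
    · rw [Finset.disjoint_left]; intro v h1 h2
      have f1 := (mFA v).1 h1
      rcases Finset.mem_union.1 h2 with h3 | h3
      · exact f1.1 (hE h3)
      · have f2 := (mΦ v).1 (hP h3)
        rcases f1.2 with h4 | h4
        · exact f2.2.1 h4
        · omega
  obtain ⟨w, hw⟩ : ∃ w : ℕ, w = (Finset.univ.filter (fun i => Wr x y N E i)).card := ⟨_, rfl⟩
  obtain ⟨S, hSdef⟩ : ∃ S : ℤ, S = ∑ i, (sg E (x i) + sg E (y i)) := ⟨_, rfl⟩
  rw [← hw, ← hSdef] at key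
  obtain ⟨A, B, b, e1, e2, e3, e4, e5, e6, e7⟩ := key ∅ (Finset.empty_subset _)
  by_cases hII : 2 * (w : ℤ) < 2 * ((A.card : ℤ) - B.card) - ∑ i, (sg A (x i) + sg A (y i))
  · refine b.caseII hII e3 ?_
    rcases slA with h' | h'
    · left
      intro v hv
      rw [Finset.mem_sdiff, e6] at hv
      rcases hv.1 with h'' | h'' | h''
      · rcases ((mFA v).1 h'').2 with h3 | h3
        · exact h' v h3
        · exact h3.2
      · exact absurd (hE h'') hv.2
      · simp at h''
    · right; exact h'
  obtain ⟨A', B', b', e1', e2', e3', e4', e5', e6', e7'⟩ := key Φ (Finset.Subset.refl _)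
  by_cases hIII : 2 * (w : ℤ) < 2 * ((B'.card : ℤ) - A'.card) - ∑ i, (sg B' (x i) + sg B' (y i))
  · refine b'.symm.caseII hIII e4' ?_
    rcases slB with h' | h'
    · left
      intro v hv
      rw [Finset.mem_sdiff] at hv
      by_cases hvB : v ∈ B0
      · exact h' v hvB
      · have hvA : v ∉ A' := fun h'' => (e7' v).1 h'' hv.1
        rw [e6'] at hvA
        push Not at hvA
        by_contra hT'
        have hA0 : v ∉ A0 := fun h'' => hvA.1 ((mFA v).2 ⟨hv.2, Or.inl h''⟩)
        have : ¬ dg G v A0 < T := fun h'' => hvA.1 ((mFA v).2 ⟨hv.2, Or.inr ⟨hvB, h''⟩⟩)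
        exact hvA.2.2 ((mΦ v).2 ⟨hv.2, hA0, hvB, by omega, by omega⟩)
    · right; exact h'
  rw [e1] at hII
  rw [sgs_symm e7', e1'] at hIII
  rw [Finset.card_empty] at e5
  by_cases hI : -(2 * w : ℤ) ≤ 2 * ((A.card : ℤ) - B.card) - S
  · exact b.caseI (by rw [e1]; omega) (by rw [e1]; exact hI)
  · obtain ⟨q, hq⟩ := b.par
    rw [e1] at hq
    obtain ⟨j, hj⟩ : ∃ j : ℕ, (j : ℤ) = - q - w := ⟨(- q - w).toNat, by rw [Int.toNat_of_nonneg]; omega⟩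
    obtain ⟨P, hP, cP⟩ := Finset.exists_subset_card_eq (s := Φ) (n := j) (by omega)
    obtain ⟨A1, B1, b1, f1, f2, f3, f4, f5, f6, f7⟩ := key P hP
    exact b1.caseI (by rw [f1]; omega) (by rw [f1]; omega)

end
end W

namespace W
section
variable {V : Type} {k : ℕ}

lemma GC.shrink [Fintype V] {G : SimpleGraph V} {x y : Fin k → V} {N : Fin k → ℕ} {o : Fin k} {s : ℕ}
    {A0 B0 : Finset V} {h h' T : ℕ} (g : GC G x y N o s A0 B0 h T) (RA RB : Finset V)
    (hA : RA.card + h ≤ h') (hB : RB.card + h ≤ h') (hT : 1000 * (k * h') ≤ T) :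
    GC G x y N o s (A0 \ RA) (B0 \ RB) h' T := by
  have hk := g.hk
  have hs := g.hs
  have nA := g.nA
  have nB := g.nB
  have c1 := Finset.le_card_sdiff RA A0
  have c2 := Finset.le_card_sdiff RB B0
  refine ⟨g.S, g.d.mono Finset.sdiff_subset Finset.sdiff_subset, by omega, by omega, ?_, ?_, ?_, ?_, by omega, by omega, hT, g.hn⟩
  · intro a ha
    have := g.mA a (Finset.sdiff_subset ha)
    have h2 := ms_mono G a (Finset.sdiff_subset (s := B0) (t := RB))
    omega
  · intro a ha
    have := g.mB a (Finset.sdiff_subset ha)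
    have h2 := ms_mono G a (Finset.sdiff_subset (s := A0) (t := RA))
    omega
  · exact fun v hv => g.eA v (Finset.sdiff_subset hv)
  · exact fun v hv => g.eB v (Finset.sdiff_subset hv)

lemma shrink_ns {G : SimpleGraph V} (A0 : Finset V) (T : ℕ) :
    ∀ v ∈ A0 \ A0.filter (fun a => T ≤ dg G a A0), dg G v (A0 \ A0.filter (fun a => T ≤ dg G a A0)) < T := by
  intro v hv
  rw [Finset.mem_sdiff, Finset.mem_filter] at hv
  have h2 := dg_mono G v (Finset.sdiff_subset (s := A0) (t := A0.filter (fun a => T ≤ dg G a A0)))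
  by_contra h'
  exact hv.2 ⟨hv.1, by omega⟩

lemma GC.fin2 [Fintype V] {G : SimpleGraph V} {x y : Fin k → V} {N : Fin k → ℕ} {o : Fin k} {s : ℕ}
    {A0 B0 : Finset V} {h T : ℕ} (g : GC G x y N o s A0 B0 h T) (hT : 43000 * (k * h) ≤ T)
    (hb : (B0.filter (fun a => T ≤ dg G a B0)).card < 6 * h) : Concl G x y N := by
  by_cases ha : (A0.filter (fun a => T ≤ dg G a A0)).card < 42 * h
  · exact (g.shrink (h' := 43 * h) _ _ (by omega) (by omega) (by rw [show k * (43 * h) = 43 * (k * h) by ring]; omega)).done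
      (Or.inl (shrink_ns A0 T)) (Or.inl (shrink_ns B0 T))
  · have := g.shrink (h' := 7 * h) ∅ (B0.filter (fun a => T ≤ dg G a B0)) (by simp; omega) (by omega)
      (by rw [show k * (7 * h) = 7 * (k * h) by ring]; omega)
    rw [Finset.sdiff_empty] at this
    exact this.done (Or.inr (by omega)) (Or.inl (shrink_ns B0 T))

lemma caseB' [Fintype V] {G : SimpleGraph V} {x y : Fin k → V} {N : Fin k → ℕ} {o : Fin k} {s : ℕ}
    (hS : Setup G x y N o s) {A0 B0 : Finset V} {h : ℕ} (hd : Disjoint A0 B0)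
    (hA : Fintype.card V ≤ 2 * A0.card + 2 * h) (hB : Fintype.card V ≤ 2 * B0.card + 2 * h)
    (mA : ∀ a ∈ A0, ms G a B0 ≤ h) (mB : ∀ a ∈ B0, ms G a A0 ≤ h)
    (eA : ∀ v ∈ A0, v ∉ Ends x y) (eB : ∀ v ∈ B0, v ∉ Ends x y)
    (hk : 4 * k + 8 ≤ h) (hs : s ≤ h) (hn : 12900000 * (k * (k * h)) ≤ Fintype.card V) : Concl G x y N := by
  have g : GC G x y N o s A0 B0 h (43000 * (k * h)) :=
    ⟨hS, hd, hA, hB, mA, mB, eA, eB, hk, hs, by omega, by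
      rw [show 300 * (k * (43000 * (k * h))) = 12900000 * (k * (k * h)) by ring]; exact hn⟩
  by_cases hb : (B0.filter (fun a => 43000 * (k * h) ≤ dg G a B0)).card < 6 * h
  · exact g.fin2 le_rfl hb
  by_cases ha : (A0.filter (fun a => 43000 * (k * h) ≤ dg G a A0)).card < 6 * h
  · exact g.symm.fin2 le_rfl ha
  exact g.done (Or.inr (by omega)) (Or.inr (by omega))

/-- Combination: all parameters. -/
lemma combine [Fintype V] {G : SimpleGraph V} {x y : Fin k → V} {N : Fin k → ℕ} {o : Fin k} {s : ℕ}
    (hS : Setup G x y N o s) {e L h0 : ℕ}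
    (h1 : 4 * k + 4 * s + 4 ≤ e) (h2 : 2 * e < Fintype.card V) (h3 : 100 * Fintype.card V * (2 * s + 5) ≤ e * e)
    (h4 : e ≤ L) (h5 : e * Fintype.card V ≤ L * L) (h6 : L ≤ h0) (h7 : 5 * L * Fintype.card V ≤ h0 * h0)
    (h8 : 12900000 * (k * (k * (5 * h0))) ≤ Fintype.card V) : Concl G x y N := by
  have hk1 : 1 ≤ k := o.pos
  by_cases hstar : ∀ X Y : Finset V, Fintype.card V ≤ 2 * X.card + 2 * e → Fintype.card V ≤ 2 * Y.card + 2 * e →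
      e * Fintype.card V ≤ ∑ a ∈ X, (Y.filter (G.Adj a ·)).card
  · exact nonext hS hstar h1 h2 h3
  push Not at hstar
  obtain ⟨X, Y, hX, hY, hs⟩ := hstar
  obtain ⟨A0, B0, d, nA, nB, hm⟩ := extract (G := G) (e := e) (L := L) (h0 := h0) (X := X) (Y := Y)
    (fun v => by have := hS.deg v; unfold dg; omega) hX hY hs h4 (by omega) h5 h6 h7
  have cE := card_Ends x y
  have c1 := Finset.le_card_sdiff (Ends x y) A0
  have c2 := Finset.le_card_sdiff (Ends x y) B0
  have hd : Disjoint (A0 \ Ends x y) (B0 \ Ends x y) := d.mono Finset.sdiff_subset Finset.sdiff_subset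
  have eA : ∀ v ∈ A0 \ Ends x y, v ∉ Ends x y := fun v hv => (Finset.mem_sdiff.1 hv).2
  have eB : ∀ v ∈ B0 \ Ends x y, v ∉ Ends x y := fun v hv => (Finset.mem_sdiff.1 hv).2
  have mA := fun v => ms_mono G v (Finset.sdiff_subset (s := A0) (t := Ends x y))
  have mB := fun v => ms_mono G v (Finset.sdiff_subset (s := B0) (t := Ends x y))
  have hkk : k * (5 * h0) ≤ k * (k * (5 * h0)) := Nat.le_mul_of_pos_left _ hk1
  rcases hm with ⟨m1, m2⟩ | ⟨m1, m2⟩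
  · exact caseA' hS hd (h := 5 * h0) (by omega) (by omega)
      (fun a ha => by have := m1 a (Finset.sdiff_subset ha); have := mA a; omega)
      (fun a ha => by have := m2 a (Finset.sdiff_subset ha); have := mB a; omega) eA eB (by omega) (by omega) (by omega)
  · exact caseB' hS hd (h := 5 * h0) (by omega) (by omega)
      (fun a ha => by have := m1 a (Finset.sdiff_subset ha); have := mB a; omega)
      (fun a ha => by have := m2 a (Finset.sdiff_subset ha); have := mA a; omega) eA eB (by omega) (by omega) h8

end
end W

namespace W
section
variable {V : Type} {k : ℕ}

lemma final_numeric [Fintype V] {G : SimpleGraph V} {x y : Fin k → V} {N : Fin k → ℕ} {o : Fin k}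
    {s D c1 c2 c3 K : ℕ} (hk : 2 ≤ k) (hD : D = 64500000 * (k * k)) (hc1 : c1 = 280000 * D ^ 4)
    (hc2 : c2 = 20 * D ^ 2 * c1) (hc3 : c3 = 10 * D * c2) (hK : K = D * c3)
    (hn : K * s ≤ Fintype.card V) (hn' : Fintype.card V ≤ 2 * K * s) (hs : k ≤ s)
    (hS : Setup G x y N o s) : Concl G x y N := by
  have D1 : 100 ≤ D := by
    rw [hD]; nlinarith
  have c11 : 280000 ≤ c1 := by
    rw [hc1]; have := Nat.one_le_pow 4 D (by omega); omega
  have c12 : c1 ≤ c2 := by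
    rw [hc2]; have := Nat.one_le_pow 2 D (by omega); nlinarith
  have c23 : c2 ≤ c3 := by
    rw [hc3]; nlinarith
  have c3K : 100 * c3 ≤ K := by
    rw [hK]; exact Nat.mul_le_mul_right _ D1
  have q5 : c1 * (2 * K) = c2 * c2 := by
    rw [hK, hc3, hc2]; ring
  have q7 : 5 * c2 * (2 * K) = c3 * c3 := by
    rw [hK, hc3]; ring
  have q3 : 1400 * K = c1 * c1 := by
    rw [hK, hc3, hc2]; conv_rhs => rw [hc1]
    rw [hc1]; ring
  have sp : 1 ≤ s := by omega
  refine combine hS (e := c1 * s) (L := c2 * s) (h0 := c3 * s) ?_ ?_ ?_ ?_ ?_ ?_ ?_ ?_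
  · have := Nat.mul_le_mul_right s c11; omega
  · have := Nat.mul_le_mul_right s (show 3 * c1 ≤ K by omega)
    have h2 := Nat.mul_le_mul_right s c11
    have : 3 * (c1 * s) ≤ K * s := by rw [← mul_assoc]; exact this
    omega
  · calc 100 * Fintype.card V * (2 * s + 5) ≤ 100 * (2 * K * s) * (7 * s) := by
          apply Nat.mul_le_mul (Nat.mul_le_mul_left _ hn'); omega
      _ = (1400 * K) * (s * s) := by ring
      _ = c1 * s * (c1 * s) := by rw [q3]; ring
  · exact Nat.mul_le_mul_right _ c12
  · calc c1 * s * Fintype.card V ≤ c1 * s * (2 * K * s) := Nat.mul_le_mul_left _ hn'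
      _ = (c1 * (2 * K)) * (s * s) := by ring
      _ = c2 * s * (c2 * s) := by rw [q5]; ring
      _ ≤ _ := le_rfl
  · exact Nat.mul_le_mul_right _ c23
  · calc 5 * (c2 * s) * Fintype.card V ≤ 5 * (c2 * s) * (2 * K * s) := Nat.mul_le_mul_left _ hn'
      _ = (5 * c2 * (2 * K)) * (s * s) := by ring
      _ = c3 * s * (c3 * s) := by rw [q7]; ring
      _ ≤ _ := le_rfl
  · calc 12900000 * (k * (k * (5 * (c3 * s)))) = (64500000 * (k * k)) * c3 * s := by ring
      _ = K * s := by rw [← hD, ← hK]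
      _ ≤ _ := hn

theorem main (k : ℕ) (hk : 2 ≤ k) :
    ∃ (C₀ : ℕ) (α β : ℝ), 0 < α ∧ α < 1 ∧ 0 < β ∧ β < 1 ∧
      ∀ (V : Type) [Fintype V] (G : SimpleGraph V),
        C₀ * k ≤ Fintype.card V →
        (∀ v : V, (Fintype.card V : ℝ) / 2 + k ≤ ({u | G.Adj v u}.ncard : ℝ)) →
        ∀ x y : Fin k → V,
          (∀ i, G.Adj (x i) (y i)) →
          Function.Injective (Sum.elim x y : Fin k ⊕ Fin k → V) →
          ∀ N : Fin k → ℕ,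
            (∀ i, 5 ≤ N i) →
            (∑ i, N i) = Fintype.card V →
            (∑ i, if (N i : ℝ) < β * Fintype.card V then (N i : ℝ) else 0) ≤
              α * Fintype.card V →
            Concl G x y N := by
  obtain ⟨D, hD⟩ : ∃ D, D = 64500000 * (k * k) := ⟨_, rfl⟩
  obtain ⟨c1, hc1⟩ : ∃ c1, c1 = 280000 * D ^ 4 := ⟨_, rfl⟩
  obtain ⟨c2, hc2⟩ : ∃ c2, c2 = 20 * D ^ 2 * c1 := ⟨_, rfl⟩
  obtain ⟨c3, hc3⟩ : ∃ c3, c3 = 10 * D * c2 := ⟨_, rfl⟩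
  obtain ⟨K, hK⟩ : ∃ K, K = D * c3 := ⟨_, rfl⟩
  have D1 : 100 ≤ D := by rw [hD]; nlinarith
  have c1p : 0 < c1 := by rw [hc1]; positivity
  have c2p : 0 < c2 := by rw [hc2]; positivity
  have c3p : 0 < c3 := by rw [hc3]; positivity
  have K1 : 100 ≤ K := by rw [hK]; nlinarith
  have K1' : (100 : ℝ) ≤ K := by exact_mod_cast K1
  have Kp : (0 : ℝ) < K := by linarith
  have hα : 1 / (K : ℝ) ≤ 1 / 100 := one_div_le_one_div_of_le (by norm_num) K1'
  refine ⟨K, 1 / (K : ℝ), 3 / 4, by positivity, by linarith, by norm_num, by norm_num, ?_⟩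
  intro V _ G hn hdeg x y hadj hinj N h5 hsum hsm
  have nK : K * 2 ≤ Fintype.card V := (Nat.mul_le_mul_left K hk).trans hn
  have np : (0 : ℝ) < Fintype.card V := by
    have : 0 < Fintype.card V := by omega
    exact_mod_cast this
  have hsumR : ∑ i, (N i : ℝ) = Fintype.card V := by exact_mod_cast hsum
  obtain ⟨o, ho⟩ : ∃ o, 3 / 4 * (Fintype.card V : ℝ) ≤ N o := by
    by_contra hcon
    push Not at hcon
    rw [Finset.sum_congr rfl (fun i _ => if_pos (hcon i)), hsumR] at hsm
    nlinarith
  have hsplit : (N o : ℝ) + ∑ i ∈ Finset.univ.erase o, (N i : ℝ) = Fintype.card V := by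
    rw [← hsumR]; exact Finset.add_sum_erase _ (fun i => (N i : ℝ)) (Finset.mem_univ o)
  have hsmall : ∀ i ∈ Finset.univ.erase o, (N i : ℝ) < 3 / 4 * Fintype.card V := by
    intro i hi
    have := Finset.single_le_sum (f := fun i => (N i : ℝ)) (fun _ _ => Nat.cast_nonneg _) hi
    linarith
  have hle : ∑ i ∈ Finset.univ.erase o, (N i : ℝ) ≤ 1 / (K : ℝ) * Fintype.card V := by
    refine le_trans ?_ hsm
    rw [Finset.sum_congr rfl (fun i hi => (if_pos (hsmall i hi)).symm)]
    refine Finset.sum_le_sum_of_subset_of_nonneg (Finset.erase_subset _ _) fun i _ _ => ?_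
    split_ifs
    · exact Nat.cast_nonneg _
    · exact le_rfl
  have hleN : ∑ i ∈ Finset.univ.erase o, N i ≤ Fintype.card V / K := by
    rw [Nat.le_div_iff_mul_le (by omega)]
    have : (∑ i ∈ Finset.univ.erase o, (N i : ℝ)) * K ≤ Fintype.card V := by
      rw [one_div, inv_mul_eq_div, le_div_iff₀ Kp] at hle
      exact hle
    exact_mod_cast this
  have hks : k ≤ Fintype.card V / K := by
    rw [Nat.le_div_iff_mul_le (by omega), mul_comm]; exact hn
  have hdm := Nat.div_add_mod (Fintype.card V) K
  have hml := Nat.mod_lt (Fintype.card V) (show 0 < K by omega)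
  refine final_numeric (o := o) (s := Fintype.card V / K) hk hD hc1 hc2 hc3 hK (by omega) ?_ hks
    ⟨fun v => ?_, hadj, Inj_of hinj, h5, hsum, hleN⟩
  · have : K * 1 ≤ K * (Fintype.card V / K) := Nat.mul_le_mul_left _ (by omega)
    rw [mul_assoc]
    omega
  · have hv := hdeg v
    have e : ({u | G.Adj v u} : Set V).ncard = (Finset.univ.filter (fun w => G.Adj v w)).card := by
      rw [← Set.ncard_coe_finset]; congr 1; ext; simp
    rw [e] at hv
    have : (Fintype.card V : ℝ) + 2 * k ≤ 2 * ((Finset.univ.filter (fun w => G.Adj v w)).card : ℝ) := by linarith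
    exact_mod_cast this

end
end W

/-- **Corollary (Wang's conjecture for large graphs).**  For every integer `k ≥ 2` there
are an integer `C₀` and constants `α, β ∈ (0,1)` such that the following holds.  If `G`
is a graph on `n ≥ C₀ k` vertices with minimum degree at least `n/2 + k`, then for any
`k` pairwise vertex-disjoint edges `e i = {x i, y i}` of `G` and any integer partition
`n = n₁ + ⋯ + n_k` with each `nᵢ ≥ 5` and with the sum of those `nᵢ` smaller than `β n`
at most `α n`, `G` contains `k` vertex-disjoint cycles `C₁, …, C_k` of orders
`n₁, …, n_k` such that `Cᵢ` passes through `e i` for every `i`. -/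
theorem disjoint_cycles_through_prescribed_edges (k : ℕ) (hk : 2 ≤ k) :
    ∃ (C₀ : ℕ) (α β : ℝ), 0 < α ∧ α < 1 ∧ 0 < β ∧ β < 1 ∧
      ∀ (V : Type) [Fintype V] (G : SimpleGraph V),
        C₀ * k ≤ Fintype.card V →
        (∀ v : V, (Fintype.card V : ℝ) / 2 + k ≤ ({u | G.Adj v u}.ncard : ℝ)) →
        ∀ x y : Fin k → V,
          (∀ i, G.Adj (x i) (y i)) →
          Function.Injective (Sum.elim x y : Fin k ⊕ Fin k → V) →
          ∀ N : Fin k → ℕ,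
            (∀ i, 5 ≤ N i) →
            (∑ i, N i) = Fintype.card V →
            (∑ i, if (N i : ℝ) < β * Fintype.card V then (N i : ℝ) else 0) ≤
              α * Fintype.card V →
            ∃ c : Fin k → List V,
              (∀ i, IsCycleListGraph G (c i)) ∧
              (∀ i, (c i).length = N i) ∧
              (∀ i, (c i).head? = some (x i) ∧ (c i)[1]? = some (y i)) ∧
              (∀ i j, i ≠ j → ∀ v ∈ c i, v ∉ c j) := by
  exact W.main k hk
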